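/- Let K be a number field with K ≠ ℚ, R an order in K, and G a finite group. Then the group of units RG* of the group ring RG is virtually a direct product of finitely many free groups if and only if either G is abelian, or K is totally real and G is isomorphic to Q8 × A for A an elementary abelian 2-group. -/

import Mathlib

/-- An order in a finite-dimensional `ℚ`-algebra `A`: a subring that is finitely
generated as a `ℤ`-module and whose `ℚ`-span is all of `A`. -/
def IsOrderIn {A : Type} [Ring A] [Algebra ℚ A] (S : Subring A) : Prop :=
  S.toAddSubgroup.FG ∧ Submodule.span ℚ (S : Set A) = ⊤

/-- A group is virtually a direct product of finitely many free groups if it has a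
finite-index subgroup isomorphic to a finite direct product of free groups. -/
def IsVirtuallyDirectProductOfFreeGroups (Γ : Type) [Group Γ] : Prop :=
  ∃ H : Subgroup Γ, H.FiniteIndex ∧
    ∃ (m : ℕ) (X : Fin m → Type), Nonempty (↥H ≃* ∀ j, FreeGroup (X j))

namespace GRU

/-! ### Free groups -/

/-- The centre of a free group on at least two generators is trivial. -/
theorem free_center_trivial {α : Type*} {x y : α} (hxy : x ≠ y) (w : FreeGroup α)
    (hw : ∀ g, Commute w g) : w = 1 := by
  classical
  by_contra hne
  have hnil : w.toWord ≠ [] := by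
    intro h; exact hne (FreeGroup.toWord_eq_nil_iff.mp h)
  have hred := FreeGroup.isReduced_toWord (x := w)
  obtain ⟨hd, tl, hcons⟩ := List.exists_cons_of_ne_nil hnil
  -- choose a letter
  set la := w.toWord.getLast hnil with hla
  obtain ⟨l, hl1, hl2⟩ : ∃ l : α × Bool, l.1 ≠ hd.1 ∧ (l.1 = la.1 → l.2 = la.2) := by
    by_cases h : hd.1 = x
    · refine ⟨(y, la.2), ?_, fun _ => rfl⟩
      rw [h]; exact hxy.symm
    · exact ⟨(x, la.2), fun h' => h h'.symm, fun _ => rfl⟩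
  have key := hw (FreeGroup.mk [l])
  have hr1 : FreeGroup.IsReduced (l :: w.toWord) := by
    rw [hcons, FreeGroup.isReduced_cons_cons, ← hcons]
    exact ⟨fun h => absurd h hl1, hred⟩
  have hr2 : FreeGroup.IsReduced (w.toWord ++ [l]) := by
    unfold FreeGroup.IsReduced at hred ⊢
    rw [List.isChain_append]
    refine ⟨hred, by simp, ?_⟩
    intro a ha b hb
    simp only [List.head?_cons, Option.mem_def, Option.some.injEq] at hb
    subst hb
    have : a = la := by
      rw [List.getLast?_eq_getLast_of_ne_nil hnil] at ha
      simpa using ha.symm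
    subst this
    intro h; exact (hl2 h.symm).symm
  have e1 : (FreeGroup.mk [l] * w).toWord = l :: w.toWord := by
    rw [← FreeGroup.mk_toWord (x := w), FreeGroup.mul_mk, FreeGroup.toWord_mk,
      FreeGroup.mk_toWord]
    exact hr1.reduce_eq
  have e2 : (w * FreeGroup.mk [l]).toWord = w.toWord ++ [l] := by
    rw [← FreeGroup.mk_toWord (x := w), FreeGroup.mul_mk, FreeGroup.toWord_mk,
      FreeGroup.mk_toWord]
    exact hr2.reduce_eq
  rw [key.eq, e1, hcons] at e2
  simp only [List.cons_append, List.cons.injEq] at e2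
  exact hl1 (by rw [e2.1])

theorem isFree_center {F : Type*} [Group F] [IsFreeGroup F] (c : F) (hc : c ≠ 1)
    (h : ∀ g, Commute c g) : IsCyclic F := by
  let e := IsFreeGroup.toFreeGroup F
  have : Subsingleton (IsFreeGroup.Generators F) := by
    by_contra hns
    rw [not_subsingleton_iff_nontrivial] at hns
    obtain ⟨x, y, hxy⟩ := hns
    apply hc
    apply e.injective
    rw [map_one]
    apply free_center_trivial hxy
    intro g
    have := (h (e.symm g)).map e
    simpa using this
  have : IsCyclic (FreeGroup (IsFreeGroup.Generators F)) := by
    rcases isEmpty_or_nonempty (IsFreeGroup.Generators F) with h0 | ⟨⟨x⟩⟩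
    · infer_instance
    · have : Unique (IsFreeGroup.Generators F) := uniqueOfSubsingleton x
      infer_instance
  exact isCyclic_of_surjective e.symm e.symm.surjective

theorem free_centralizer_cyclic {F : Type*} [Group F] [IsFreeGroup F] (c : F) (hc : c ≠ 1) :
    IsCyclic (Subgroup.centralizer {c}) := by
  apply isFree_center (⟨c, by rw [Subgroup.mem_centralizer_singleton_iff]⟩ :
    Subgroup.centralizer {c})
  · intro h; exact hc (congrArg Subtype.val h)
  · rintro ⟨g, hg⟩
    rw [Subgroup.mem_centralizer_singleton_iff] at hg
    exact Subtype.ext hg.symm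

theorem free_gen {F : Type*} [Group F] [IsFreeGroup F] (c : F) (hc : c ≠ 1) :
    ∃ t : F, Commute c t ∧ ∀ g, Commute c g → ∃ k : ℤ, t ^ k = g := by
  obtain ⟨⟨t, ht⟩, hgen⟩ := (free_centralizer_cyclic c hc).exists_generator
  refine ⟨t, ?_, ?_⟩
  · rw [Subgroup.mem_centralizer_singleton_iff] at ht; exact ht.symm
  · intro g hg
    have hg' : g ∈ Subgroup.centralizer {c} := by
      rw [Subgroup.mem_centralizer_singleton_iff]; exact hg.symm
    obtain ⟨k, hk⟩ := Subgroup.mem_zpowers_iff.mp (hgen ⟨g, hg'⟩)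
    exact ⟨k, by simpa using congrArg Subtype.val hk⟩

theorem free_ct {F : Type*} [Group F] [IsFreeGroup F] {a b c : F} (ha : a ≠ 1)
    (hb : Commute a b) (hc : Commute a c) : Commute b c := by
  obtain ⟨t, -, ht⟩ := free_gen a ha
  obtain ⟨k, rfl⟩ := ht b hb
  obtain ⟨l, rfl⟩ := ht c hc
  exact (Commute.refl t).zpow_zpow k l

theorem free_tf (F : Type*) [Group F] [IsFreeGroup F] : IsMulTorsionFree F := by
  let e := IsFreeGroup.toFreeGroup F
  exact Function.Injective.isMulTorsionFree e.toMonoidHom e.injective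

theorem free_rel {F : Type*} [Group F] [IsFreeGroup F] {a b : F} (hab : Commute a b) :
    ∃ m n : ℤ, (m ≠ 0 ∨ n ≠ 0) ∧ a ^ m * b ^ n = 1 := by
  by_cases ha : a = 1
  · exact ⟨1, 0, by simp, by simp [ha]⟩
  obtain ⟨t, -, ht⟩ := free_gen a ha
  obtain ⟨k, rfl⟩ := ht a (Commute.refl a)
  obtain ⟨l, rfl⟩ := ht b hab
  have hk : k ≠ 0 := by rintro rfl; simp at ha
  refine ⟨l, -k, Or.inr (by simpa using hk), ?_⟩
  rw [← zpow_mul, ← zpow_mul, ← zpow_add]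
  have : k * l + l * (-k) = 0 := by ring
  rw [this, zpow_zero]

theorem free_csa {F : Type*} [Group F] [IsFreeGroup F] {c g : F} (hc : c ≠ 1)
    (h : Commute c (g * c * g⁻¹)) : Commute c g := by
  have := free_tf F
  obtain ⟨t, hct, ht⟩ := free_gen c hc
  have ht1 : t ≠ 1 := by
    rintro rfl
    obtain ⟨k, hk⟩ := ht c (Commute.refl c)
    exact hc (by simpa using hk.symm)
  have hc' : g * c * g⁻¹ ≠ 1 := by
    intro h'; exact hc (by simpa using h')
  have hconj : Commute (g * c * g⁻¹) (g * t * g⁻¹) := by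
    have := hct.map (MulAut.conj g)
    simpa using this
  have h1 : Commute c (g * t * g⁻¹) := free_ct hc' h.symm hconj
  obtain ⟨a, ha⟩ := ht _ h1
  -- the reverse
  have h2 : Commute c (g⁻¹ * c * g) := by
    have := h.map (MulAut.conj g⁻¹)
    simp only [MulAut.conj_apply, inv_inv] at this
    have e : g⁻¹ * (g * c * g⁻¹) * g = c := by group
    rw [e] at this
    exact this.symm
  have hc'' : g⁻¹ * c * g ≠ 1 := by
    intro h'; apply hc
    have : g * (g⁻¹ * c * g) * g⁻¹ = 1 := by rw [h']; simp
    have e : g * (g⁻¹ * c * g) * g⁻¹ = c := by group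
    rwa [e] at this
  have hconj' : Commute (g⁻¹ * c * g) (g⁻¹ * t * g) := by
    have := hct.map (MulAut.conj g⁻¹)
    simpa using this
  have h3 : Commute c (g⁻¹ * t * g) := free_ct hc'' h2.symm hconj'
  obtain ⟨b, hb⟩ := ht _ h3
  have hab : t ^ (a * b) = t := by
    have e : g * (t ^ b) * g⁻¹ = t := by rw [hb]; group
    rw [← conj_zpow, ← ha, ← zpow_mul] at e
    exact e
  have hab1 : a * b = 1 := by
    have : t ^ (a * b - 1) = 1 := by rw [zpow_sub, hab, zpow_one, mul_inv_cancel]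
    by_contra hne
    exact not_isOfFinOrder_of_isMulTorsionFree ht1
      (isOfFinOrder_iff_zpow_eq_one.mpr ⟨_, sub_ne_zero.mpr hne, this⟩)
  have htg : Commute t g := by
    rcases Int.eq_one_or_neg_one_of_mul_eq_one hab1 with h' | h'
    · rw [h', zpow_one] at ha
      have : t * g = g * t := by rw [eq_mul_inv_iff_mul_eq] at ha; exact ha
      exact this
    · rw [h', zpow_neg_one] at ha
      have e : g * t = t⁻¹ * g := by rw [eq_mul_inv_iff_mul_eq] at ha; exact ha.symm
      have e2 : Commute (g ^ 2) t := by
        have : g * g * t = t * (g * g) := by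
          rw [mul_assoc, e, ← mul_assoc]
          have : g * t⁻¹ = t * g := by
            have := congrArg (fun z => t * z * t⁻¹) e
            simp only [← mul_assoc, mul_inv_cancel, one_mul] at this
            rw [← this]
            group
          rw [this, mul_assoc]
        rw [sq]; exact this
      by_cases hg2 : g ^ 2 = 1
      · have : g = 1 := by simpa using hg2
        rw [this]; exact Commute.one_right t
      · exact free_ct hg2 e2 ((Commute.refl g).pow_left 2)
  obtain ⟨k, hk⟩ := ht c (Commute.refl c)
  rw [← hk]; exact htg.zpow_left k

/-! ### Products of free groups -/

theorem prod_central {m : ℕ} {X : Fin m → Type} (u v : ∀ j, FreeGroup (X j)) (huv : Commute u v)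
    (h : ∀ a b : ℤ, (a ≠ 0 ∨ b ≠ 0) → ∀ g, Commute g (u ^ a * v ^ b) → Commute g u) :
    ∀ g, Commute g u := by
  classical
  intro g
  funext j
  have hj : Commute (u j) (v j) := congrFun huv j
  obtain ⟨a, b, hab, hrel⟩ := free_rel hj
  have := h a b hab (Pi.mulSingle j (g j)) (by
    funext i
    by_cases hij : i = j
    · subst hij
      simp [hrel]
    · simp [Pi.mulSingle_eq_of_ne hij])
  have := congrFun this j
  simpa using this

theorem prod_embed {m : ℕ} {X : Fin m → Type} (N : Subgroup (∀ j, FreeGroup (X j)))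
    [hN : N.Normal] (γ δ : ∀ j, FreeGroup (X j)) (hγ : γ ∈ N) (hδ : δ ∈ N) (hne : ¬ Commute γ δ)
    (hD : ∀ a ∈ N, ∀ b ∈ N, ∀ c ∈ N, ¬ Commute a b → Commute c a → Commute c b → c = 1) :
    ∃ j, ∀ c ∈ N, c j = 1 → c = 1 := by
  classical
  obtain ⟨j, hj⟩ : ∃ j, ¬ Commute (γ j) (δ j) := by
    by_contra hcon
    push Not at hcon
    exact hne (funext fun j => hcon j)
  refine ⟨j, fun κ hκ hκj => ?_⟩
  -- the commutator element supported at `j`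
  let ι : FreeGroup (X j) →* (∀ j, FreeGroup (X j)) := MonoidHom.mulSingle (fun j => FreeGroup (X j)) j
  set c0 : FreeGroup (X j) := γ j * δ j * (γ j)⁻¹ * (δ j)⁻¹ with hc0
  have hc0ne : c0 ≠ 1 := by
    intro h
    apply hj
    rw [hc0, mul_inv_eq_one, mul_inv_eq_iff_eq_mul] at h
    exact h
  have hmem : ι c0 ∈ N := by
    have : ι c0 = γ * (ι (δ j) * γ⁻¹ * (ι (δ j))⁻¹) := by
      funext i
      by_cases hij : i = j
      · subst hij; simp [ι, hc0, mul_assoc]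
      · simp [ι, Pi.mulSingle_eq_of_ne hij]
    rw [this]
    exact N.mul_mem hγ (hN.conj_mem _ (N.inv_mem hγ) _)
  have hcomm : ∀ d, Commute κ (ι d) := by
    intro d
    funext i
    by_cases hij : i = j
    · subst hij; simp [ι, hκj]
    · simp [ι, Pi.mulSingle_eq_of_ne hij]
  have hconj : ∀ ε ∈ N, ι (ε j * c0 * (ε j)⁻¹) ∈ N := by
    intro ε hε
    have : ι (ε j * c0 * (ε j)⁻¹) = ε * ι c0 * ε⁻¹ := by
      funext i
      by_cases hij : i = j
      · subst hij; simp [ι]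
      · simp [ι, Pi.mulSingle_eq_of_ne hij]
    rw [this]
    exact hN.conj_mem _ hmem _
  have hιc : ∀ a b, Commute (ι a) (ι b) → Commute a b := by
    intro a b h
    have := congrFun h j
    exact (by simpa [ι] using this : a * b = b * a)
  by_cases h1 : Commute c0 (γ j * c0 * (γ j)⁻¹)
  · by_cases h2 : Commute c0 (δ j * c0 * (δ j)⁻¹)
    · exact absurd (free_ct hc0ne (free_csa hc0ne h1) (free_csa hc0ne h2)) hj
    · exact hD _ hmem _ (hconj δ hδ) κ hκ (fun h => h2 (hιc _ _ h)) (hcomm _) (hcomm _)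
  · exact hD _ hmem _ (hconj γ hγ) κ hκ (fun h => h1 (hιc _ _ h)) (hcomm _) (hcomm _)

end GRU

namespace GRU

/-! ### Dedekind groups -/

theorem comm_pow_left {G : Type*} [Group G] {x y c : G} (hxy : x * y = c * y * x)
    (hx : Commute c x) (n : ℕ) : x ^ n * y = c ^ n * y * x ^ n := by
  induction n with
  | zero => simp
  | succ n ih =>
    calc x ^ (n + 1) * y = x ^ n * (x * y) := by rw [pow_succ, mul_assoc]
      _ = (x ^ n * c) * y * x := by rw [hxy]; simp only [mul_assoc]
      _ = c * (x ^ n * y) * x := by rw [← (hx.pow_right n).eq]; simp only [mul_assoc]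
      _ = _ := by rw [ih, pow_succ', pow_succ]; simp only [mul_assoc]

theorem mul_pow_class2 {G : Type*} [Group G] {X y d : G} (h : y * X = d * X * y)
    (hX : Commute d X) (hy : Commute d y) (n : ℕ) :
    (X * y) ^ n = X ^ n * y ^ n * d ^ (n * (n - 1) / 2) := by
  induction n with
  | zero => simp
  | succ n ih =>
    have e : (n + 1) * (n + 1 - 1) / 2 = n * (n - 1) / 2 + n := by
      rw [Nat.triangle_succ]
    have h2 := comm_pow_left h hy n
    rw [pow_succ, ih, e, pow_add d, pow_succ X, pow_succ y]
    set T := n * (n - 1) / 2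
    have hT : d ^ T * (X * y) = (X * y) * d ^ T := ((hX.mul_right hy).pow_left T).eq
    have hn : d ^ n * X = X * d ^ n := (hX.pow_left n).eq
    have hny : d ^ n * y = y * d ^ n := (hy.pow_left n).eq
    have hny' : d ^ n * y ^ n = y ^ n * d ^ n := ((hy.pow_left n).pow_right n).eq
    have hTn : d ^ T * d ^ n = d ^ n * d ^ T := by rw [← pow_add, ← pow_add, add_comm]
    calc X ^ n * y ^ n * d ^ T * (X * y) = X ^ n * (y ^ n * X) * y * d ^ T := by
          rw [mul_assoc _ (d ^ T), hT]; simp only [mul_assoc]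
      _ = X ^ n * (d ^ n * X) * y ^ n * y * d ^ T := by rw [h2]; simp only [mul_assoc]
      _ = X ^ n * X * (d ^ n * y ^ n) * y * d ^ T := by rw [hn]; simp only [mul_assoc]
      _ = X ^ n * X * y ^ n * (d ^ n * y) * d ^ T := by rw [hny']; simp only [mul_assoc]
      _ = X ^ n * X * (y ^ n * y) * (d ^ n * d ^ T) := by rw [hny]; simp only [mul_assoc]
      _ = _ := by rw [← hTn]

theorem mem_zpowers_of_pow {G : Type*} [Group G] {x c : G} {p a : ℕ} (hp : p.Prime)
    (hx : orderOf x = p ^ (a + 1)) (hc : c ^ p = 1) (hcx : ∃ k : ℤ, x ^ k = c) :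
    ∃ k : ℤ, (x ^ (p ^ a)) ^ k = c := by
  obtain ⟨m, rfl⟩ := hcx
  have : ((p ^ (a + 1) : ℕ) : ℤ) ∣ m * p := by
    rw [← hx, orderOf_dvd_iff_zpow_eq_one, zpow_mul, zpow_natCast]; exact hc
  have hp0 : (p : ℤ) ≠ 0 := by exact_mod_cast hp.ne_zero
  have h2 : ((p ^ a : ℕ) : ℤ) ∣ m := by
    rw [pow_succ] at this
    push_cast at this ⊢
    exact (mul_dvd_mul_iff_right hp0).mp this
  obtain ⟨k, rfl⟩ := h2
  exact ⟨k, by rw [zpow_mul, zpow_natCast]⟩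

theorem ded_aux {G : Type*} [Group G] [Finite G]
    (hD : ∀ g h : G, ∃ k : ℤ, h * g * h⁻¹ = g ^ k) (x y : G) (hxy : ¬ Commute x y)
    (hmin : ∀ x' y' : G, ¬ Commute x' y' → orderOf x + orderOf y ≤ orderOf x' + orderOf y')
    (hle : orderOf y ≤ orderOf x) :
    ∃ i j : G, i ^ 2 = j ^ 2 ∧ i ^ 4 = 1 ∧ i ^ 2 ≠ 1 ∧ j * i * j⁻¹ = i⁻¹ := by
  obtain ⟨c, hc⟩ : ∃ c, c = x * y * x⁻¹ * y⁻¹ := ⟨_, rfl⟩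
  have hrel : x * y = c * y * x := by rw [hc]; group
  have hcx : ∃ k : ℤ, x ^ k = c := by
    obtain ⟨k, hk⟩ := hD x y
    refine ⟨1 - k, ?_⟩
    rw [hc, zpow_sub, zpow_one, ← hk]; group
  have hcy : ∃ k : ℤ, y ^ k = c := by
    obtain ⟨k, hk⟩ := hD y x
    refine ⟨k - 1, ?_⟩
    rw [hc, zpow_sub, zpow_one, ← hk]
  have hcommx : Commute c x := by
    obtain ⟨k, hk⟩ := hcx
    rw [← hk]; exact (Commute.refl x).zpow_left k
  have hcommy : Commute c y := by
    obtain ⟨k, hk⟩ := hcy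
    rw [← hk]; exact (Commute.refl y).zpow_left k
  have hc1 : c ≠ 1 := by
    rintro rfl
    apply hxy
    show x * y = y * x
    rw [hrel, one_mul]
  have hrel' : y * x = c⁻¹ * x * y := by rw [mul_assoc, hrel]; group
  have hqx : ∀ q : ℕ, q.Prime → q ∣ orderOf x → c ^ q = 1 := by
    intro q hq hdvd
    have hlt : orderOf (x ^ q) < orderOf x := by
      rw [orderOf_pow_of_dvd hq.ne_zero hdvd]
      exact Nat.div_lt_self (orderOf_pos x) hq.one_lt
    have : Commute (x ^ q) y := by
      by_contra h
      have := hmin _ _ h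
      omega
    have e := comm_pow_left hrel hcommx q
    rw [this.eq, mul_assoc] at e
    simpa using e.symm
  have hqy : ∀ q : ℕ, q.Prime → q ∣ orderOf y → c ^ q = 1 := by
    intro q hq hdvd
    have hlt : orderOf (y ^ q) < orderOf y := by
      rw [orderOf_pow_of_dvd hq.ne_zero hdvd]
      exact Nat.div_lt_self (orderOf_pos y) hq.one_lt
    have : Commute x (y ^ q) := by
      by_contra h
      have := hmin _ _ h
      omega
    have e := comm_pow_left hrel' hcommy.inv_left q
    rw [← this.eq, mul_assoc] at e
    simpa using e.symm
  have hx1 : orderOf x ≠ 1 := by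
    intro h
    rw [orderOf_eq_one_iff] at h
    subst h
    exact hxy (Commute.one_left y)
  have hy1 : orderOf y ≠ 1 := by
    intro h
    rw [orderOf_eq_one_iff] at h
    subst h
    exact hxy (Commute.one_right x)
  obtain ⟨p, hp, hpx⟩ := Nat.exists_prime_and_dvd hx1
  have hcp := hqx p hp hpx
  have hoc : orderOf c = p := by
    have := Fact.mk hp
    exact orderOf_eq_prime hcp hc1
  have huniq : ∀ q : ℕ, q.Prime → c ^ q = 1 → q = p := by
    intro q hq h
    have := orderOf_dvd_of_pow_eq_one h
    rw [hoc] at this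
    exact ((Nat.prime_dvd_prime_iff_eq hp hq).mp this).symm
  obtain ⟨a, ha⟩ : ∃ a, orderOf x = p ^ (a + 1) := by
    have h := Nat.eq_prime_pow_of_unique_prime_dvd (orderOf_pos x).ne'
      (fun {d} hd hdx => huniq d hd (hqx d hd hdx))
    generalize (orderOf x).primeFactorsList.length = r at h
    cases r with
    | zero => exact absurd h hx1
    | succ a => exact ⟨a, h⟩
  obtain ⟨b, hb⟩ : ∃ b, orderOf y = p ^ (b + 1) := by
    have h := Nat.eq_prime_pow_of_unique_prime_dvd (orderOf_pos y).ne'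
      (fun {d} hd hdx => huniq d hd (hqy d hd hdx))
    generalize (orderOf y).primeFactorsList.length = r at h
    cases r with
    | zero => exact absurd h hy1
    | succ a => exact ⟨a, h⟩
  have hab : b ≤ a := by
    rw [ha, hb] at hle
    have := (Nat.pow_le_pow_iff_right hp.one_lt).mp hle
    omega
  obtain ⟨r, hr⟩ := mem_zpowers_of_pow hp ha hcp hcx
  obtain ⟨m, hm⟩ := mem_zpowers_of_pow hp hb hcp hcy
  obtain ⟨n, hn⟩ : ∃ n, n = p ^ b := ⟨_, rfl⟩
  rw [← hn] at hm
  have hdp : (y ^ n) ^ p = 1 := by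
    rw [← pow_mul, hn, ← pow_succ, ← hb, pow_orderOf_eq_one]
  obtain ⟨s, hs⟩ : ∃ s : ℤ, y ^ n = c ^ s := by
    have hcop : IsCoprime m (p : ℤ) := by
      rw [isCoprime_comm]
      refine (Prime.coprime_iff_not_dvd (Nat.prime_iff_prime_int.mp hp)).mpr ?_
      rintro ⟨k, rfl⟩
      rw [zpow_mul, zpow_natCast, hdp, one_zpow] at hm
      exact hc1 hm.symm
    obtain ⟨s, t, hst⟩ := hcop
    refine ⟨s, ?_⟩
    rw [← hm, ← zpow_mul]
    have : m * s = 1 - p * t := by linarith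
    rw [this, zpow_sub, zpow_one, zpow_mul, zpow_natCast, hdp, one_zpow, inv_one, mul_one]
  -- the new element
  obtain ⟨e, he⟩ : ∃ e : ℤ, e = (p : ℤ) ^ (a - b) * (r * s) := ⟨_, rfl⟩
  have hyn : y ^ n = x ^ (e * n) := by
    rw [hs, ← hr, ← zpow_natCast, ← zpow_mul, ← zpow_mul, he, hn]
    congr 1
    push_cast
    have : (p : ℤ) ^ a = (p : ℤ) ^ (a - b) * (p : ℤ) ^ b := by
      rw [← pow_add]; congr 1; omega
    rw [this]; ring
  have hXy : ∀ k : ℤ, y * x ^ k = (c ^ (-k)) * x ^ k * y := by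
    intro k
    have h1 : y * x * y⁻¹ = c⁻¹ * x := by rw [hrel']; group
    have h2 : y * x ^ k * y⁻¹ = c ^ (-k) * x ^ k := by
      rw [← conj_zpow, h1, (hcommx.inv_left).mul_zpow, inv_zpow, zpow_neg]
    rw [← h2]; group
  have hform := mul_pow_class2 (hXy (-e)) ((hcommx.zpow_left _).zpow_right _)
    (hcommy.zpow_left _) n
  have hne : ¬ Commute x (x ^ (-e) * y) := by
    intro h
    apply hxy
    have h2 : Commute x (x ^ e * (x ^ (-e) * y)) := ((Commute.refl x).zpow_right e).mul_right h
    have e2 : x ^ e * (x ^ (-e) * y) = y := by group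
    rwa [e2] at h2
  have hny1 : (x ^ (-e) * y) ^ n ≠ 1 := by
    intro h
    have h1 := hmin _ _ hne
    have h2 : orderOf (x ^ (-e) * y) ≤ n := by
      apply orderOf_le_of_pow_eq_one _ h
      rw [hn]; exact pow_pos hp.pos b
    have h3 : n < orderOf y := by
      rw [hb, hn]; exact Nat.pow_lt_pow_right hp.one_lt (Nat.lt_succ_self b)
    omega
  rw [hform, hyn] at hny1
  have e3 : (x ^ (-e)) ^ n * x ^ (e * n) = 1 := by
    rw [← zpow_natCast, ← zpow_mul, ← zpow_add]
    have : -e * n + e * n = 0 := by ring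
    rw [this, zpow_zero]
  rw [e3, one_mul, neg_neg, ← zpow_natCast, ← zpow_mul] at hny1
  have hndvd : ¬ (p : ℤ) ∣ e * ((n * (n - 1) / 2 : ℕ) : ℤ) := by
    rintro ⟨k, hk⟩
    apply hny1
    rw [hk, zpow_mul, zpow_natCast, hcp, one_zpow]
  have hnd1 : ¬ (p : ℤ) ∣ e := fun h => hndvd (h.mul_right _)
  have hnd2 : ¬ p ∣ n * (n - 1) / 2 := fun h =>
    hndvd ((Int.natCast_dvd_natCast.mpr h).mul_left _)
  have hab' : a = b := by
    by_contra hne'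
    apply hnd1
    rw [he]
    exact (dvd_pow_self _ (by omega)).mul_right _
  have htwo : 2 * (n * (n - 1) / 2) = n * (n - 1) := by
    apply Nat.mul_div_cancel'
    exact (Nat.even_mul_pred_self n).two_dvd
  have hb0 : b ≠ 0 := by
    rintro rfl
    apply hnd2
    rw [hn]; simp
  have hpn : p ∣ n := by rw [hn]; exact dvd_pow_self p hb0
  have hp2 : p = 2 := by
    by_contra h
    apply hnd2
    have hc2 : Nat.Coprime p 2 := (Nat.coprime_primes hp Nat.prime_two).mpr h
    apply hc2.dvd_of_dvd_mul_left
    rw [htwo]; exact hpn.mul_right _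
  subst hp2
  have hb1 : b = 1 := by
    by_contra h
    apply hnd2
    have h4 : 4 ∣ n := by
      rw [hn]; exact pow_dvd_pow 2 (by omega : 2 ≤ b)
    obtain ⟨k, hk⟩ := h4
    have : 2 * (n * (n - 1) / 2) = 2 * (2 * (k * (n - 1))) := by
      rw [htwo]; nth_rewrite 1 [hk]; ring
    exact ⟨k * (n - 1), by omega⟩
  subst hb1
  subst hab'
  have hx4 : x ^ 4 = 1 := by
    have := pow_orderOf_eq_one x
    rw [ha] at this; simpa using this
  have hx2 : x ^ 2 ≠ 1 := by
    intro h
    have := orderOf_dvd_of_pow_eq_one h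
    rw [ha] at this
    norm_num at this
  have hpar : ∀ (d : G) (k : ℤ), d ^ 2 = 1 → d ^ k ≠ 1 → d ^ k = d := by
    intro d k hd hk
    rcases Int.even_or_odd k with ⟨l, hl⟩ | ⟨l, hl⟩
    · exfalso; apply hk
      rw [hl, ← two_mul, zpow_mul]
      have : d ^ (2 : ℤ) = 1 := by exact_mod_cast hd
      rw [this, one_zpow]
    · rw [hl, zpow_add, zpow_mul, zpow_one]
      have : d ^ (2 : ℤ) = 1 := by exact_mod_cast hd
      rw [this, one_zpow, one_mul]
  have hcx2 : x ^ 2 = c := by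
    have hr' : (x ^ 2) ^ r = c := by simpa using hr
    rw [← hr']
    refine (hpar (x ^ 2) r (by rw [← pow_mul]; exact hx4) ?_).symm
    rw [hr']; exact hc1
  have hcy2 : y ^ 2 = c := by
    have hn2 : n = 2 := by rw [hn]; norm_num
    subst hn2
    rw [← hm]
    refine (hpar (y ^ 2) m hdp ?_).symm
    rw [hm]; exact hc1
  refine ⟨x, y, by rw [hcx2, hcy2], hx4, hx2, ?_⟩
  have : c⁻¹ = c := by
    rw [inv_eq_iff_mul_eq_one, ← sq]; exact hcp
  rw [hrel', this, ← hcx2, mul_assoc, mul_inv_cancel, mul_one]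
  rw [eq_inv_iff_mul_eq_one, ← pow_succ, ← pow_succ]
  exact hx4

theorem ded_q8 {G : Type*} [Group G] [Finite G]
    (hD : ∀ g h : G, ∃ k : ℤ, h * g * h⁻¹ = g ^ k) (hna : ∃ x y : G, ¬ Commute x y) :
    ∃ i j : G, i ^ 2 = j ^ 2 ∧ i ^ 4 = 1 ∧ i ^ 2 ≠ 1 ∧ j * i * j⁻¹ = i⁻¹ := by
  classical
  have hex : ∃ n : ℕ, ∃ x y : G, ¬ Commute x y ∧ orderOf x + orderOf y = n := by
    obtain ⟨x, y, h⟩ := hna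
    exact ⟨_, x, y, h, rfl⟩
  obtain ⟨x, y, hxy, hn⟩ := Nat.find_spec hex
  have hmin : ∀ x' y' : G, ¬ Commute x' y' → orderOf x + orderOf y ≤ orderOf x' + orderOf y' := by
    intro x' y' h
    rw [hn]
    exact Nat.find_min' hex ⟨x', y', h, rfl⟩
  rcases le_total (orderOf y) (orderOf x) with h | h
  · exact ded_aux hD x y hxy hmin h
  · refine ded_aux hD y x (fun h' => hxy h'.symm) ?_ h
    intro x' y' h'
    rw [add_comm (orderOf y)]
    exact hmin x' y' h'

end GRU

namespace GRU

open QuaternionGroup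

/-- The homomorphism from `ZMod 4` given by an element with `i ^ 4 = 1`. -/
noncomputable def z4 {G : Type*} [Group G] (i : G) (h : i ^ 4 = 1) : ZMod (2 * 2) →+ Additive G :=
  ZMod.lift (2 * 2) ⟨zmultiplesHom (Additive G) (Additive.ofMul i), by
    simp only [zmultiplesHom_apply]
    rw [← ofMul_zpow]
    have : i ^ ((2 * 2 : ℕ) : ℤ) = 1 := by rw [zpow_natCast]; exact h
    rw [this]; rfl⟩

theorem z4_int {G : Type*} [Group G] (i : G) (h : i ^ 4 = 1) (k : ℤ) :
    (z4 i h (k : ZMod (2 * 2))).toMul = i ^ k := by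
  rw [z4, ZMod.lift_coe]
  simp [zmultiplesHom_apply]

/-- The homomorphism from the quaternion group determined by two elements. -/
noncomputable def q8hom {G : Type*} [Group G] (i j : G) (h1 : i ^ 2 = j ^ 2) (h2 : i ^ 4 = 1)
    (h3 : j * i * j⁻¹ = i⁻¹) : QuaternionGroup 2 →* G where
  toFun q := match q with
    | a k => (z4 i h2 k).toMul
    | xa k => j * (z4 i h2 k).toMul
  map_one' := by
    show (z4 i h2 0).toMul = 1
    rw [map_zero]; rfl
  map_mul' := by
    have key : ∀ k : ZMod (2 * 2), (z4 i h2 k).toMul * j = j * (z4 i h2 (-k)).toMul := by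
      intro k
      obtain ⟨k, rfl⟩ := ZMod.intCast_surjective k
      rw [← Int.cast_neg, z4_int, z4_int]
      have h4 : j⁻¹ * i * j = i⁻¹ := by
        have h5 : i = j⁻¹ * i⁻¹ * j := by rw [← h3]; group
        calc j⁻¹ * i * j = (j⁻¹ * i⁻¹ * j)⁻¹ := by group
          _ = i⁻¹ := by rw [← h5]
      have : j⁻¹ * i ^ k * j = i ^ (-k) := by
        have := conj_zpow (i := k) (a := j⁻¹) (b := i)
        rw [inv_inv, h4] at this
        rw [← this, zpow_neg, inv_zpow]
      rw [← this]; group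
    have h2' : (z4 i h2 ((2 : ℕ) : ZMod (2 * 2))).toMul = j * j := by
      have := z4_int i h2 2
      exact (by exact_mod_cast this : _ = i ^ 2).trans (h1.trans (sq j))
    rintro (k | k) (l | l)
    · show (z4 i h2 (k + l)).toMul = _
      rw [map_add]; rfl
    · show j * (z4 i h2 (l - k)).toMul = (z4 i h2 k).toMul * (j * (z4 i h2 l).toMul)
      rw [← mul_assoc, key, sub_eq_neg_add, map_add, toMul_add, mul_assoc]
    · show j * (z4 i h2 (k + l)).toMul = j * (z4 i h2 k).toMul * (z4 i h2 l).toMul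
      rw [map_add, toMul_add, mul_assoc]
    · show (z4 i h2 (((2 : ℕ) : ZMod (2 * 2)) + l - k)).toMul =
        j * (z4 i h2 k).toMul * (j * (z4 i h2 l).toMul)
      rw [add_sub_assoc, map_add (z4 i h2), sub_eq_neg_add, map_add (z4 i h2), toMul_add, toMul_add, h2',
        mul_assoc j (z4 i h2 k).toMul, ← mul_assoc (z4 i h2 k).toMul j, key]
      simp only [mul_assoc]

/-- The structure of a finite non-abelian group in which all cyclic subgroups are normal. -/
theorem ded_struct {G : Type*} [Group G] [Finite G]
    (hD : ∀ g h : G, ∃ k : ℤ, h * g * h⁻¹ = g ^ k) (hna : ∃ x y : G, ¬ Commute x y) :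
    ∃ (ψ : QuaternionGroup 2 →* G) (C : Subgroup G), Function.Injective ψ ∧
      (∀ q, ∀ c ∈ C, Commute (ψ q) c) ∧ (∀ c ∈ C, ∀ d ∈ C, Commute c d) ∧
      (∀ g, ∃ q, ∃ c ∈ C, g = ψ q * c) ∧ (∀ q, ψ q ∈ C → q = 1 ∨ q = a 2) ∧
      ψ (a 2) ∈ C ∧ (∀ c ∈ C, c ^ 4 = 1 → c ^ 2 = 1) := by
  obtain ⟨i, j, h1, h2, hne, h3⟩ := ded_q8 hD hna
  let ψ := q8hom i j h1 h2 h3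
  have hψi : ψ (a 1) = i := by
    have := z4_int i h2 1
    rw [Int.cast_one, zpow_one] at this
    exact this
  have hψj : ψ (xa 0) = j := by
    show j * (z4 i h2 0).toMul = j
    simp
  have hψ2 : ψ (a 2) = i ^ 2 := by
    have := z4_int i h2 2
    exact_mod_cast this
  have hψinj : Function.Injective ψ := by
    rw [injective_iff_map_eq_one]
    have hz : ∀ q : QuaternionGroup 2, q = 1 ∨ q ^ 2 = a 2 ∨ q = a 2 := by decide
    intro q hq
    rcases hz q with h | h | h
    · exact h
    · exfalso; apply hne
      rw [← hψ2, ← h, map_pow, hq, one_pow]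
    · exfalso; apply hne
      rw [← hψ2, ← h, hq]
  have hij : ∀ q : QuaternionGroup 2, q ∈ Subgroup.closure {a 1, xa 0} := by
    have e : ∀ q : QuaternionGroup 2, ∃ k l : Fin 4, q = xa 0 ^ (l : ℕ) * a 1 ^ (k : ℕ) := by decide
    intro q
    obtain ⟨k, l, h⟩ := e q
    rw [h]
    exact mul_mem (pow_mem (Subgroup.subset_closure (by simp)) _)
      (pow_mem (Subgroup.subset_closure (by simp)) _)
  let C := Subgroup.centralizer ({i, j} : Set G)
  have hC : ∀ c, c ∈ C ↔ Commute i c ∧ Commute j c := by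
    intro c
    simp only [C, Subgroup.mem_centralizer_iff, Set.mem_insert_iff, Set.mem_singleton_iff,
      forall_eq_or_imp, forall_eq]
    rfl
  have hcomm : ∀ q, ∀ c ∈ C, Commute (ψ q) c := by
    intro q c hc
    rw [hC] at hc
    have := hij q
    induction this using Subgroup.closure_induction with
    | mem x hx =>
      rcases hx with rfl | hx
      · rw [hψi]; exact hc.1
      · rw [Set.mem_singleton_iff] at hx; subst hx; rw [hψj]; exact hc.2
    | one => rw [map_one]; exact Commute.one_left c
    | mul x y _ _ hx hy => rw [map_mul]; exact hx.mul_left hy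
    | inv x _ hx => rw [map_inv]; exact hx.inv_left
  have hord4 : ∀ c ∈ C, c ^ 4 = 1 → c ^ 2 = 1 := by
    intro c hc hc4
    rw [hC] at hc
    by_contra hc2
    obtain ⟨k, hk⟩ := hD (i * c) j
    have e1 : j * (i * c) * j⁻¹ = i⁻¹ * c := by
      have : j * (i * c) * j⁻¹ = (j * i * j⁻¹) * (j * c * j⁻¹) := by group
      rw [this, h3, hc.2.eq]; group
    rw [e1, hc.1.mul_zpow] at hk
    -- `i⁻¹ * c = i ^ k * c ^ k`
    have hk2 : i ^ (k + 1) = c ^ (1 - k) := by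
      have : c = i * (i ^ k * c ^ k) := by rw [← hk]; group
      have h' : c * c ^ (-k) = i * i ^ k := by
        nth_rewrite 1 [this]; group
      rw [zpow_add, zpow_one, (Commute.refl i).zpow_left k |>.eq, ← h', zpow_sub, zpow_one, zpow_neg]
    have hi4 : i ^ (4 : ℤ) = 1 := by exact_mod_cast h2
    have hc4' : c ^ (4 : ℤ) = 1 := by exact_mod_cast hc4
    have hmod : ∀ g : G, g ^ (4 : ℤ) = 1 → ∀ m : ℤ, g ^ m = g ^ (m % 4) := by
      intro g hg m
      conv_lhs => rw [← Int.emod_add_mul_ediv m 4, zpow_add, zpow_mul, hg, one_zpow, mul_one]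
    rw [hmod i hi4, hmod c hc4'] at hk2
    have hinc : ¬ Commute j i := by
      intro h
      rw [h.eq, mul_inv_cancel_right, eq_inv_iff_mul_eq_one, ← sq] at h3
      exact hne h3
    have hcases : k % 4 = 0 ∨ k % 4 = 1 ∨ k % 4 = 2 ∨ k % 4 = 3 := by omega
    rcases hcases with h | h | h | h
    · have e1 : (k + 1) % 4 = 1 := by omega
      have e2 : (1 - k) % 4 = 1 := by omega
      rw [e1, e2, zpow_one, zpow_one] at hk2
      apply hinc; rw [hk2]; exact hc.2
    · have e1 : (k + 1) % 4 = 2 := by omega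
      have e2 : (1 - k) % 4 = 0 := by omega
      rw [e1, e2, zpow_zero] at hk2
      exact hne (by exact_mod_cast hk2)
    · have e1 : (k + 1) % 4 = 3 := by omega
      have e2 : (1 - k) % 4 = 3 := by omega
      rw [e1, e2] at hk2
      have : i = c := by
        have hi : i = (i ^ (3 : ℤ))⁻¹ := by
          rw [eq_inv_iff_mul_eq_one, ← zpow_one_add]; exact hi4
        have hcc : c = (c ^ (3 : ℤ))⁻¹ := by
          rw [eq_inv_iff_mul_eq_one, ← zpow_one_add]; exact hc4'
        rw [hi, hcc, hk2]
      apply hinc; rw [this]; exact hc.2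
    · have e1 : (k + 1) % 4 = 0 := by omega
      have e2 : (1 - k) % 4 = 2 := by omega
      rw [e1, e2, zpow_zero] at hk2
      exact hc2 (by exact_mod_cast hk2.symm)
  have hCab : ∀ c ∈ C, ∀ d ∈ C, Commute c d := by
    by_contra hcon
    push Not at hcon
    obtain ⟨c, hc, d, hd, hcd⟩ := hcon
    obtain ⟨i', j', -, h2', hne', -⟩ := ded_q8 (G := C) (by
      intro g h
      obtain ⟨k, hk⟩ := hD (g : G) (h : G)
      exact ⟨k, Subtype.ext (by simpa using hk)⟩)
      ⟨⟨c, hc⟩, ⟨d, hd⟩, fun h => hcd (congrArg Subtype.val h)⟩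
    apply hne'
    have := hord4 i' i'.2 (by exact_mod_cast congrArg Subtype.val h2')
    exact Subtype.ext (by simpa using this)
  have hpm : ∀ x g : G, x ^ 4 = 1 → g * x * g⁻¹ = x ∨ g * x * g⁻¹ = x⁻¹ ∨ (g * x * g⁻¹) ^ 2 = 1 := by
    intro x g hx
    obtain ⟨k, hk⟩ := hD x g
    have hx4 : x ^ (4 : ℤ) = 1 := by exact_mod_cast hx
    have hk' : x ^ k = x ^ (k % 4) := by
      conv_lhs => rw [← Int.emod_add_mul_ediv k 4, zpow_add, zpow_mul, hx4, one_zpow, mul_one]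
    rw [hk, hk']
    have hcases : k % 4 = 0 ∨ k % 4 = 1 ∨ k % 4 = 2 ∨ k % 4 = 3 := by omega
    rcases hcases with h | h | h | h <;> rw [h]
    · right; right; simp
    · left; simp
    · right; right
      rw [← zpow_natCast, ← zpow_mul]; exact hx4
    · right; left
      rw [eq_inv_iff_mul_eq_one, ← zpow_add_one]; exact hx4
  have hsqc : ∀ x g : G, (g * x * g⁻¹) ^ 2 = 1 → x ^ 2 = 1 := by
    intro x g h
    rw [conj_pow] at h
    have := congrArg (fun z => g⁻¹ * z * g) h
    simpa [mul_assoc] using this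
  have hj4 : j ^ 4 = 1 := by
    have : j ^ 4 = (j ^ 2) ^ 2 := by rw [← pow_mul]
    rw [this, ← h1, ← pow_mul]; exact h2
  have hi' : ∀ g : G, g * i * g⁻¹ = i ∨ g * i * g⁻¹ = i⁻¹ := by
    intro g
    rcases hpm i g h2 with h | h | h
    · exact Or.inl h
    · exact Or.inr h
    · exact absurd (hsqc _ _ h) hne
  have hj' : ∀ g : G, g * j * g⁻¹ = j ∨ g * j * g⁻¹ = j⁻¹ := by
    intro g
    rcases hpm j g hj4 with h | h | h
    · exact Or.inl h
    · exact Or.inr h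
    · exact absurd (by rw [h1]; exact hsqc _ _ h) hne
  have hconjij : i * j * i⁻¹ = j⁻¹ := by
    rcases hj' i with h | h
    · exfalso
      rw [mul_inv_eq_iff_eq_mul] at h
      rw [← h, mul_inv_cancel_right, eq_inv_iff_mul_eq_one, ← sq] at h3
      exact hne h3
    · exact h
  have hmemC : ∀ g : G, g * i * g⁻¹ = i → g * j * g⁻¹ = j → g ∈ C := by
    intro g h h'
    rw [hC]
    exact ⟨(mul_inv_eq_iff_eq_mul.mp h).symm, (mul_inv_eq_iff_eq_mul.mp h').symm⟩
  have hdec : ∀ g q : G, ∀ x e : G, q * x * q⁻¹ = e → g * x * g⁻¹ = e →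
      (q⁻¹ * g) * x * (q⁻¹ * g)⁻¹ = x := by
    intro g q x e hq hg
    have : (q⁻¹ * g) * x * (q⁻¹ * g)⁻¹ = q⁻¹ * (g * x * g⁻¹) * q := by group
    rw [this, hg, ← hq]; group
  have hii : i * i * i⁻¹ = i := by group
  have hjj : j * j * j⁻¹ = j := by group
  have hk1 : (i * j) * i * (i * j)⁻¹ = i⁻¹ := by
    have : (i * j) * i * (i * j)⁻¹ = i * (j * i * j⁻¹) * i⁻¹ := by group
    rw [this, h3]; group
  have hk2 : (i * j) * j * (i * j)⁻¹ = j⁻¹ := by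
    have : (i * j) * j * (i * j)⁻¹ = i * j * i⁻¹ := by group
    rw [this, hconjij]
  have hsurj : ∀ g, ∃ q, ∃ c ∈ C, g = ψ q * c := by
    intro g
    have : ∃ q, (ψ q)⁻¹ * g ∈ C := by
      rcases hi' g with hi | hi <;> rcases hj' g with hj | hj
      · exact ⟨1, by rw [map_one, inv_one, one_mul]; exact hmemC g hi hj⟩
      · refine ⟨a 1, ?_⟩
        rw [hψi]
        exact hmemC _ (hdec g i i i hii hi) (hdec g i j _ hconjij hj)
      · refine ⟨xa 0, ?_⟩
        rw [hψj]
        exact hmemC _ (hdec g j i _ h3 hi) (hdec g j j _ hjj hj)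
      · refine ⟨a 1 * xa 0, ?_⟩
        rw [map_mul, hψi, hψj]
        exact hmemC _ (hdec g _ i _ hk1 hi) (hdec g _ j _ hk2 hj)
    obtain ⟨q, hq⟩ := this
    exact ⟨q, _, hq, by group⟩
  refine ⟨ψ, C, hψinj, hcomm, hCab, hsurj, ?_, ?_, hord4⟩
  · intro q hq
    rw [hC, ← hψi, ← hψj] at hq
    have e1 : a 1 * q = q * a 1 := hψinj (by rw [map_mul, map_mul]; exact hq.1)
    have e2 : xa 0 * q = q * xa 0 := hψinj (by rw [map_mul, map_mul]; exact hq.2)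
    have : ∀ q : QuaternionGroup 2, a 1 * q = q * a 1 → xa 0 * q = q * xa 0 →
        q = 1 ∨ q = a 2 := by decide
    exact this q e1 e2
  · rw [hC, ← hψi, ← hψj]
    have e1 : (a 1 : QuaternionGroup 2) * (a 2) = a 2 * a 1 := by decide
    have e2 : (xa 0 : QuaternionGroup 2) * (a 2) = a 2 * xa 0 := by decide
    exact ⟨Commute.map (show Commute _ _ from e1) ψ, Commute.map (show Commute _ _ from e2) ψ⟩

theorem ded_iso {G : Type} [Group G] (ψ : QuaternionGroup 2 →* G) (C : Subgroup G)
    (hψ : Function.Injective ψ) (hcomm : ∀ q, ∀ c ∈ C, Commute (ψ q) c)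
    (hCab : ∀ c ∈ C, ∀ d ∈ C, Commute c d) (hsurj : ∀ g, ∃ q, ∃ c ∈ C, g = ψ q * c)
    (hinter : ∀ q, ψ q ∈ C → q = 1 ∨ q = a 2) (hz : ψ (a 2) ∈ C) (hC2 : ∀ c ∈ C, c ^ 2 = 1)
    (χ : C →* ℂˣ) (hχ : χ ⟨_, hz⟩ = -1) :
    ∃ (A : Type) (_ : CommGroup A), (∀ a : A, a ^ 2 = 1) ∧
          Nonempty (G ≃* QuaternionGroup 2 × A) := by
  let B : Subgroup C := χ.ker
  let _ : CommGroup B := { (inferInstance : Group B) with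
    mul_comm := fun x y => Subtype.ext (Subtype.ext (hCab _ x.1.2 _ y.1.2)) }
  refine ⟨B, inferInstance, ?_, ?_⟩
  · intro x
    exact Subtype.ext (Subtype.ext (hC2 _ x.1.2))
  let f : QuaternionGroup 2 × B →* G :=
    { toFun := fun p => ψ p.1 * (p.2 : C)
      map_one' := by simp
      map_mul' := by
        rintro ⟨q, x⟩ ⟨r, y⟩
        have := (hcomm r _ x.1.2).eq
        simp only [Prod.mk_mul_mk, map_mul, Subgroup.coe_mul]
        rw [mul_assoc, ← mul_assoc (ψ r), this]
        simp only [mul_assoc] }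
  have hne1 : (-1 : ℂˣ) ≠ 1 := by
    intro h
    have := congrArg Units.val h
    norm_num at this
  refine ⟨(MulEquiv.ofBijective f ⟨?_, ?_⟩).symm⟩
  · rw [injective_iff_map_eq_one]
    rintro ⟨q, x⟩ h
    have h' : ψ q * (x : C) = 1 := h
    have hq : ψ q ∈ C := by
      rw [mul_eq_one_iff_eq_inv] at h'
      rw [h']; exact C.inv_mem x.1.2
    rcases hinter q hq with rfl | rfl
    · rw [map_one, one_mul] at h'
      have : x = 1 := Subtype.ext (Subtype.ext h')
      rw [this]; rfl
    · exfalso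
      have hx : χ x.1 = 1 := x.2
      have e : (⟨_, hz⟩ : C) * x.1 = 1 := Subtype.ext h'
      have := congrArg χ e
      rw [map_mul, hχ, hx, map_one, mul_one] at this
      exact hne1 this
  · intro g
    obtain ⟨q, c, hc, rfl⟩ := hsurj g
    have hsq : (χ ⟨c, hc⟩) ^ 2 = 1 := by
      rw [← map_pow, ← map_one χ]
      congr 1
      exact Subtype.ext (hC2 c hc)
    have hpm : χ ⟨c, hc⟩ = 1 ∨ χ ⟨c, hc⟩ = -1 := by
      have : ((χ ⟨c, hc⟩ : ℂˣ) : ℂ) ^ 2 = 1 := by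
        rw [← Units.val_pow_eq_pow_val, hsq, Units.val_one]
      rcases mul_self_eq_one_iff.mp ((sq _).symm.trans this) with h | h
      · left; exact Units.ext h
      · right; exact Units.ext (by simpa using h)
    rcases hpm with h | h
    · exact ⟨⟨q, ⟨⟨c, hc⟩, h⟩⟩, rfl⟩
    · refine ⟨⟨q * a 2, ⟨⟨_, hz⟩ * ⟨c, hc⟩, ?_⟩⟩, ?_⟩
      · show χ _ = 1
        rw [map_mul, hχ, h]; simp
      · show ψ (q * a 2) * (ψ (a 2) * c) = _
        rw [← mul_assoc, ← map_mul]
        congr 2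
        have : ∀ q : QuaternionGroup 2, q * a 2 * a 2 = q := by decide
        exact this q

end GRU

namespace GRU

/-- The one-parameter unipotent group attached to a square-zero element. -/
def unip {R S : Type*} [CommRing R] [Ring S] [Algebra R S] (n : S) (hn : n * n = 0) :
    Multiplicative R →* Sˣ where
  toFun r := ⟨1 + r.toAdd • n, 1 - r.toAdd • n, by
      simp [mul_sub, add_mul, hn], by simp [mul_add, sub_mul, hn]⟩
  map_one' := by ext; simp
  map_mul' r s := by
    ext
    simp [mul_add, add_mul, hn, add_smul, add_assoc]

theorem unip_val {R S : Type*} [CommRing R] [Ring S] [Algebra R S] (n : S) (hn : n * n = 0)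
    (r : R) : ((unip n hn (Multiplicative.ofAdd r) : Sˣ) : S) = 1 + r • n := rfl

theorem unip_pow_mem {R S : Type*} [CommRing R] [Ring S] [Algebra R S] (n : S) (hn : n * n = 0)
    (H : Subgroup Sˣ) (hH : H.FiniteIndex) (r : R) :
    ∃ k : ℕ, 0 < k ∧ unip n hn (Multiplicative.ofAdd ((k : R) * r)) ∈ H := by
  obtain ⟨k, hk, -, h⟩ := Subgroup.exists_pow_mem_of_index_ne_zero hH.index_ne_zero
    (unip n hn (Multiplicative.ofAdd r))
  refine ⟨k, hk, ?_⟩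
  rw [← map_pow, ← ofAdd_nsmul, nsmul_eq_mul] at h
  exact h

theorem nil_comm {R S : Type*} [CommRing R] [Ring S] [Algebra R S] (ω : R)
    (hreg : ∀ a b : ℤ, (a ≠ 0 ∨ b ≠ 0) → ∀ s : S, ((a : R) + b * ω) • s = 0 → s = 0)
    (H : Subgroup Sˣ) (hH : H.FiniteIndex) {m : ℕ} {X : Fin m → Type}
    (e : H ≃* ∀ j, FreeGroup (X j)) (n n' : S) (hn : n * n = 0) (hn' : n' * n' = 0) :
    n * n' = n' * n := by
  obtain ⟨k1, hk1, h1⟩ := unip_pow_mem n hn H hH (1 : R)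
  obtain ⟨k2, hk2, h2⟩ := unip_pow_mem n hn H hH ω
  obtain ⟨k3, hk3, h3⟩ := unip_pow_mem n' hn' H hH (1 : R)
  let u : H := ⟨_, h1⟩ ^ k2
  let v : H := ⟨_, h2⟩ ^ k1
  have hu : (u : Sˣ) = unip n hn (Multiplicative.ofAdd ((k2 : R) * (k1 : R))) := by
    simp only [u, Subgroup.coe_pow, mul_one]
    rw [← map_pow, ← ofAdd_nsmul, nsmul_eq_mul]
  have hv : (v : Sˣ) = unip n hn (Multiplicative.ofAdd ((k2 : R) * (k1 : R) * ω)) := by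
    simp only [v, Subgroup.coe_pow]
    rw [← map_pow, ← ofAdd_nsmul, nsmul_eq_mul]
    congr 2; ring
  have huv : Commute u v := by
    apply Subtype.ext
    simp only [Subgroup.coe_mul, hu, hv, ← map_mul]
    rw [mul_comm]
  have comm_iff : ∀ (g : Sˣ) (r : R), (∀ s : S, r • s = 0 → s = 0) →
      (Commute g (unip n hn (Multiplicative.ofAdd r)) ↔ (g : S) * n = n * g) := by
    intro g r hr
    have : Commute g (unip n hn (Multiplicative.ofAdd r)) ↔
      (g : S) * (1 + r • n) = (1 + r • n) * g := by
      rw [← unip_val n hn, ← Units.val_mul, ← Units.val_mul]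
      exact Units.ext_iff
    rw [this, mul_add, add_mul, mul_one, one_mul, add_right_inj, mul_smul_comm, smul_mul_assoc]
    constructor
    · intro h
      rw [← sub_eq_zero, ← smul_sub] at h
      exact sub_eq_zero.mp (hr _ h)
    · intro h; rw [h]
  have hk : ∀ k : ℕ, 0 < k → ∀ s : S, (k : R) • s = 0 → s = 0 := by
    intro k hk s hs
    have := hreg k 0 (Or.inl (by exact_mod_cast hk.ne')) s
    apply this
    simpa using hs
  have hkk : ∀ s : S, ((k2 : R) * k1) • s = 0 → s = 0 := by
    intro s hs
    rw [mul_smul] at hs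
    exact hk _ hk1 _ (hk _ hk2 _ hs)
  have hcen : ∀ g : H, Commute g u := by
    have := prod_central (e u) (e v) (huv.map e) ?_
    · intro g
      have := (this (e g)).map e.symm
      simpa using this
    · intro a b hab g hg
      have hg2 := hg.map e.symm
      have e1 : e.symm (e u ^ a * e v ^ b) = u ^ a * v ^ b := by
        rw [map_mul, map_zpow, map_zpow, e.symm_apply_apply, e.symm_apply_apply]
      rw [e1] at hg2
      have hg3 : Commute ((e.symm g : H) : Sˣ) ((u ^ a * v ^ b : H) : Sˣ) := hg2.map H.subtype
      have e2 : ((u ^ a * v ^ b : H) : Sˣ) =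
          unip n hn (Multiplicative.ofAdd ((k2 : R) * k1 * (a + b * ω))) := by
        rw [Subgroup.coe_mul, Subgroup.coe_zpow, Subgroup.coe_zpow, hu, hv, ← map_zpow (unip (R := R) n hn),
          ← map_zpow (unip (R := R) n hn), ← ofAdd_zsmul, ← ofAdd_zsmul, ← map_mul, ← ofAdd_add, zsmul_eq_mul,
          zsmul_eq_mul]
        congr 2; ring
      rw [e2, comm_iff _ _ (fun s hs => hreg a b hab s (hkk _ (by rwa [← mul_smul])))] at hg3
      have h4 : Commute ((e.symm g : H) : Sˣ) (u : Sˣ) := by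
        rw [hu, comm_iff _ _ hkk]; exact hg3
      have h5 : Commute (e.symm g) u := Subtype.ext h4
      have := h5.map e
      simpa using this
  have h6 := (hcen ⟨_, h3⟩).map H.subtype
  have h7 : Commute (unip n' hn' (Multiplicative.ofAdd ((k3 : R) * 1))) (u : Sˣ) := h6
  rw [hu, comm_iff _ _ hkk, unip_val, mul_one, add_mul, mul_add, one_mul, mul_one, add_right_inj,
    smul_mul_assoc, mul_smul_comm, ← sub_eq_zero, ← smul_sub] at h7
  exact (sub_eq_zero.mp (hk _ hk3 _ h7)).symm

end GRU

namespace GRU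

open MonoidAlgebra

section star
variable {k G : Type*} [CommRing k] [Group G]

/-- The canonical involution of a group ring. -/
noncomputable def st (x : MonoidAlgebra k G) : MonoidAlgebra k G := mapDomain (fun g => g⁻¹) x

theorem st_single (g : G) (r : k) : st (single g r) = single g⁻¹ r := mapDomain_single

theorem st_add (x y : MonoidAlgebra k G) : st (x + y) = st x + st y := mapDomain_add _ _ _

theorem st_zero : st (0 : MonoidAlgebra k G) = 0 := mapDomain_zero _

theorem st_one : st (1 : MonoidAlgebra k G) = 1 := by
  rw [one_def, st_single, inv_one]

theorem st_st (x : MonoidAlgebra k G) : st (st x) = x := by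
  induction x using MonoidAlgebra.induction_linear with
  | zero => simp [st_zero]
  | add f g hf hg => rw [st_add, st_add, hf, hg]
  | single m r => rw [st_single, st_single, inv_inv]

theorem st_mul (x y : MonoidAlgebra k G) : st (x * y) = st y * st x := by
  induction x using MonoidAlgebra.induction_linear with
  | zero => simp [st_zero]
  | add f g hf hg => rw [add_mul, st_add, st_add, hf, hg, mul_add]
  | single m r =>
    induction y using MonoidAlgebra.induction_linear with
    | zero => simp [st_zero]
    | add f g hf hg => rw [mul_add, st_add, st_add, hf, hg, add_mul]
    | single n s =>
      rw [single_mul_single, st_single, st_single, st_single, single_mul_single, mul_inv_rev,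
        mul_comm]

theorem st_coeff (x : MonoidAlgebra k G) (g : G) : (st x).coeff g = x.coeff g⁻¹ := by
  have := Finsupp.mapDomain_apply (M := k) (f := fun g : G => g⁻¹) inv_injective x.coeff g⁻¹
  simp only [inv_inv] at this
  exact this

theorem mul_st_coeff [Fintype G] (x : MonoidAlgebra k G) :
    (x * st x).coeff 1 = ∑ g, x.coeff g ^ 2 := by
  rw [coeff_mul_apply_left, Finsupp.sum_fintype]
  · refine Finset.sum_congr rfl fun g _ => ?_
    rw [st_coeff]; simp [sq]
  · simp

end star

theorem mul_st_int {G : Type*} [Group G] [Finite G] (x : MonoidAlgebra ℤ G) (h : x * st x = 0) :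
    x = 0 := by
  cases nonempty_fintype G
  have := mul_st_coeff x
  rw [h] at this
  have h2 := (Finset.sum_eq_zero_iff_of_nonneg (fun g _ => sq_nonneg (x.coeff g))).mp this.symm
  ext g
  simpa using h2 g (Finset.mem_univ g)

theorem ded_of_nil {G : Type*} [Group G] [Finite G]
    (hN : ∀ n n' : MonoidAlgebra ℤ G, n * n = 0 → n' * n' = 0 → n * n' = n' * n) (h g : G) :
    ∃ k : ℤ, g * h * g⁻¹ = h ^ k := by
  suffices key : ∀ g : G, ∃ k : ℤ, g⁻¹ * h * g = h ^ k by
    have := key g⁻¹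
    rwa [inv_inv] at this
  clear g; intro g
  let s : MonoidAlgebra ℤ G := ∑ k ∈ Finset.range (orderOf h), single (h ^ k) 1
  let d : MonoidAlgebra ℤ G := 1 - single h 1
  have hs : s * d = 0 := by
    have : s * (single h 1) = s := by
      simp only [s, Finset.sum_mul, single_mul_single, mul_one, ← pow_succ]
      have h1 := Finset.sum_range_succ (fun k => (single (h ^ k) 1 : MonoidAlgebra ℤ G)) (orderOf h)
      rw [Finset.sum_range_succ'] at h1
      rw [pow_orderOf_eq_one, pow_zero] at h1
      exact add_right_cancel h1
    rw [mul_sub, this, mul_one, sub_self]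
  let n : MonoidAlgebra ℤ G := d * single g 1 * s
  have hn : n * n = 0 := by
    simp only [n, mul_assoc]
    rw [← mul_assoc s d, hs]; simp
  have hn' : st n * st n = 0 := by rw [← st_mul, hn, st_zero]
  have hc := hN n (st n) hn hn'
  have h0 : n = 0 := by
    apply mul_st_int
    apply mul_st_int
    rw [st_mul n (st n), st_st n]
    calc n * st n * (n * st n) = n * (st n * n) * st n := by simp only [mul_assoc]
      _ = (n * n) * (st n * st n) := by rw [← hc]; simp only [mul_assoc]
      _ = 0 := by rw [hn, zero_mul]
  have hcs : ∀ t, s.coeff t = ∑ k ∈ Finset.range (orderOf h), (single (h ^ k) 1 : MonoidAlgebra ℤ G).coeff t := by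
    intro t
    simp [s, MonoidAlgebra.coeff_sum, Finsupp.finsetSum_apply]
  have h1 : single g 1 * s = single (h * g) 1 * s := by
    have : n = single g 1 * s - single (h * g) 1 * s := by
      simp only [n, d, sub_mul, one_mul, single_mul_single, mul_one]
    rw [this] at h0
    exact sub_eq_zero.mp h0
  have h2 := congrArg (fun x => MonoidAlgebra.coeff x (h * g)) h1
  simp only [coeff_single_mul_apply, one_mul] at h2
  rw [inv_mul_cancel, hcs 1] at h2
  have hpos : (0 : ℤ) < ∑ k ∈ Finset.range (orderOf h), (single (h ^ k) 1 : MonoidAlgebra ℤ G).coeff 1 := by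
    classical
    apply Finset.sum_pos'
    · intro i _
      rw [coeff_single, Finsupp.single_apply]; split_ifs <;> simp
    · exact ⟨0, Finset.mem_range.mpr (orderOf_pos h), by simp⟩
  rw [← h2, hcs] at hpos
  obtain ⟨k, _, hk⟩ := Finset.exists_ne_zero_of_sum_ne_zero hpos.ne'
  refine ⟨k, ?_⟩
  rw [zpow_natCast]
  by_contra hne
  apply hk
  classical
  rw [coeff_single, Finsupp.single_apply, if_neg]
  intro h3; apply hne; rw [h3]; group

theorem nil_comm_grp {R G : Type*} [CommRing R] [IsDomain R] [Group G] (ω : R)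
    (hω : ∀ a b : ℤ, (a ≠ 0 ∨ b ≠ 0) → (a : R) + b * ω ≠ 0)
    (H : Subgroup (MonoidAlgebra R G)ˣ) (hH : H.FiniteIndex) {m : ℕ} {X : Fin m → Type}
    (e : H ≃* ∀ j, FreeGroup (X j)) (n n' : MonoidAlgebra R G) (hn : n * n = 0)
    (hn' : n' * n' = 0) : n * n' = n' * n := by
  refine nil_comm ω ?_ H hH e n n' hn hn'
  intro a b hab s hs
  ext g
  have := congrArg (fun x => MonoidAlgebra.coeff x g) hs
  simp only [coeff_smul, Finsupp.smul_apply, smul_eq_mul] at this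
  rcases mul_eq_zero.mp this with h | h
  · exact absurd h (hω a b hab)
  · simpa using h

theorem ded_of_grp {R G : Type*} [CommRing R] [IsDomain R] [CharZero R] [Group G] [Finite G] (ω : R)
    (hω : ∀ a b : ℤ, (a ≠ 0 ∨ b ≠ 0) → (a : R) + b * ω ≠ 0)
    (H : Subgroup (MonoidAlgebra R G)ˣ) (hH : H.FiniteIndex) {m : ℕ} {X : Fin m → Type}
    (e : H ≃* ∀ j, FreeGroup (X j)) (h g : G) : ∃ k : ℤ, g * h * g⁻¹ = h ^ k := by
  apply ded_of_nil
  intro n n' hn hn'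
  let f : MonoidAlgebra ℤ G →+* MonoidAlgebra R G := mapRingHom G (Int.castRingHom R)
  have hf : Function.Injective f := by
    rw [injective_iff_map_eq_zero]
    intro x hx
    ext g
    have := congrArg (fun x => MonoidAlgebra.coeff x g) hx
    simpa [f] using this
  apply hf
  rw [map_mul, map_mul]
  apply nil_comm_grp ω hω H hH e
  · rw [← map_mul, hn, map_zero]
  · rw [← map_mul, hn', map_zero]

end GRU

namespace GRU

/-- The almost invariant set used for free groups: words ending in the letter `x`. -/
def endSet {α : Type*} [DecidableEq α] (x : α) : Set (FreeGroup α) :=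
  {w | w.toWord.getLast? = some (x, true)}

theorem endSet_gen {α : Type*} [DecidableEq α] (x y : α) :
    {p : FreeGroup α | ¬ (p ∈ endSet x ↔ FreeGroup.of y * p ∈ endSet x)}.Finite := by
  refine Set.Finite.subset (Set.toFinite {1, (FreeGroup.of y)⁻¹}) ?_
  intro p hp
  by_contra hne
  simp only [Set.mem_insert_iff, Set.mem_singleton_iff, not_or] at hne
  apply hp
  have h1 : (FreeGroup.of y * p).toWord = FreeGroup.reduce ((y, true) :: p.toWord) := by
    rw [FreeGroup.toWord_mul, FreeGroup.toWord_of]; rfl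
  simp only [endSet, Set.mem_ofPred_eq, h1, FreeGroup.reduce.cons, FreeGroup.reduce_toWord]
  rcases hw : p.toWord with _ | ⟨b, _ | ⟨c, l⟩⟩
  · exact absurd (FreeGroup.toWord_eq_nil_iff.mp hw) hne.1
  · have hb : ¬ (y = b.1 ∧ true = !b.2) := by
      rintro ⟨hy, hb⟩
      apply hne.2
      apply FreeGroup.toWord_injective
      rw [hw, FreeGroup.toWord_inv, FreeGroup.toWord_of]
      obtain ⟨b1, b2⟩ := b
      cases b2
      · simp only at hy; rw [hy]; rfl
      · exact absurd hb (by simp)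
    simp only [hb, if_false]
    simp
  · by_cases hb : y = b.1 ∧ true = !b.2
    · simp [hb.1, hb.2]
    · simp only [hb, if_false]
      simp

theorem endSet_inv {α : Type*} [DecidableEq α] (x : α) (s : FreeGroup α) :
    {p : FreeGroup α | ¬ (p ∈ endSet x ↔ s * p ∈ endSet x)}.Finite := by
  induction s using FreeGroup.induction_on with
  | C1 => simp
  | of y => exact endSet_gen x y
  | inv_of y h =>
    have h2 := h.preimage (mul_right_injective (FreeGroup.of y)⁻¹).injOn
    refine h2.subset ?_
    intro p hp
    simp only [Set.mem_preimage, Set.mem_ofPred_eq, mul_inv_cancel_left] at hp ⊢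
    tauto
  | mul s t hs ht =>
    refine (ht.union (hs.preimage (mul_right_injective t).injOn)).subset ?_
    intro p hp
    simp only [Set.mem_union, Set.mem_preimage, Set.mem_ofPred_eq, mul_assoc] at hp ⊢
    tauto

theorem endSet_inf {α : Type*} [DecidableEq α] (x : α) :
    (endSet x).Infinite ∧ (endSet x)ᶜ.Infinite := by
  have hinj : Function.Injective (fun n : ℕ => FreeGroup.of x ^ (n + 1)) := by
    intro a b h
    have := FreeGroup.toWord_injective.eq_iff.mpr h
    simp only [FreeGroup.toWord_of_pow] at this
    have := congrArg List.length this
    simpa using this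
  constructor
  · refine Set.infinite_of_injective_forall_mem hinj ?_
    intro n
    simp [endSet, FreeGroup.toWord_of_pow, List.getLast?_replicate]
  · refine Set.infinite_of_injective_forall_mem (inv_injective.comp hinj) ?_
    intro n
    simp [endSet, FreeGroup.toWord_of_pow, FreeGroup.toWord_inv, FreeGroup.invRev, List.getLast?_replicate]

theorem end_contra {Δ α : Type*} [Group Δ] (e : Δ ≃* FreeGroup α) {X : Type*} [TopologicalSpace X]
    (h : Δ → X → ℝ) (r : ℝ) (hcont : ∀ δ, Continuous (h δ))
    (hcover : ∀ g, ∃ δ, h δ g < r)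
    (hproper : ∀ s : ℝ, ∃ F : Set Δ, F.Finite ∧ ∀ p q g, h p g < s → h q g < s → q * p⁻¹ ∈ F)
    (hpt : ∀ p, ∃ g, h p g < r)
    (hbd : ∀ p s, ∃ T, ∀ g, h p g < s → h 1 g ≤ T)
    (hunb : ∀ T, ∃ g, T < h 1 g)
    (hconn : ∀ T, ∃ T' : ℝ, ∃ W : Set X, IsPreconnected W ∧ (∀ g, T' < h 1 g → g ∈ W) ∧
      ∀ g ∈ W, T < h 1 g) : False := by
  classical
  rcases isEmpty_or_nonempty α with hα | ⟨⟨x⟩⟩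
  · obtain ⟨T, hT⟩ := hbd 1 r
    obtain ⟨g, hg⟩ := hunb T
    obtain ⟨δ, hδ⟩ := hcover g
    have : δ = 1 := e.injective (Subsingleton.elim _ _)
    subst this
    exact absurd (hT g hδ) (not_le.mpr hg)
  let P : Set Δ := e ⁻¹' endSet x
  have hPinv : ∀ s, {p : Δ | ¬ (p ∈ P ↔ s * p ∈ P)}.Finite := by
    intro s
    have := (endSet_inv x (e s)).preimage e.injective.injOn
    refine this.subset ?_
    intro p hp
    simpa [P] using hp
  have hPinf : P.Infinite := by
    intro hf
    have := hf.image e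
    rw [Set.image_preimage_eq _ e.surjective] at this
    exact (endSet_inf x).1 this
  have hPcinf : Pᶜ.Infinite := by
    intro hf
    have := hf.image e
    rw [show Pᶜ = e ⁻¹' (endSet x)ᶜ from rfl, Set.image_preimage_eq _ e.surjective] at this
    exact (endSet_inf x).2 this
  let A : Set Δ → Set X := fun Q => ⋃ p ∈ Q, {g | h p g < r}
  have hA : ∀ Q, IsOpen (A Q) := fun Q =>
    isOpen_biUnion fun p _ => isOpen_lt (hcont p) continuous_const
  have hAunb : ∀ Q : Set Δ, Q.Infinite → ∀ T, ∃ g ∈ A Q, T < h 1 g := by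
    intro Q hQ T
    by_contra hcon
    push Not at hcon
    obtain ⟨F, hF, hF2⟩ := hproper (max r (T + 1))
    choose g hg using hpt
    refine hQ (hF.subset ?_)
    intro p hp
    have hmem : g p ∈ A Q := Set.mem_biUnion hp (hg p)
    have := hF2 1 p (g p) (lt_of_le_of_lt (hcon _ hmem) (lt_of_lt_of_le (lt_add_one T)
      (le_max_right _ _))) (lt_of_lt_of_le (hg p) (le_max_left _ _))
    simpa using this
  have hAB : ∃ T, ∀ g, g ∈ A P → g ∈ A Pᶜ → h 1 g ≤ T := by
    obtain ⟨F, hF, hF2⟩ := hproper r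
    have hfin : (⋃ s ∈ F, {p : Δ | ¬ (p ∈ P ↔ s * p ∈ P)}).Finite := hF.biUnion fun s _ => hPinv s
    choose T hT using fun p => hbd p r
    obtain ⟨M, hM⟩ := (hfin.image T).bddAbove
    refine ⟨M, fun g hg1 hg2 => ?_⟩
    simp only [A, Set.mem_iUnion, Set.mem_ofPred_eq] at hg1 hg2
    obtain ⟨p, hp, hpg⟩ := hg1
    obtain ⟨q, hq, hqg⟩ := hg2
    refine (hT p g hpg).trans (hM (Set.mem_image_of_mem T ?_))
    refine Set.mem_biUnion (hF2 p q g hpg hqg) ?_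
    simp only [Set.mem_ofPred_eq, inv_mul_cancel_right]
    intro hh
    exact hq (hh.mp hp)
  obtain ⟨T, hT⟩ := hAB
  obtain ⟨T', W, hW, hW1, hW2⟩ := hconn T
  obtain ⟨a, ha, ha'⟩ := hAunb P hPinf T'
  obtain ⟨b, hb, hb'⟩ := hAunb Pᶜ hPcinf T'
  obtain ⟨c, hcW, hcA, hcB⟩ := hW (A P) (A Pᶜ) (hA _) (hA _) (by
    intro g _
    obtain ⟨δ, hδ⟩ := hcover g
    by_cases hP : δ ∈ P
    · exact Or.inl (Set.mem_biUnion hP hδ)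
    · exact Or.inr (Set.mem_biUnion (show δ ∈ Pᶜ from hP) hδ)) ⟨a, hW1 a ha', ha⟩ ⟨b, hW1 b hb', hb⟩
  exact absurd (hT c hcA hcB) (not_le.mpr (hW2 c hcW))

end GRU

namespace GRU

open Quaternion

/-- Coordinates of a quaternion. -/
def co {R : Type*} [CommRing R] (q : Quaternion R) : Fin 4 → R := ![q.re, q.imI, q.imJ, q.imK]

/-- The pure quaternion with given coordinates. -/
def pureQ (v : EuclideanSpace ℝ (Fin 3)) : Quaternion ℝ := ⟨0, v 0, v 1, v 2⟩

/-- Parametrization of complex norm one quaternions. -/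
noncomputable def cpar (p : Quaternion ℝ) (v : EuclideanSpace ℝ (Fin 3)) (t : ℝ) (i : Fin 4) : ℂ :=
  ((√(1 + t ^ 2) * co p i : ℝ) : ℂ) + ((t * co (p * pureQ v) i : ℝ) : ℂ) * Complex.I

@[simp] theorem pureQ_re (v : EuclideanSpace ℝ (Fin 3)) : (pureQ v).re = 0 := rfl
@[simp] theorem pureQ_imI (v : EuclideanSpace ℝ (Fin 3)) : (pureQ v).imI = v 0 := rfl
@[simp] theorem pureQ_imJ (v : EuclideanSpace ℝ (Fin 3)) : (pureQ v).imJ = v 1 := rfl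
@[simp] theorem pureQ_imK (v : EuclideanSpace ℝ (Fin 3)) : (pureQ v).imK = v 2 := rfl

theorem sum_co_sq {R : Type*} [CommRing R] (q : Quaternion R) : ∑ i, co q i ^ 2 = normSq q := by
  simp [Fin.sum_univ_four, co, normSq_def']

theorem norm_pureQ (v : EuclideanSpace ℝ (Fin 3)) : normSq (pureQ v) = ‖v‖ ^ 2 := by
  rw [EuclideanSpace.norm_sq_eq, normSq_def']
  simp [pureQ, Fin.sum_univ_three]

theorem co_dot (p : Quaternion ℝ) (v : EuclideanSpace ℝ (Fin 3)) :
    ∑ i, co p i * co (p * pureQ v) i = 0 := by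
  simp only [Fin.sum_univ_four, co, Matrix.cons_val_zero, Matrix.cons_val_one,
    Matrix.cons_val, re_mul, imI_mul, imJ_mul, imK_mul, pureQ_re, pureQ_imI, pureQ_imJ, pureQ_imK]
  ring

theorem cpar_sum (p : Quaternion ℝ) (hp : normSq p = 1) (v : EuclideanSpace ℝ (Fin 3))
    (hv : ‖v‖ = 1) (t : ℝ) : ∑ i, cpar p v t i ^ 2 = 1 := by
  have h1 : ∑ i, co p i ^ 2 = 1 := by rw [sum_co_sq, hp]
  have h2 : ∑ i, co (p * pureQ v) i ^ 2 = 1 := by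
    rw [sum_co_sq, map_mul, hp, norm_pureQ, hv]; norm_num
  have h3 := co_dot p v
  have hs : √(1 + t ^ 2) ^ 2 = 1 + t ^ 2 := Real.sq_sqrt (by positivity)
  have : ∀ i, cpar p v t i ^ 2 = (((1 + t ^ 2) * co p i ^ 2 - t ^ 2 * co (p * pureQ v) i ^ 2 : ℝ) : ℂ) +
      ((2 * √(1 + t ^ 2) * t * (co p i * co (p * pureQ v) i) : ℝ) : ℂ) * Complex.I := by
    intro i
    have hs' : ((√(1 + t ^ 2) : ℝ) : ℂ) ^ 2 = 1 + (t : ℂ) ^ 2 := by exact_mod_cast congrArg Complex.ofReal hs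
    simp only [cpar]
    push_cast
    linear_combination ((co p i : ℝ) : ℂ) ^ 2 * hs' + (t : ℂ) ^ 2 * ((co (p * pureQ v) i : ℝ) : ℂ) ^ 2 * Complex.I_sq
  simp only [this]
  rw [Finset.sum_add_distrib, ← Finset.sum_mul, ← Complex.ofReal_sum, ← Complex.ofReal_sum,
    Finset.sum_sub_distrib, ← Finset.mul_sum, ← Finset.mul_sum, ← Finset.mul_sum, h1, h2, h3]
  simp

theorem cpar_norm (p : Quaternion ℝ) (hp : normSq p = 1) (v : EuclideanSpace ℝ (Fin 3))
    (hv : ‖v‖ = 1) (t : ℝ) : ∑ i, ‖cpar p v t i‖ ^ 2 = 1 + 2 * t ^ 2 := by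
  have h1 : ∑ i, co p i ^ 2 = 1 := by rw [sum_co_sq, hp]
  have h2 : ∑ i, co (p * pureQ v) i ^ 2 = 1 := by
    rw [sum_co_sq, map_mul, hp, norm_pureQ, hv]; norm_num
  have hs : √(1 + t ^ 2) ^ 2 = 1 + t ^ 2 := Real.sq_sqrt (by positivity)
  have : ∀ i, ‖cpar p v t i‖ ^ 2 = (1 + t ^ 2) * co p i ^ 2 + t ^ 2 * co (p * pureQ v) i ^ 2 := by
    intro i
    rw [cpar, ← Complex.normSq_eq_norm_sq, Complex.normSq_add_mul_I]
    linear_combination (co p i) ^ 2 * hs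
  simp only [this]
  rw [Finset.sum_add_distrib, ← Finset.mul_sum, ← Finset.mul_sum, h1, h2]
  ring

theorem cpar_surj (z : Fin 4 → ℂ) (hz : ∑ i, z i ^ 2 = 1) :
    ∃ (p : Quaternion ℝ) (v : EuclideanSpace ℝ (Fin 3)) (t : ℝ), normSq p = 1 ∧ ‖v‖ = 1 ∧ 0 ≤ t ∧
      cpar p v t = z := by
  let a : Quaternion ℝ := ⟨(z 0).re, (z 1).re, (z 2).re, (z 3).re⟩
  let b : Quaternion ℝ := ⟨(z 0).im, (z 1).im, (z 2).im, (z 3).im⟩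
  have hz' : ∀ i, z i = ((co a i : ℝ) : ℂ) + ((co b i : ℝ) : ℂ) * Complex.I := by
    intro i
    fin_cases i <;> exact (Complex.re_add_im _).symm
  have hre := congrArg Complex.re hz
  have him := congrArg Complex.im hz
  simp only [Fin.sum_univ_four, sq, Complex.add_re, Complex.add_im, Complex.mul_re, Complex.mul_im,
    Complex.one_re, Complex.one_im] at hre him
  have a0 : a.re = (z 0).re := rfl
  have a1 : a.imI = (z 1).re := rfl
  have a2 : a.imJ = (z 2).re := rfl
  have a3 : a.imK = (z 3).re := rfl
  have b0 : b.re = (z 0).im := rfl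
  have b1 : b.imI = (z 1).im := rfl
  have b2 : b.imJ = (z 2).im := rfl
  have b3 : b.imK = (z 3).im := rfl
  clear_value a b
  have hab : normSq a = 1 + normSq b := by
    rw [normSq_def', normSq_def']; rw [a0, a1, a2, a3, b0, b1, b2, b3]; linarith
  have hdot : (star a * b).re = 0 := by
    simp only [re_mul, re_star, imI_star, imJ_star, imK_star, a0, a1, a2, a3, b0, b1, b2, b3]; linarith
  let t := √(normSq b)
  have ht : t ^ 2 = normSq b := Real.sq_sqrt normSq_nonneg
  let s := √(1 + t ^ 2)
  have hs : s ^ 2 = 1 + t ^ 2 := Real.sq_sqrt (by positivity)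
  have hs0 : s ≠ 0 := (Real.sqrt_pos.mpr (by positivity)).ne'
  let p : Quaternion ℝ := s⁻¹ • a
  have hp : normSq p = 1 := by
    simp only [p, normSq_smul]
    rw [hab, ← ht, ← hs]; field_simp
  have hsp : ∀ i, s * co p i = co a i := by
    intro i; fin_cases i <;> simp [p, co] <;> field_simp
  obtain ⟨v, hv, hv2⟩ : ∃ v : EuclideanSpace ℝ (Fin 3), ‖v‖ = 1 ∧ t • (p * pureQ v) = b := by
    by_cases h0 : t = 0
    · refine ⟨EuclideanSpace.single 0 1, by simp, ?_⟩
      rw [h0, zero_smul]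
      symm
      rw [← normSq_eq_zero, ← ht, h0]; norm_num
    · let q : Quaternion ℝ := t⁻¹ • (star p * b)
      have hq : q.re = 0 := by
        simp only [q, p, Quaternion.star_smul, smul_mul_assoc, re_smul, hdot]
        simp
      let v : EuclideanSpace ℝ (Fin 3) := !₂[q.imI, q.imJ, q.imK]
      have hvq : pureQ v = q := by
        ext
        · simp [pureQ, hq]
        · simp [pureQ, v]
        · simp [pureQ, v]
        · simp [pureQ, v]
      refine ⟨v, ?_, ?_⟩
      · have : ‖v‖ ^ 2 = 1 := by
          rw [← norm_pureQ, hvq]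
          simp only [q, normSq_smul, map_mul, normSq_star, hp, ← ht]
          field_simp
        have h0 := norm_nonneg v
        nlinarith
      · rw [hvq]
        simp only [q, mul_smul_comm]
        rw [smul_smul, mul_inv_cancel₀ h0, one_smul, ← mul_assoc, self_mul_star, hp]
        simp
  refine ⟨p, v, t, hp, hv, Real.sqrt_nonneg _, ?_⟩
  funext i
  rw [cpar, hz', ← hsp i]
  congr 3
  rw [← hv2]
  fin_cases i <;> simp [co]

/-- The space of norm one quaternions over a product of copies of `ℝ` and `ℂ`, in coordinates. -/
abbrev XS (ι κ : Type*) := {x : Fin 4 → (ι → ℝ) × (κ → ℂ) // ∑ i, x i ^ 2 = 1}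

theorem XS_real {ι κ : Type*} (x : XS ι κ) (v : ι) : ∑ i, (x.1 i).1 v ^ 2 = 1 := by
  have := congrArg (fun z => z.1 v) x.2
  simpa [Prod.fst_sum] using this

theorem XS_cplx {ι κ : Type*} (x : XS ι κ) (w : κ) : ∑ i, (x.1 i).2 w ^ 2 = 1 := by
  have := congrArg (fun z => z.2 w) x.2
  simpa [Prod.snd_sum] using this

abbrev S3 := Metric.sphere (0 : Quaternion ℝ) 1
abbrev S2 := Metric.sphere (0 : EuclideanSpace ℝ (Fin 3)) 1

theorem S3_normSq (p : S3) : normSq (p : Quaternion ℝ) = 1 := by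
  rw [normSq_eq_norm_mul_self, norm_eq_of_mem_sphere]; norm_num

instance : PreconnectedSpace S3 := Subtype.preconnectedSpace (isPreconnected_sphere (by
  rw [rank_eq_four]; norm_num) _ _)

instance : PreconnectedSpace S2 := Subtype.preconnectedSpace (isPreconnected_sphere (by
  rw [rank_eq_card_basis (EuclideanSpace.basisFun (Fin 3) ℝ).toBasis]; simp) _ _)

theorem continuous_co (i : Fin 4) : Continuous (fun q : Quaternion ℝ => co q i) := by
  fin_cases i
  · exact continuous_re
  · exact continuous_imI
  · exact continuous_imJ
  · exact continuous_imK

theorem continuous_pureQ : Continuous pureQ := by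
  have : Continuous (fun v : EuclideanSpace ℝ (Fin 3) => (linearIsometryEquivTuple.symm
    (WithLp.toLp 2 ![0, v 0, v 1, v 2]) : Quaternion ℝ)) := by
    refine (linearIsometryEquivTuple.symm.continuous).comp ?_
    refine (PiLp.continuous_toLp 2 _).comp ?_
    refine continuous_pi fun i => ?_
    fin_cases i <;> simp <;> fun_prop
  exact this

theorem continuous_cpar (i : Fin 4) :
    Continuous (fun x : S3 × S2 × ℝ => cpar x.1 x.2.1 x.2.2 i) := by
  unfold cpar
  have h1 : Continuous (fun x : S3 × S2 × ℝ => co (x.1 : Quaternion ℝ) i) :=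
    (continuous_co i).comp (continuous_subtype_val.comp continuous_fst)
  have h2 : Continuous (fun x : S3 × S2 × ℝ => co ((x.1 : Quaternion ℝ) * pureQ x.2.1) i) := by
    refine (continuous_co i).comp ?_
    exact (continuous_subtype_val.comp continuous_fst).mul (continuous_pureQ.comp
      (continuous_subtype_val.comp (continuous_fst.comp continuous_snd)))
  fun_prop

/-- The parametrization of the space of norm one quaternions. -/
noncomputable def Par {ι κ : Type*} (y : (ι → S3) × (κ → S3 × S2 × ℝ)) : XS ι κ :=
  ⟨fun i => (fun v => co (y.1 v : Quaternion ℝ) i,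
    fun w => cpar (y.2 w).1 (y.2 w).2.1 (y.2 w).2.2 i), by
    ext v
    · simp only [Prod.fst_sum, Prod.pow_fst, Finset.sum_apply, Pi.pow_apply, Prod.fst_one,
        Pi.one_apply]
      rw [sum_co_sq, S3_normSq]
    · simp only [Prod.snd_sum, Prod.pow_snd, Finset.sum_apply, Pi.pow_apply, Prod.snd_one,
        Pi.one_apply]
      exact cpar_sum _ (S3_normSq _) _ (norm_eq_of_mem_sphere _) _⟩

theorem continuous_Par {ι κ : Type*} : Continuous (Par : _ → XS ι κ) := by
  refine Continuous.subtype_mk ?_ _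
  refine continuous_pi fun i => Continuous.prodMk ?_ ?_
  · refine continuous_pi fun v => ?_
    exact (continuous_co i).comp (continuous_subtype_val.comp
      ((continuous_apply v).comp continuous_fst))
  · refine continuous_pi fun w => ?_
    exact (continuous_cpar i).comp ((continuous_apply w).comp continuous_snd)

theorem Par_surj {ι κ : Type*} (x : XS ι κ) :
    ∃ y, Par y = x ∧ ∀ w, 0 ≤ (y.2 w).2.2 := by
  have h1 : ∀ v, ∃ p : S3, ∀ i, co (p : Quaternion ℝ) i = (x.1 i).1 v := by
    intro v
    let q : Quaternion ℝ := ⟨(x.1 0).1 v, (x.1 1).1 v, (x.1 2).1 v, (x.1 3).1 v⟩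
    have hq : ∀ i, co q i = (x.1 i).1 v := by
      intro i; fin_cases i <;> rfl
    have hn : normSq q = 1 := by
      rw [← sum_co_sq]; simp only [hq]; exact XS_real x v
    refine ⟨⟨q, ?_⟩, hq⟩
    rw [mem_sphere_zero_iff_norm]
    rw [normSq_eq_norm_mul_self] at hn
    have := norm_nonneg q
    nlinarith
  have h2 : ∀ w, ∃ y : S3 × S2 × ℝ, 0 ≤ y.2.2 ∧ ∀ i, cpar y.1 y.2.1 y.2.2 i = (x.1 i).2 w := by
    intro w
    obtain ⟨p, v, t, hp, hv, ht, h⟩ := cpar_surj (fun i => (x.1 i).2 w) (XS_cplx x w)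
    refine ⟨⟨⟨p, ?_⟩, ⟨v, by simpa using hv⟩, t⟩, ht, fun i => congrFun h i⟩
    rw [mem_sphere_zero_iff_norm]
    rw [normSq_eq_norm_mul_self] at hp
    have := norm_nonneg p
    nlinarith
  choose a ha using h1
  choose b hb0 hb using h2
  refine ⟨⟨a, b⟩, ?_, hb0⟩
  apply Subtype.ext
  funext i
  exact Prod.ext (funext fun v => ha v i) (funext fun w => hb w i)

theorem XS_comp_le {ι κ : Type*} [Fintype ι] [Fintype κ] (x : XS ι κ) (w : κ) (i : Fin 4) :
    ‖(x.1 i).2 w‖ ≤ ‖x.1‖ :=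
  ((norm_le_pi_norm (x.1 i).2 w).trans (norm_snd_le (x.1 i))).trans (norm_le_pi_norm x.1 i)

theorem Par_norm {ι κ : Type*} [Fintype ι] [Fintype κ] (y : (ι → S3) × (κ → S3 × S2 × ℝ)) (w : κ) :
    1 + 2 * (y.2 w).2.2 ^ 2 ≤ 4 * ‖(Par y).1‖ ^ 2 := by
  rw [← cpar_norm _ (S3_normSq (y.2 w).1) _ (norm_eq_of_mem_sphere (y.2 w).2.1), Fin.sum_univ_four]
  have h : ∀ i, ‖cpar (y.2 w).1 (y.2 w).2.1 (y.2 w).2.2 i‖ ^ 2 ≤ ‖(Par y).1‖ ^ 2 := fun i =>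
    pow_le_pow_left₀ (norm_nonneg _) (XS_comp_le (Par y) w i) 2
  linarith [h 0, h 1, h 2, h 3]

theorem Par_norm_le {ι κ : Type*} [Fintype ι] [Fintype κ] (y : (ι → S3) × (κ → S3 × S2 × ℝ))
    (t : ℝ) (ht : 0 ≤ t) (hy : ∀ w, 0 ≤ (y.2 w).2.2) (hy2 : ∀ w, (y.2 w).2.2 ≤ t) :
    ‖(Par y).1‖ ≤ 1 + 2 * t := by
  have h0 : (0 : ℝ) ≤ 1 + 2 * t := by positivity
  rw [pi_norm_le_iff_of_nonneg h0]
  intro i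
  rw [Prod.norm_def, max_le_iff, pi_norm_le_iff_of_nonneg h0, pi_norm_le_iff_of_nonneg h0]
  constructor
  · intro v
    have h1 := XS_real (Par y) v
    have h2 : ((Par y).1 i).1 v ^ 2 ≤ 1 := by
      rw [← h1]
      exact Finset.single_le_sum (f := fun i => ((Par y).1 i).1 v ^ 2) (fun i _ => sq_nonneg _)
        (Finset.mem_univ i)
    rw [Real.norm_eq_abs]
    have := abs_le_of_sq_le_sq (h2.trans_eq (one_pow 2).symm) zero_le_one
    linarith
  · intro w
    have h1 := cpar_norm _ (S3_normSq (y.2 w).1) _ (norm_eq_of_mem_sphere (y.2 w).2.1) (y.2 w).2.2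
    have h2 : ‖((Par y).1 i).2 w‖ ^ 2 ≤ 1 + 2 * (y.2 w).2.2 ^ 2 := by
      rw [← h1]
      exact Finset.single_le_sum (f := fun i => ‖((Par y).1 i).2 w‖ ^ 2) (fun i _ => sq_nonneg _)
        (Finset.mem_univ i)
    have h3 := hy w
    have h4 := hy2 w
    refine le_of_sq_le_sq ?_ h0
    nlinarith

theorem XS_unb {ι κ : Type*} [Fintype ι] [Fintype κ] [Nonempty κ] (T : ℝ) :
    ∃ g : XS ι κ, T < ‖g.1‖ := by
  obtain ⟨p⟩ : Nonempty S3 := ⟨⟨1, by simp⟩⟩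
  obtain ⟨v⟩ : Nonempty S2 := ⟨⟨EuclideanSpace.single 0 1, by simp⟩⟩
  obtain ⟨w⟩ := ‹Nonempty κ›
  refine ⟨Par ⟨fun _ => p, fun _ => ⟨p, v, 2 * |T|⟩⟩, ?_⟩
  have := Par_norm (⟨fun _ => p, fun _ => ⟨p, v, 2 * |T|⟩⟩ : (ι → S3) × (κ → S3 × S2 × ℝ)) w
  simp only at this
  refine lt_of_le_of_lt (le_abs_self T) (lt_of_pow_lt_pow_left₀ 2 (norm_nonneg _) ?_)
  nlinarith [sq_nonneg |T|]

theorem XS_conn {ι κ : Type*} [Fintype ι] [Fintype κ] (T : ℝ) :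
    ∃ T' : ℝ, ∃ W : Set (XS ι κ), IsPreconnected W ∧ (∀ g : XS ι κ, T' < ‖g.1‖ → g ∈ W) ∧
      ∀ g ∈ W, T < ‖g.1‖ := by
  classical
  let t := 2 * |T|
  have ht : 0 ≤ t := by positivity
  let D : κ → Set ((ι → S3) × (κ → S3 × S2 × ℝ)) := fun w =>
    Set.univ ×ˢ Set.pi Set.univ (fun w' => if w' = w then Set.univ ×ˢ (Set.univ ×ˢ Set.Ioi t)
      else Set.univ)
  have hDmem : ∀ w y, y ∈ D w ↔ t < (y.2 w).2.2 := by
    intro w y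
    simp only [D, Set.mem_prod, Set.mem_univ, true_and, Set.mem_pi, forall_const]
    constructor
    · intro h
      have := h w
      simpa using this
    · intro h w'
      by_cases hw : w' = w
      · subst hw; simpa using h
      · simp [hw]
  have hD : ∀ w, IsPreconnected (D w) := by
    intro w
    refine isPreconnected_univ.prod (isPreconnected_univ_pi fun w' => ?_)
    by_cases hw : w' = w
    · simp only [hw, if_true]
      exact isPreconnected_univ.prod (isPreconnected_univ.prod isPreconnected_Ioi)
    · simp only [hw, if_false]
      exact isPreconnected_univ
  refine ⟨1 + 2 * t, ⋃ w, Par '' D w, ?_, ?_, ?_⟩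
  · apply isPreconnected_iUnion
    · obtain ⟨p⟩ : Nonempty S3 := ⟨⟨1, by simp⟩⟩
      obtain ⟨v⟩ : Nonempty S2 := ⟨⟨EuclideanSpace.single 0 1, by simp⟩⟩
      refine ⟨Par ⟨fun _ => p, fun _ => ⟨p, v, t + 1⟩⟩, Set.mem_iInter.mpr fun w =>
        Set.mem_image_of_mem _ ?_⟩
      rw [hDmem]; simp
    · intro w
      exact (hD w).image _ continuous_Par.continuousOn
  · intro g hg
    obtain ⟨y, rfl, hy⟩ := Par_surj g
    by_contra hcon
    simp only [Set.mem_iUnion, not_exists] at hcon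
    refine absurd (Par_norm_le y t ht hy fun w => ?_) (not_le.mpr hg)
    by_contra hw
    exact hcon w (Set.mem_image_of_mem _ ((hDmem w y).mpr (not_le.mp hw)))
  · intro g hg
    obtain ⟨w, y, hy, rfl⟩ := Set.mem_iUnion.mp hg
    rw [hDmem] at hy
    have := Par_norm y w
    refine lt_of_le_of_lt (le_abs_self T) (lt_of_pow_lt_pow_left₀ 2 (norm_nonneg _) ?_)
    have h2 : t ^ 2 < (y.2 w).2.2 ^ 2 := by gcongr
    have h3 : t ^ 2 = 4 * |T| ^ 2 := by simp only [t]; ring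
    nlinarith [sq_nonneg |T|]

end GRU

namespace GRU

open Quaternion NumberField

/-- Underlying function of `qmap`. -/
def qmapFun {A B : Type*} [CommRing A] [CommRing B] (f : A →+* B) (q : Quaternion A) : Quaternion B :=
  ⟨f q.re, f q.imI, f q.imJ, f q.imK⟩

section qmapFun
variable {A B : Type*} [CommRing A] [CommRing B] (f : A →+* B)
@[simp] theorem qmapFun_re (q : Quaternion A) : (qmapFun f q).re = f q.re := rfl
@[simp] theorem qmapFun_imI (q : Quaternion A) : (qmapFun f q).imI = f q.imI := rfl
@[simp] theorem qmapFun_imJ (q : Quaternion A) : (qmapFun f q).imJ = f q.imJ := rfl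
@[simp] theorem qmapFun_imK (q : Quaternion A) : (qmapFun f q).imK = f q.imK := rfl
end qmapFun

/-- Functoriality of the quaternions. -/
def qmap {A B : Type*} [CommRing A] [CommRing B] (f : A →+* B) : Quaternion A →+* Quaternion B where
  toFun := qmapFun f
  map_one' := by ext <;> simp
  map_zero' := by ext <;> simp
  map_add' p q := by ext <;> simp
  map_mul' p q := by ext <;> simp

section qmap
variable {A B : Type*} [CommRing A] [CommRing B] (f : A →+* B)
@[simp] theorem qmap_re (q : Quaternion A) : (qmap f q).re = f q.re := rfl
@[simp] theorem qmap_imI (q : Quaternion A) : (qmap f q).imI = f q.imI := rfl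
@[simp] theorem qmap_imJ (q : Quaternion A) : (qmap f q).imJ = f q.imJ := rfl
@[simp] theorem qmap_imK (q : Quaternion A) : (qmap f q).imK = f q.imK := rfl
theorem qmap_co (q : Quaternion A) (i : Fin 4) : co (qmap f q) i = f (co q i) := by
  fin_cases i <;> rfl
theorem qmap_normSq (q : Quaternion A) : normSq (qmap f q) = f (normSq q) := by
  simp [normSq_def']
theorem qmap_star (q : Quaternion A) : qmap f (star q) = star (qmap f q) := by
  ext <;> simp
theorem qmap_inj (hf : Function.Injective f) : Function.Injective (qmap f) := by
  intro p q h
  ext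
  · exact hf (congrArg QuaternionAlgebra.re h)
  · exact hf (congrArg QuaternionAlgebra.imI h)
  · exact hf (congrArg QuaternionAlgebra.imJ h)
  · exact hf (congrArg QuaternionAlgebra.imK h)
end qmap

/-- The quaternion with given coordinates. -/
def qof {A : Type*} [CommRing A] (x : Fin 4 → A) : Quaternion A := ⟨x 0, x 1, x 2, x 3⟩

section qof
variable {A : Type*} [CommRing A]
@[simp] theorem qof_re (x : Fin 4 → A) : (qof x).re = x 0 := rfl
@[simp] theorem qof_imI (x : Fin 4 → A) : (qof x).imI = x 1 := rfl
@[simp] theorem qof_imJ (x : Fin 4 → A) : (qof x).imJ = x 2 := rfl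
@[simp] theorem qof_imK (x : Fin 4 → A) : (qof x).imK = x 3 := rfl
@[simp] theorem co_qof (x : Fin 4 → A) : co (qof x) = x := by
  funext i; fin_cases i <;> rfl
@[simp] theorem qof_co (q : Quaternion A) : qof (co q) = q := by
  ext <;> rfl
theorem co_inj {p q : Quaternion A} (h : co p = co q) : p = q := by
  rw [← qof_co p, h, qof_co]

/-- Matrix of left multiplication by a quaternion. -/
def lmat (g : Quaternion A) : Matrix (Fin 4) (Fin 4) A :=
  !![g.re, -g.imI, -g.imJ, -g.imK; g.imI, g.re, -g.imK, g.imJ;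
    g.imJ, g.imK, g.re, -g.imI; g.imK, -g.imJ, g.imI, g.re]

theorem lmat_mulVec (g : Quaternion A) (x : Fin 4 → A) : (lmat g).mulVec x = co (g * qof x) := by
  funext i
  fin_cases i <;> simp [lmat, Matrix.mulVec, dotProduct, Fin.sum_univ_four, co] <;> ring

theorem lmat_det (g : Quaternion A) : (lmat g).det = normSq g ^ 2 := by
  rw [normSq_def']
  simp only [lmat]
  rw [Matrix.det_succ_row_zero]
  simp [Fin.sum_univ_succ, Matrix.det_fin_three, Fin.succAbove]
  ring
end qof

theorem qn_mul {E : Type*} [NormedCommRing E] (p q : Quaternion E) :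
    ‖co (p * q)‖ ≤ 4 * ‖co p‖ * ‖co q‖ := by
  rw [pi_norm_le_iff_of_nonneg (by positivity)]
  have hp : ∀ i, ‖co p i‖ ≤ ‖co p‖ := norm_le_pi_norm _
  have hq : ∀ i, ‖co q i‖ ≤ ‖co q‖ := norm_le_pi_norm _
  have h : ∀ i j, ‖co p i * co q j‖ ≤ ‖co p‖ * ‖co q‖ := fun i j =>
    (norm_mul_le _ _).trans (mul_le_mul (hp i) (hq j) (norm_nonneg _) (norm_nonneg _))
  have key : ∀ a b c d : E, ∀ M : ℝ, ‖a‖ ≤ M → ‖b‖ ≤ M → ‖c‖ ≤ M → ‖d‖ ≤ M →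
      ‖a + b + c + d‖ ≤ 4 * M := by
    intro a b c d M ha hb hc hd
    have h1 := norm_add_le (a + b + c) d
    have h2 := norm_add_le (a + b) c
    have h3 := norm_add_le a b
    linarith
  intro i
  rw [mul_assoc]
  fin_cases i
  · have := key (co p 0 * co q 0) (-(co p 1 * co q 1)) (-(co p 2 * co q 2)) (-(co p 3 * co q 3)) _
      (h _ _) (by rw [norm_neg]; exact h _ _) (by rw [norm_neg]; exact h _ _)
      (by rw [norm_neg]; exact h _ _)
    refine le_trans (le_of_eq (congrArg norm ?_)) this
    show co (p * q) 0 = _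
    simp [co]; try ring
  · have := key (co p 0 * co q 1) (co p 1 * co q 0) (co p 2 * co q 3) (-(co p 3 * co q 2)) _
      (h _ _) (h _ _) (h _ _) (by rw [norm_neg]; exact h _ _)
    refine le_trans (le_of_eq (congrArg norm ?_)) this
    show co (p * q) 1 = _
    simp [co]; try ring
  · have := key (co p 0 * co q 2) (-(co p 1 * co q 3)) (co p 2 * co q 0) (co p 3 * co q 1) _
      (h _ _) (by rw [norm_neg]; exact h _ _) (h _ _) (h _ _)
    refine le_trans (le_of_eq (congrArg norm ?_)) this
    show co (p * q) 2 = _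
    simp [co]; try ring
  · have := key (co p 0 * co q 3) (co p 1 * co q 2) (-(co p 2 * co q 1)) (co p 3 * co q 0) _
      (h _ _) (h _ _) (by rw [norm_neg]; exact h _ _) (h _ _)
    refine le_trans (le_of_eq (congrArg norm ?_)) this
    show co (p * q) 3 = _
    simp [co]; try ring

theorem qn_star {E : Type*} [NormedCommRing E] (p : Quaternion E) : ‖co (star p)‖ = ‖co p‖ := by
  have h : ∀ p : Quaternion E, ‖co (star p)‖ ≤ ‖co p‖ := by
    intro p
    rw [pi_norm_le_iff_of_nonneg (norm_nonneg _)]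
    have hp : ∀ i, ‖co p i‖ ≤ ‖co p‖ := norm_le_pi_norm _
    intro i
    refine le_trans (le_of_eq ?_) (hp i)
    fin_cases i <;> simp [co]
  apply le_antisymm (h p)
  have := h (star p)
  rwa [star_star] at this

theorem normSq_norm_le {E : Type*} [NormedCommRing E] (p : Quaternion E) :
    ‖normSq p‖ ≤ 4 * ‖co p‖ ^ 2 := by
  rw [← sum_co_sq]
  refine (norm_sum_le _ _).trans ?_
  have h : ∀ i, ‖co p i ^ 2‖ ≤ ‖co p‖ ^ 2 := fun i =>
    (norm_pow_le' _ (by norm_num)).trans (pow_le_pow_left₀ (norm_nonneg _) (norm_le_pi_norm _ i) 2)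
  rw [Fin.sum_univ_four]
  linarith [h 0, h 1, h 2, h 3]

variable (L : Type*) [Field L] [NumberField L]

/-- The embedding of integral quaternions. -/
noncomputable def jO : Quaternion (𝓞 L) →+* Quaternion (mixedEmbedding.mixedSpace L) :=
  qmap ((mixedEmbedding L).comp (algebraMap (𝓞 L) L))

open scoped Classical in
theorem mink : ∃ C : ℝ, ∀ g : Quaternion (mixedEmbedding.mixedSpace L), normSq g = 1 →
    ∃ x : Quaternion (𝓞 L), x ≠ 0 ∧ ‖co (g * jO L x)‖ ≤ C := by
  classical
  let E := mixedEmbedding.mixedSpace L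
  let V := Fin 4 → E
  let b : Module.Basis _ ℝ V := Pi.basis (fun _ : Fin 4 => mixedEmbedding.latticeBasis L)
  let _ : MeasurableSpace V := borel V
  have _ : BorelSpace V := ⟨rfl⟩
  let μ : MeasureTheory.Measure V := MeasureTheory.Measure.addHaar
  have hcount : Countable (Submodule.span ℤ (Set.range b)).toAddSubgroup :=
    inferInstanceAs (Countable (Submodule.span ℤ (Set.range b)))
  have hfd := ZSpan.isAddFundamentalDomain b μ
  have hF : μ (ZSpan.fundamentalDomain b) < ⊤ :=
    (ZSpan.fundamentalDomain_isBounded b).measure_lt_top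
  have : NoncompactSpace V := NormedSpace.noncompactSpace ℝ V
  have hV : μ Set.univ = ⊤ := MeasureTheory.measure_univ_of_isAddLeftInvariant μ
  have hU : (⋃ n : ℕ, Metric.ball (0 : V) n) = Set.univ := Metric.iUnion_ball_nat 0
  obtain ⟨n, hn⟩ : ∃ n : ℕ, μ (ZSpan.fundamentalDomain b) * 2 ^ Module.finrank ℝ V <
      μ (Metric.ball (0 : V) n) := by
    rw [← hU, Monotone.measure_iUnion] at hV
    · have h2 : μ (ZSpan.fundamentalDomain b) * 2 ^ Module.finrank ℝ V < ⊤ :=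
        ENNReal.mul_lt_top hF (by simp)
      rw [← hV] at h2
      exact lt_iSup_iff.mp h2
    · intro m k hmk
      exact Metric.ball_subset_ball (by exact_mod_cast hmk)
  refine ⟨n, fun g hg => ?_⟩
  let f : V →ₗ[ℝ] V := (Matrix.toLin' (lmat g)).restrictScalars ℝ
  have hdet : LinearMap.det f = 1 := by
    rw [LinearMap.det_restrictScalars, LinearMap.det_toLin', lmat_det, hg, one_pow, map_one]
  have hμ : μ (f ⁻¹' Metric.ball 0 n) = μ (Metric.ball (0 : V) n) := by
    rw [MeasureTheory.Measure.addHaar_preimage_linearMap μ (by rw [hdet]; exact one_ne_zero), hdet]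
    simp
  rw [← hμ] at hn
  obtain ⟨x, hx, hx2⟩ := MeasureTheory.exists_ne_zero_mem_lattice_of_measure_mul_two_pow_lt_measure
    (L := (Submodule.span ℤ (Set.range b)).toAddSubgroup) (s := f ⁻¹' Metric.ball 0 n) hfd
    (by
      intro y hy
      simp only [Set.mem_preimage, map_neg, mem_ball_zero_iff, norm_neg] at hy ⊢
      exact hy)
    ((convex_ball 0 _).linear_preimage f) hn
  have hxi : ∀ i, ∃ a : 𝓞 L, mixedEmbedding L a = (x : V) i := by
    intro i
    have hm : (x : V) i ∈ Submodule.span ℤ (Set.range (mixedEmbedding.latticeBasis L)) := by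
      have hxm : (x : V) ∈ Submodule.span ℤ (Set.range b) := x.2
      generalize (x : V) = y at hxm
      induction hxm using Submodule.span_induction with
      | mem y hy =>
        obtain ⟨⟨k, l⟩, rfl⟩ := hy
        have hb : b ⟨k, l⟩ = Pi.single k (mixedEmbedding.latticeBasis L l) :=
          Pi.basis_apply _ _
        rw [hb]
        by_cases hki : i = k
        · subst hki; rw [Pi.single_eq_same]; exact Submodule.subset_span ⟨l, rfl⟩
        · rw [Pi.single_eq_of_ne hki]; exact Submodule.zero_mem _
      | zero => exact Submodule.zero_mem _
      | add y z _ _ hy hz => exact Submodule.add_mem _ hy hz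
      | smul a y _ hy => exact Submodule.smul_mem _ a hy
    rw [mixedEmbedding.mem_span_latticeBasis] at hm
    obtain ⟨z, hz⟩ := hm
    exact ⟨z, hz⟩
  choose a ha using hxi
  have hjx : jO L (qof a) = qof (x : V) := by
    apply co_inj
    funext i
    rw [jO, qmap_co, co_qof, co_qof, ← ha i]; rfl
  refine ⟨qof a, ?_, ?_⟩
  · rintro h0
    apply hx
    rw [h0, map_zero] at hjx
    apply Subtype.ext
    rw [← co_qof (x : V), ← hjx]
    funext i; fin_cases i <;> rfl
  · rw [hjx, ← lmat_mulVec]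
    have h3 : f (x : V) ∈ Metric.ball (0 : V) n := hx2
    rw [mem_ball_zero_iff] at h3
    have h4 : f (x : V) = (lmat g).mulVec (x : V) := Matrix.toLin'_apply _ _
    rw [← h4]
    exact h3.le

end GRU

namespace GRU

open Quaternion NumberField

open scoped Classical in
theorem fin_O (L : Type*) [Field L] [NumberField L] (B : ℝ) :
    {a : 𝓞 L | ‖mixedEmbedding L (a : L)‖ ≤ B}.Finite := by
  have h := Embeddings.finite_of_norm_le L ℂ B
  refine Set.Finite.subset (h.preimage (f := fun a : 𝓞 L => (a : L))
    (fun a _ b _ hab => RingOfIntegers.ext hab)) ?_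
  intro a ha
  refine ⟨a.isIntegral_coe, fun φ => ?_⟩
  have h1 : ‖φ a‖ = (InfinitePlace.mk φ) (a : L) := rfl
  rw [h1, ← mixedEmbedding.normAtPlace_apply]
  refine le_trans ?_ ha
  rcases InfinitePlace.isReal_or_isComplex (InfinitePlace.mk φ) with hw | hw
  · rw [mixedEmbedding.normAtPlace_apply_of_isReal hw]
    exact (norm_le_pi_norm _ _).trans (norm_fst_le _)
  · rw [mixedEmbedding.normAtPlace_apply_of_isComplex hw]
    exact (norm_le_pi_norm _ _).trans (norm_snd_le _)

open scoped Classical in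
theorem fin_HO (L : Type*) [Field L] [NumberField L] (B : ℝ) :
    {x : Quaternion (𝓞 L) | ‖co (jO L x)‖ ≤ B}.Finite := by
  have h := Set.Finite.pi (t := fun _ : Fin 4 => {a : 𝓞 L | ‖mixedEmbedding L (a : L)‖ ≤ B})
    (fun _ => fin_O L B)
  refine Set.Finite.subset (h.preimage (f := fun x : Quaternion (𝓞 L) => co x)
    (fun a _ b _ hab => co_inj hab)) ?_
  intro x hx
  simp only [Set.mem_preimage, Set.mem_pi, Set.mem_univ, true_imp_iff]
  intro i
  have h1 := norm_le_pi_norm (co (jO L x)) i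
  rw [jO, qmap_co] at h1
  exact h1.trans hx

/-- The inclusion of integral quaternions. -/
noncomputable def inc (L : Type*) [Field L] [NumberField L] : Quaternion (𝓞 L) →+* Quaternion L :=
  qmap (algebraMap (𝓞 L) L)

theorem inc_inj (L : Type*) [Field L] [NumberField L] : Function.Injective (inc L) :=
  qmap_inj _ RingOfIntegers.coe_injective

theorem jO_eq (L : Type*) [Field L] [NumberField L] (x : Quaternion (𝓞 L)) :
    jO L x = qmap (mixedEmbedding L) (inc L x) := rfl

theorem co_add_coe_mul {A : Type*} [CommRing A] (y w : Quaternion A) (a : A) (i : Fin 4) :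
    co (y + (a : Quaternion A) * w) i = co y i + a * co w i := by
  fin_cases i <;> simp [co]

theorem norm_class (L : Type*) [Field L] [NumberField L] (a : 𝓞 L) (ha : a ≠ 0) :
    ∃ W : Set (Quaternion L), W.Finite ∧ ∀ x : Quaternion (𝓞 L), normSq x = a →
      ∃ w ∈ W, ∃ u : Quaternion (𝓞 L), normSq u = 1 ∧ inc L u = inc L x * w := by
  classical
  let S := {x : Quaternion (𝓞 L) // normSq x = a}
  have hfin : Finite (𝓞 L ⧸ Ideal.span {a}) :=
    Ring.HasFiniteQuotients.finiteQuotient (by simpa using ha)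
  let f : S → (Fin 4 → 𝓞 L ⧸ Ideal.span {a}) := fun x i => Ideal.Quotient.mk _ (co x.1 i)
  have haL : (a : L) ≠ 0 := by
    intro h; exact ha (RingOfIntegers.ext h)
  refine ⟨Set.range (fun c : Set.range f =>
    inc L (star (Set.rangeSplitting f c).1) * ((a : L)⁻¹ : L)), Set.finite_range _, ?_⟩
  intro x hx
  let c : Set.range f := ⟨f ⟨x, hx⟩, ⟨_, rfl⟩⟩
  refine ⟨_, ⟨c, rfl⟩, ?_⟩
  set y : S := Set.rangeSplitting f c with hy
  have hfy : f y = f ⟨x, hx⟩ := Set.apply_rangeSplitting f c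
  have hd : ∀ i, ∃ z, co x i = co y.1 i + a * z := by
    intro i
    have h1 := congrFun hfy i
    simp only [f] at h1
    rw [eq_comm, Ideal.Quotient.mk_eq_mk_iff_sub_mem, Ideal.mem_span_singleton] at h1
    obtain ⟨z, hz⟩ := h1
    exact ⟨z, by rw [← hz]; ring⟩
  choose z hz using hd
  have hxy : x = y.1 + (a : Quaternion (𝓞 L)) * qof z := by
    apply co_inj; funext i; rw [hz, co_add_coe_mul, co_qof]
  have hys : y.1 * star y.1 = (a : Quaternion (𝓞 L)) := by rw [self_mul_star, y.2]
  let u := 1 + qof z * star y.1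
  have hu : x * star y.1 = (a : Quaternion (𝓞 L)) * u := by
    rw [hxy, add_mul, hys, mul_add, mul_one, mul_assoc]
  refine ⟨u, ?_, ?_⟩
  · have h2 := congrArg normSq hu
    rw [map_mul, map_mul, normSq_star, hx, y.2, normSq_coe] at h2
    have : a ^ 2 * normSq u = a ^ 2 * 1 := by rw [← h2]; ring
    exact mul_left_cancel₀ (pow_ne_zero 2 ha) this
  · have h2 := congrArg (inc L) hu
    rw [map_mul, map_mul] at h2
    rw [← mul_assoc, h2]
    have h3 : inc L (a : Quaternion (𝓞 L)) = ((a : L) : Quaternion L) := by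
      ext <;> simp [inc]
    rw [h3, coe_commutes, mul_assoc, ← coe_mul, mul_inv_cancel₀ haL, coe_one, mul_one]

open scoped Classical in
theorem cocompact (L : Type*) [Field L] [NumberField L]
    (hdiv : ∀ x : Quaternion (𝓞 L), normSq x = 0 → x = 0) :
    ∃ r : ℝ, ∀ g : Quaternion (mixedEmbedding.mixedSpace L), normSq g = 1 →
      ∃ u : Quaternion (𝓞 L), normSq u = 1 ∧ ‖co (g * jO L u)‖ ≤ r := by
  obtain ⟨C, hC⟩ := mink L
  have hA := fin_O L (4 * C ^ 2)
  have hW : ∀ a : 𝓞 L, ∃ W : Set (Quaternion L), W.Finite ∧ (a ≠ 0 → ∀ x : Quaternion (𝓞 L),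
      normSq x = a → ∃ w ∈ W, ∃ u : Quaternion (𝓞 L), normSq u = 1 ∧ inc L u = inc L x * w) := by
    intro a
    by_cases ha : a = 0
    · exact ⟨∅, Set.finite_empty, fun h => absurd ha h⟩
    · obtain ⟨W, h1, h2⟩ := norm_class L a ha
      exact ⟨W, h1, fun _ => h2⟩
  choose W hWf hWx using hW
  have hfin : (⋃ a ∈ {a : 𝓞 L | ‖mixedEmbedding L (a : L)‖ ≤ 4 * C ^ 2}, W a).Finite :=
    hA.biUnion (fun a _ => hWf a)
  obtain ⟨M, hM⟩ := (hfin.image (fun w => ‖co (qmap (mixedEmbedding L) w)‖)).bddAbove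
  refine ⟨4 * C * M, fun g hg => ?_⟩
  obtain ⟨x, hx0, hx⟩ := hC g hg
  have hC0 : 0 ≤ C := (norm_nonneg _).trans hx
  have hn : ‖mixedEmbedding L ((normSq x : 𝓞 L) : L)‖ ≤ 4 * C ^ 2 := by
    have h1 : normSq (g * jO L x) = mixedEmbedding L ((normSq x : 𝓞 L) : L) := by
      rw [map_mul, hg, one_mul, jO, qmap_normSq]; rfl
    rw [← h1]
    refine (normSq_norm_le _).trans ?_
    gcongr
  obtain ⟨w, hw, u, hu, hux⟩ := hWx (normSq x) (fun h => hx0 (hdiv x h)) x rfl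
  refine ⟨u, hu, ?_⟩
  have h2 : jO L u = jO L x * qmap (mixedEmbedding L) w := by
    rw [jO_eq, hux, map_mul, jO_eq]
  rw [h2, ← mul_assoc]
  refine (qn_mul _ _).trans ?_
  have h3 : ‖co (qmap (mixedEmbedding L) w)‖ ≤ M :=
    hM ⟨w, Set.mem_biUnion (show normSq x ∈ {a : 𝓞 L | _} from hn) hw, rfl⟩
  gcongr

end GRU

namespace GRU

open Quaternion NumberField

theorem mem_unitary_iff {A : Type*} [CommRing A] (q : Quaternion A) :
    q ∈ unitary (Quaternion A) ↔ normSq q = 1 := by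
  rw [Unitary.mem_iff, star_mul_self, self_mul_star, and_self]
  constructor
  · intro h
    have := congrArg QuaternionAlgebra.re h
    simpa using this
  · intro h; rw [h, coe_one]

open scoped Classical in
theorem not_free (L : Type*) [Field L] [NumberField L]
    (hc : ∃ w : InfinitePlace L, w.IsComplex)
    (hdiv : ∀ x : Quaternion (𝓞 L), normSq x = 0 → x = 0)
    (Δ : Subgroup (unitary (Quaternion (𝓞 L)))) (hΔ : Δ.FiniteIndex)
    {α : Type*} (e : Δ ≃* FreeGroup α) : False := by
  obtain ⟨w0, hw0⟩ := hc
  have hne : Nonempty {w : InfinitePlace L // w.IsComplex} := ⟨⟨w0, hw0⟩⟩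
  let X := XS {w : InfinitePlace L // w.IsReal} {w : InfinitePlace L // w.IsComplex}
  let j : Δ → Quaternion (mixedEmbedding.mixedSpace L) := fun δ => jO L (δ : Quaternion (𝓞 L))
  have jmul : ∀ p q : Δ, j (p * q) = j p * j q := fun p q => by
    simp only [j, ← map_mul]; rfl
  have jone : j 1 = 1 := map_one (jO L)
  have jinv : ∀ p : Δ, j p⁻¹ = star (j p) := fun p => by
    simp only [j]; rw [jO, ← qmap_star]; rfl
  let h : Δ → X → ℝ := fun δ g => ‖co (j δ * qof g.1)‖
  have hN : ∀ g : X, normSq (qof g.1) = 1 := fun g => by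
    rw [← sum_co_sq, co_qof]; exact g.2
  have hgg : ∀ g : X, qof g.1 * star (qof g.1) = 1 := fun g => by
    rw [self_mul_star, hN, coe_one]
  have h1 : ∀ g : X, h 1 g = ‖g.1‖ := fun g => by
    simp only [h]; rw [jone, one_mul, co_qof]
  obtain ⟨r, hr⟩ := cocompact L hdiv
  -- coset representatives
  have hfin : Finite (unitary (Quaternion (𝓞 L)) ⧸ Δ) := Subgroup.finite_quotient_of_finiteIndex
  obtain ⟨M, hM⟩ := (Set.finite_range
    (fun c : unitary (Quaternion (𝓞 L)) ⧸ Δ =>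
      ‖co (jO L ((c.out⁻¹ : unitary (Quaternion (𝓞 L))) : Quaternion (𝓞 L)))‖)).bddAbove
  let r' : ℝ := max (4 * M * r) ‖co (1 : Quaternion (mixedEmbedding.mixedSpace L))‖ + 1
  refine end_contra e (X := X) h r' ?_ ?_ ?_ ?_ ?_ ?_ ?_
  · intro δ
    simp only [h]
    simp_rw [← lmat_mulVec]
    exact (Continuous.matrix_mulVec continuous_const continuous_subtype_val).norm
  · intro g
    obtain ⟨u, hu, hur⟩ := hr (star (qof g.1)) (by rw [normSq_star]; exact hN g)
    have husm : star u ∈ unitary (Quaternion (𝓞 L)) := by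
      rw [mem_unitary_iff, normSq_star, hu]
    let v : unitary (Quaternion (𝓞 L)) := ⟨star u, husm⟩
    let t : unitary (Quaternion (𝓞 L)) := (QuotientGroup.mk v : unitary (Quaternion (𝓞 L)) ⧸ Δ).out
    have ht : t⁻¹ * v ∈ Δ := by
      rw [← QuotientGroup.eq]; exact Quotient.out_eq _
    refine ⟨⟨t⁻¹ * v, ht⟩, ?_⟩
    have e1 : j ⟨t⁻¹ * v, ht⟩ = jO L ((t⁻¹ : unitary (Quaternion (𝓞 L))) : Quaternion (𝓞 L)) *
        jO L (star u) := by
      rw [← map_mul]; rfl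
    have e2 : ‖co (jO L (star u) * qof g.1)‖ ≤ r := by
      rw [← qn_star, star_mul, jO, qmap_star, star_star]; exact hur
    simp only [h]
    rw [e1, mul_assoc]
    have hM' : ‖co (jO L ((t⁻¹ : unitary (Quaternion (𝓞 L))) : Quaternion (𝓞 L)))‖ ≤ M :=
      hM ⟨_, rfl⟩
    have hM0 : 0 ≤ M := (norm_nonneg _).trans hM'
    calc _ ≤ _ := qn_mul _ _
      _ ≤ 4 * M * r := by gcongr
      _ ≤ _ := le_max_left _ _
      _ < r' := lt_add_one _
  · intro s
    refine ⟨{δ : Δ | ‖co (j δ)‖ ≤ 4 * s * s}, ?_, ?_⟩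
    · exact (fin_HO L (4 * s * s)).preimage (f := fun δ : Δ => (δ : Quaternion (𝓞 L)))
        (fun a _ b _ hab => Subtype.ext (Subtype.ext hab))
    · intro p q g hp hq
      have e1 : j (q * p⁻¹) = (j q * qof g.1) * star (j p * qof g.1) := by
        rw [star_mul, mul_assoc, ← mul_assoc (qof g.1), hgg, one_mul, jmul, jinv]
      show ‖co (j (q * p⁻¹))‖ ≤ _
      rw [e1]
      have hs : 0 ≤ s := (norm_nonneg _).trans hp.le
      refine (qn_mul _ _).trans ?_
      rw [qn_star]
      simp only [h] at hp hq
      gcongr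
  · intro p
    have hp : ∑ i, co (j p⁻¹) i ^ 2 = 1 := by
      rw [sum_co_sq]
      simp only [j]
      rw [jO, qmap_normSq, (mem_unitary_iff _).1 (p⁻¹ : Δ).1.2, map_one]
    refine ⟨⟨co (j p⁻¹), hp⟩, ?_⟩
    simp only [h]
    rw [qof_co, ← jmul, mul_inv_cancel, jone]
    exact lt_of_le_of_lt (le_max_right _ _) (lt_add_one _)
  · intro p s
    refine ⟨4 * ‖co (j p⁻¹)‖ * s, fun g hg => ?_⟩
    have e1 : j 1 * qof g.1 = j p⁻¹ * (j p * qof g.1) := by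
      rw [← mul_assoc, ← jmul, inv_mul_cancel]
    simp only [h] at hg ⊢
    rw [e1]
    refine (qn_mul _ _).trans ?_
    gcongr
  · intro T
    obtain ⟨g, hg⟩ := XS_unb (ι := {w : InfinitePlace L // w.IsReal})
      (κ := {w : InfinitePlace L // w.IsComplex}) T
    exact ⟨g, by rw [h1]; exact hg⟩
  · intro T
    obtain ⟨T', W, hW, ha, hb⟩ := XS_conn (ι := {w : InfinitePlace L // w.IsReal})
      (κ := {w : InfinitePlace L // w.IsComplex}) T
    exact ⟨T', W, hW, fun g hg => ha g (by rw [h1] at hg; exact hg),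
      fun g hg => by rw [h1]; exact hb g hg⟩

end GRU

namespace GRU

open Quaternion NumberField

section Qalg
variable {F : Type*} [Field F] [CharZero F]

theorem q_comm_iff (p q : Quaternion F) : p * q = q * p ↔
    (p.imJ * q.imK = p.imK * q.imJ ∧ p.imK * q.imI = p.imI * q.imK ∧
      p.imI * q.imJ = p.imJ * q.imI) := by
  have h2 : (2 : F) ≠ 0 := two_ne_zero
  constructor
  · intro h
    have h1 := congrArg QuaternionAlgebra.imI h
    have h2' := congrArg QuaternionAlgebra.imJ h
    have h3 := congrArg QuaternionAlgebra.imK h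
    simp only [imI_mul, imJ_mul, imK_mul] at h1 h2' h3
    refine ⟨?_, ?_, ?_⟩ <;> apply mul_left_cancel₀ h2
    · linear_combination h1
    · linear_combination h2'
    · linear_combination h3
  · rintro ⟨h1, h2', h3⟩
    ext
    · simp only [re_mul]; ring
    · simp only [imI_mul]; linear_combination 2 * h1
    · simp only [imJ_mul]; linear_combination 2 * h2'
    · simp only [imK_mul]; linear_combination 2 * h3

theorem q_par (p q : Quaternion F) (h : p * q = q * p)
    (hq : q.imI ≠ 0 ∨ q.imJ ≠ 0 ∨ q.imK ≠ 0) :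
    ∃ l, p.imI = l * q.imI ∧ p.imJ = l * q.imJ ∧ p.imK = l * q.imK := by
  rw [q_comm_iff] at h
  obtain ⟨a1, a2, a3⟩ := h
  rcases hq with hx | hx | hx
  · refine ⟨p.imI / q.imI, ?_, ?_, ?_⟩ <;> field_simp
    · linear_combination -a3
    · linear_combination a2
  · refine ⟨p.imJ / q.imJ, ?_, ?_, ?_⟩ <;> field_simp
    · linear_combination a3
    · linear_combination -a1
  · refine ⟨p.imK / q.imK, ?_, ?_, ?_⟩ <;> field_simp
    · linear_combination -a2
    · linear_combination a1

theorem q_centr (p p' q : Quaternion F) (h : p * q = q * p) (h' : p' * q = q * p')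
    (hn : p * p' ≠ p' * p) : q.imI = 0 ∧ q.imJ = 0 ∧ q.imK = 0 := by
  by_contra hc
  have hcase : q.imI ≠ 0 ∨ q.imJ ≠ 0 ∨ q.imK ≠ 0 := by tauto
  obtain ⟨l, a1, a2, a3⟩ := q_par p q h hcase
  obtain ⟨l', b1, b2, b3⟩ := q_par p' q h' hcase
  apply hn
  rw [q_comm_iff, a1, a2, a3, b1, b2, b3]
  refine ⟨?_, ?_, ?_⟩ <;> ring

theorem q_real_sq (q : Quaternion F) (h : q.imI = 0 ∧ q.imJ = 0 ∧ q.imK = 0)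
    (hn : normSq q = 1) : q * q = 1 := by
  obtain ⟨h1, h2, h3⟩ := h
  rw [normSq_def', h1, h2, h3] at hn
  ext <;> simp [h1, h2, h3]
  linear_combination hn

/-- The units `i`. -/
def qI (A : Type*) [CommRing A] : Quaternion A := qof ![0, 1, 0, 0]
/-- The unit `j`. -/
def qJ (A : Type*) [CommRing A] : Quaternion A := qof ![0, 0, 1, 0]
/-- The unit `k`. -/
def qK (A : Type*) [CommRing A] : Quaternion A := qof ![0, 0, 0, 1]

theorem div_of_nilcomm (hN : ∀ n n' : Quaternion F, n * n = 0 → n' * n' = 0 → n * n' = n' * n)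
    (q : Quaternion F) (hq : normSq q = 0) : q = 0 := by
  -- nilpotents vanish
  have hnil : ∀ n : Quaternion F, n * n = 0 → n.re = 0 → n = 0 := by
    intro n hn hre
    have h1 := hN n (qI F * n * qI F) hn (by
      have : qI F * qI F = -1 := by ext <;> simp [qI]
      calc qI F * n * qI F * (qI F * n * qI F) = qI F * n * (qI F * qI F) * n * qI F := by
            noncomm_ring
        _ = -(qI F * (n * n) * qI F) := by rw [this]; noncomm_ring
        _ = 0 := by rw [hn]; simp)
    have h2 := hN n (qJ F * n * qJ F) hn (by
      have : qJ F * qJ F = -1 := by ext <;> simp [qJ]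
      calc qJ F * n * qJ F * (qJ F * n * qJ F) = qJ F * n * (qJ F * qJ F) * n * qJ F := by
            noncomm_ring
        _ = -(qJ F * (n * n) * qJ F) := by rw [this]; noncomm_ring
        _ = 0 := by rw [hn]; simp)
    rw [q_comm_iff] at h1 h2
    simp [qI, qJ] at h1 h2
    have h3 := congrArg QuaternionAlgebra.re hn
    simp [hre] at h3
    have e2 : (2 : F) ≠ 0 := two_ne_zero
    have bd : n.imI * n.imK = 0 := by
      apply mul_left_cancel₀ e2; grind
    have bc : n.imI * n.imJ = 0 := by
      apply mul_left_cancel₀ e2; grind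
    have cd : n.imJ * n.imK = 0 := by
      apply mul_left_cancel₀ e2; grind
    have hb : n.imI = 0 := by
      have : n.imI ^ 4 = 0 := by grind
      simpa using this
    have hc : n.imJ = 0 := by
      have : n.imJ ^ 4 = 0 := by grind
      simpa using this
    have hd : n.imK = 0 := by
      have : n.imK ^ 4 = 0 := by grind
      simpa using this
    ext <;> simp [*]
  have hss : star q * q = 0 := by rw [star_mul_self, hq, coe_zero]
  have key : ∀ a : Quaternion F, a.re = 0 → star a = -a → q * a * star q = 0 := by
    intro a ha hsa
    apply hnil
    · calc q * a * star q * (q * a * star q) = q * a * (star q * q) * a * star q := by noncomm_ring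
        _ = 0 := by rw [hss]; simp
    · have : star (q * a * star q) = -(q * a * star q) := by
        rw [star_mul, star_mul, star_star, hsa]; noncomm_ring
      have h4 := congrArg QuaternionAlgebra.re this
      simp only [re_star, re_neg] at h4
      have : (2 : F) * (q * a * star q).re = 0 := by linear_combination h4
      simpa using this
  have k1 := congrArg QuaternionAlgebra.imI (key (qI F) (by simp [qI]) (by ext <;> simp [qI]))
  have k2 := congrArg QuaternionAlgebra.imJ (key (qJ F) (by simp [qJ]) (by ext <;> simp [qJ]))
  have k3 := congrArg QuaternionAlgebra.imK (key (qK F) (by simp [qK]) (by ext <;> simp [qK]))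
  simp [qI, qJ, qK] at k1 k2 k3
  rw [normSq_def'] at hq
  have ha : q.re = 0 := by
    have : 4 * q.re ^ 2 = 0 := by linear_combination k1 + k2 + k3 + hq
    simpa using this
  have hb : q.imI = 0 := by
    have : 4 * q.imI ^ 2 = 0 := by linear_combination k1 - k2 - k3 + hq
    simpa using this
  have hc : q.imJ = 0 := by
    have : 4 * q.imJ ^ 2 = 0 := by linear_combination -k1 + k2 - k3 + hq
    simpa using this
  have hd : q.imK = 0 := by
    have : 4 * q.imK ^ 2 = 0 := by linear_combination -k1 - k2 + k3 + hq
    simpa using this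
  ext <;> simp [*]

end Qalg

/-- Cyclic permutation of the coordinates. -/
def tauFun {A : Type*} [CommRing A] (q : Quaternion A) : Quaternion A :=
  qof ![q.re, q.imK, q.imI, q.imJ]

/-- Cyclic permutation of the coordinates as a ring homomorphism. -/
def tau (A : Type*) [CommRing A] : Quaternion A →+* Quaternion A where
  toFun := tauFun
  map_one' := by ext <;> simp [tauFun]
  map_zero' := by ext <;> simp [tauFun]
  map_add' p q := by ext <;> simp [tauFun]
  map_mul' p q := by ext <;> simp [tauFun] <;> ring

theorem tau_normSq {A : Type*} [CommRing A] (q : Quaternion A) : normSq (tau A q) = normSq q := by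
  rw [normSq_def', normSq_def']; simp [tau, tauFun]; ring

theorem axis_contra {F : Type*} [Field F] [CharZero F] (q : Quaternion F)
    (h1 : q * (qI F * q * qI F) = qI F * q * qI F * q) (h2 : q * tau F q = tau F q * q) :
    q.imI = 0 ∧ q.imJ = 0 ∧ q.imK = 0 := by
  rw [q_comm_iff] at h1 h2
  simp [qI, tau, tauFun] at h1 h2
  have e2 : (2 : F) ≠ 0 := two_ne_zero
  have bd : q.imI * q.imK = 0 := by
    apply mul_left_cancel₀ e2; grind
  have bc : q.imI * q.imJ = 0 := by
    apply mul_left_cancel₀ e2; grind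
  have hb : q.imI = 0 := by
    have : q.imI ^ 3 = 0 := by grind
    simpa using this
  refine ⟨hb, ?_, ?_⟩
  · have : q.imJ ^ 2 = 0 := by grind
    simpa using this
  · have : q.imK ^ 2 = 0 := by grind
    simpa using this

end GRU

namespace GRU

open Quaternion NumberField

theorem fg_exp {A : Type*} [AddCommGroup A] [Module.Finite ℤ A] (M : AddSubgroup A)
    (h : ∀ a : A, ∃ N : ℕ, N ≠ 0 ∧ N • a ∈ M) : ∃ N : ℕ, N ≠ 0 ∧ ∀ a : A, N • a ∈ M := by
  classical
  obtain ⟨s, hs⟩ := (Module.Finite.fg_top : (⊤ : Submodule ℤ A).FG)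
  choose N hN hNM using h
  refine ⟨∏ a ∈ s, N a, Finset.prod_ne_zero_iff.2 (fun a _ => hN a), fun a => ?_⟩
  have ha : a ∈ Submodule.span ℤ (s : Set A) := hs ▸ Submodule.mem_top
  induction ha using Submodule.span_induction with
  | mem a ha =>
    rw [← Finset.prod_erase_mul s N ha, mul_smul]
    exact M.nsmul_mem (hNM a) _
  | zero => rw [smul_zero]; exact M.zero_mem
  | add a b _ _ ha hb => rw [smul_add]; exact M.add_mem ha hb
  | smul k a _ ha =>
    rw [smul_comm]; exact M.zsmul_mem ha k

section lift
variable (L : Type) [Field L] [NumberField L]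

theorem gamma_cong (N : ℕ) (hN : N ≠ 0) : ∃ D : Subgroup (unitary (Quaternion (𝓞 L))),
    D.FiniteIndex ∧ ∀ u ∈ D, ∃ y : Quaternion (𝓞 L), (u : Quaternion (𝓞 L)) = 1 + N • y := by
  have hN' : (N : 𝓞 L) ≠ 0 := by exact_mod_cast hN
  have hfin : Finite (𝓞 L ⧸ Ideal.span {(N : 𝓞 L)}) :=
    Ring.HasFiniteQuotients.finiteQuotient (by simpa using hN')
  have hfin2 : Finite (Quaternion (𝓞 L ⧸ Ideal.span {(N : 𝓞 L)})) :=
    Finite.of_injective co (fun p q h => co_inj h)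
  have hfin3 : Finite (Quaternion (𝓞 L ⧸ Ideal.span {(N : 𝓞 L)}))ˣ :=
    Finite.of_injective _ Units.val_injective
  let f : unitary (Quaternion (𝓞 L)) →* (Quaternion (𝓞 L ⧸ Ideal.span {(N : 𝓞 L)}))ˣ :=
    (Units.map (qmap (Ideal.Quotient.mk (Ideal.span {(N : 𝓞 L)}))).toMonoidHom).comp
      Unitary.toUnits
  refine ⟨f.ker, inferInstance, fun u hu => ?_⟩
  have h1 : qmap (Ideal.Quotient.mk (Ideal.span {(N : 𝓞 L)})) (u : Quaternion (𝓞 L)) = 1 :=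
    congrArg Units.val (MonoidHom.mem_ker.1 hu)
  have h2 : ∀ i, ∃ z, co ((u : Quaternion (𝓞 L)) - 1) i = (N : 𝓞 L) * z := by
    intro i
    have h3 : co (qmap (Ideal.Quotient.mk (Ideal.span {(N : 𝓞 L)}))
        ((u : Quaternion (𝓞 L)) - 1)) i = 0 := by
      rw [map_sub, h1, map_one, sub_self]; fin_cases i <;> rfl
    rw [qmap_co, Ideal.Quotient.eq_zero_iff_mem, Ideal.mem_span_singleton] at h3
    exact h3
  choose z hz using h2
  refine ⟨qof z, ?_⟩
  rw [add_comm, ← sub_eq_iff_eq_add]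
  apply co_inj
  funext i
  rw [hz]
  fin_cases i <;> simp [co]

variable {L} {S : Type*} [Ring S] (π : S →+* Quaternion L) (J : AddSubgroup S)

theorem gamma_lift (hl : ∀ s x : S, x ∈ J → s * x ∈ J) 
    (hinj : ∀ x ∈ J, π x = 0 → x = 0)
    (hsurj : ∀ q : Quaternion L, ∃ N : ℕ, N ≠ 0 ∧ ∃ x ∈ J, π x = N • q) :
    ∃ D : Subgroup (unitary (Quaternion (𝓞 L))), D.FiniteIndex ∧ ∃ l : D →* Sˣ,
      ∀ u : D, π (l u : S) = inc L (u : Quaternion (𝓞 L)) ∧ (l u : S) - 1 ∈ J := by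
  have hfin : Module.Finite ℤ (Quaternion (𝓞 L)) := Module.Finite.trans (𝓞 L) _
  let M : AddSubgroup (Quaternion (𝓞 L)) := (J.map π.toAddMonoidHom).comap (inc L).toAddMonoidHom
  obtain ⟨N, hN, hNM⟩ := fg_exp M (fun a => by
    obtain ⟨N, hN, x, hx, hxa⟩ := hsurj (inc L a)
    exact ⟨N, hN, x, hx, by rw [map_nsmul]; exact hxa⟩)
  obtain ⟨D, hD, hDy⟩ := gamma_cong L N hN
  have hlift : ∀ u : D, ∃ v : Sˣ, π (v : S) = inc L (u : Quaternion (𝓞 L)) ∧ (v : S) - 1 ∈ J := by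
    intro u
    have hx : ∀ u : D, ∃ x ∈ J, π (1 + x) = inc L (u : Quaternion (𝓞 L)) := by
      intro u
      obtain ⟨y, hy⟩ := hDy u.1 u.2
      obtain ⟨x, hx, hxy⟩ := hNM y
      refine ⟨x, hx, ?_⟩
      have h1 : π x = inc L (N • y) := hxy
      rw [hy, map_add, map_add, map_one, map_one, h1]
    obtain ⟨x, hx1, hx2⟩ := hx u
    obtain ⟨x', hx1', hx2'⟩ := hx u⁻¹
    have key : ∀ x ∈ J, ∀ x' ∈ J, π (1 + x) * π (1 + x') = 1 → (1 + x) * (1 + x') = 1 := by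
      intro x hx x' hx' h
      have h1 : (1 + x) * (1 + x') = 1 + (x + x' + x * x') := by noncomm_ring
      rw [← map_mul, h1, map_add, map_one, add_eq_left] at h
      rw [h1, hinj _ (J.add_mem (J.add_mem hx hx') (hl _ _ hx')) h, add_zero]
    have e1 : π (1 + x) * π (1 + x') = 1 := by
      rw [hx2, hx2', ← map_mul, ← map_one (inc L)]
      congr 1
      exact congrArg (fun w : D => (w : Quaternion (𝓞 L))) (mul_inv_cancel u)
    have e2 : π (1 + x') * π (1 + x) = 1 := by
      rw [hx2, hx2', ← map_mul, ← map_one (inc L)]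
      congr 1
      exact congrArg (fun w : D => (w : Quaternion (𝓞 L))) (inv_mul_cancel u)
    exact ⟨⟨1 + x, 1 + x', key _ hx1 _ hx1' e1, key _ hx1' _ hx1 e2⟩, hx2, by simpa using hx1⟩
  choose l hl1 hl2 using hlift
  refine ⟨D, hD, MonoidHom.mk' l ?_, fun u => ⟨hl1 u, hl2 u⟩⟩
  intro a b
  apply Units.ext
  rw [Units.val_mul, ← sub_eq_zero]
  apply hinj
  · have : (l (a * b) : S) - l a * l b = ((l (a * b) : S) - 1) - (l a * ((l b : S) - 1)
        + ((l a : S) - 1)) := by noncomm_ring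
    rw [this]
    exact J.sub_mem (hl2 _) (J.add_mem (hl _ _ (hl2 b)) (hl2 a))
  · rw [map_sub, map_mul, hl1, hl1, hl1, sub_eq_zero, ← map_mul]; rfl

end lift

theorem noncomm_gamma {L : Type} [Field L] [NumberField L]
    (Δ : Subgroup (unitary (Quaternion (𝓞 L)))) (hΔ : Δ.FiniteIndex)
    (htf : ∀ δ ∈ Δ, ∀ n : ℕ, n ≠ 0 → δ ^ n = 1 → δ = 1) (δ) (hδ : δ ∈ Δ) (hδ1 : δ ≠ 1) :
    ∃ a ∈ Δ, ∃ b ∈ Δ, ¬ Commute a b := by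
  by_contra hcon
  push Not at hcon
  have hI : qI (𝓞 L) ∈ unitary (Quaternion (𝓞 L)) := by
    rw [mem_unitary_iff, normSq_def']; simp [qI]
  let I : unitary (Quaternion (𝓞 L)) := ⟨qI (𝓞 L), hI⟩
  have htau : tau (𝓞 L) (δ : Quaternion (𝓞 L)) ∈ unitary (Quaternion (𝓞 L)) := by
    rw [mem_unitary_iff, tau_normSq, ← mem_unitary_iff]; exact δ.2
  let δt : unitary (Quaternion (𝓞 L)) := ⟨_, htau⟩
  obtain ⟨n1, h1, -, hn1⟩ := Subgroup.exists_pow_mem_of_index_ne_zero hΔ.index_ne_zero (I * δ * I⁻¹)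
  obtain ⟨n2, h2, -, hn2⟩ := Subgroup.exists_pow_mem_of_index_ne_zero hΔ.index_ne_zero δt
  let n := n1 * n2
  have hn : n ≠ 0 := (Nat.mul_pos h1 h2).ne'
  let ε := δ ^ n
  have hε : ε ∈ Δ := Δ.pow_mem hδ n
  have hε1 : I * ε * I⁻¹ ∈ Δ := by
    have : I * ε * I⁻¹ = ((I * δ * I⁻¹) ^ n1) ^ n2 := by
      rw [← pow_mul, conj_pow]
    rw [this]; exact Δ.pow_mem hn1 _
  have hε2 : δt ^ n ∈ Δ := by
    simp only [n]
    rw [mul_comm, pow_mul]; exact Δ.pow_mem hn2 _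
  have c1 := congrArg (fun w : unitary (Quaternion (𝓞 L)) => inc L w) (hcon _ hε _ hε1).eq
  have c2 := congrArg (fun w : unitary (Quaternion (𝓞 L)) => inc L w) (hcon _ hε _ hε2).eq
  have iI : inc L (qI (𝓞 L)) = qI L := by ext <;> simp [inc, qI]
  have iI' : inc L ((I⁻¹ : unitary (Quaternion (𝓞 L))) : Quaternion (𝓞 L)) = - qI L := by
    have : ((I⁻¹ : unitary (Quaternion (𝓞 L))) : Quaternion (𝓞 L)) = star (qI (𝓞 L)) := rfl
    rw [this, inc, qmap_star, ← inc, iI]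
    ext <;> simp [qI]
  have it : ∀ q, inc L (tau (𝓞 L) q) = tau L (inc L q) := fun q => by
    ext <;> simp [inc, tau, tauFun]
  have itt : inc L ((δt ^ n : unitary (Quaternion (𝓞 L))) : Quaternion (𝓞 L)) =
      tau L (inc L ε) := by
    rw [← it]
    congr 1
    simp only [ε]
    rw [SubmonoidClass.coe_pow, SubmonoidClass.coe_pow, map_pow]
  have hax := axis_contra (inc L (ε : Quaternion (𝓞 L))) (by
      have e1 : inc L ((I * ε * I⁻¹ : unitary (Quaternion (𝓞 L))) : Quaternion (𝓞 L)) =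
          - (qI L * inc L ε * qI L) := by
        rw [Submonoid.coe_mul, Submonoid.coe_mul, map_mul, map_mul, iI', ← iI]
        simp [I]
      simp only [Submonoid.coe_mul (unitary _) ε, Submonoid.coe_mul (unitary _) _ ε, map_mul (inc L)
        (ε : Quaternion (𝓞 L)), map_mul (inc L) _ (ε : Quaternion (𝓞 L))] at c1
      rw [e1] at c1
      simpa using c1) (by
      simp only [Submonoid.coe_mul, map_mul] at c2
      rw [itt] at c2
      exact c2)
  have hsq := q_real_sq _ hax (by
    rw [inc, qmap_normSq, (mem_unitary_iff _).1 ε.2, map_one])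
  have hε3 : ε * ε = 1 := by
    apply Subtype.ext
    apply inc_inj L
    rw [Submonoid.coe_mul, map_mul, hsq]; exact (map_one _).symm
  apply hδ1
  apply htf δ hδ (n * 2) (by positivity)
  rw [pow_mul, pow_two]; exact hε3

end GRU

namespace GRU

open Quaternion NumberField

theorem abs_contra {L : Type} [Field L] [NumberField L] (hc : ∃ w : InfinitePlace L, w.IsComplex)
    {S : Type} [Ring S] (π : S →+* Quaternion L) (J : AddSubgroup S)
    (hl : ∀ s x : S, x ∈ J → s * x ∈ J) (hr : ∀ s x : S, x ∈ J → x * s ∈ J)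
    (hinj : ∀ x ∈ J, π x = 0 → x = 0)
    (hsurj : ∀ q : Quaternion L, ∃ N : ℕ, N ≠ 0 ∧ ∃ x ∈ J, π x = N • q)
    (hN : ∀ n n' : S, n * n = 0 → n' * n' = 0 → n * n' = n' * n)
    (H : Subgroup Sˣ) (hH : H.FiniteIndex) {m : ℕ} {X : Fin m → Type}
    (e : H ≃* ∀ j, FreeGroup (X j)) : False := by
  -- the quaternion algebra is a division algebra
  have hdivL : ∀ q : Quaternion L, normSq q = 0 → q = 0 := by
    apply div_of_nilcomm
    intro n n' hn hn'
    obtain ⟨N, hN0, x, hx, hxn⟩ := hsurj n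
    obtain ⟨N', hN0', x', hx', hxn'⟩ := hsurj n'
    have hx2 : x * x = 0 := hinj _ (hl _ _ hx) (by rw [map_mul, hxn, smul_mul_smul_comm, hn, smul_zero])
    have hx2' : x' * x' = 0 :=
      hinj _ (hl _ _ hx') (by rw [map_mul, hxn', smul_mul_smul_comm, hn', smul_zero])
    have h1 := congrArg π (hN x x' hx2 hx2')
    rw [map_mul, map_mul, hxn, hxn', smul_mul_smul_comm, smul_mul_smul_comm, mul_comm N' N] at h1
    have hNN : ((N * N' : ℕ) : L) ≠ 0 := by exact_mod_cast mul_ne_zero hN0 hN0'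
    rw [← Nat.cast_smul_eq_nsmul L, ← Nat.cast_smul_eq_nsmul L] at h1
    exact smul_right_injective _ hNN h1
  have hdiv : ∀ x : Quaternion (𝓞 L), normSq x = 0 → x = 0 := by
    intro x hx
    apply inc_inj L
    rw [map_zero]
    apply hdivL
    rw [inc, qmap_normSq, hx, map_zero]
  obtain ⟨D, hD, l, hl12⟩ := gamma_lift π J hl hinj hsurj
  have linj : Function.Injective l := by
    intro a b hab
    apply Subtype.ext
    apply Subtype.ext
    apply inc_inj L
    rw [← (hl12 a).1, ← (hl12 b).1, hab]
  let Δ0 : Subgroup D := H.comap l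
  let Δ : Subgroup (unitary (Quaternion (𝓞 L))) := Δ0.map D.subtype
  have hΔ : Δ.FiniteIndex := by
    constructor
    simp only [Δ]
    rw [Subgroup.index_map_subtype]
    apply mul_ne_zero _ hD.index_ne_zero
    simp only [Δ0]
    rw [Subgroup.index_comap]
    exact fun h => hH.index_ne_zero (Subgroup.index_eq_zero_of_relIndex_eq_zero h)
  have hFtf : ∀ j, IsMulTorsionFree (FreeGroup (X j)) := fun j => free_tf _
  have hPtf : IsMulTorsionFree (∀ j, FreeGroup (X j)) := inferInstance
  let E : Δ0 →* (∀ j, FreeGroup (X j)) :=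
    e.toMonoidHom.comp ((l.comp Δ0.subtype).codRestrict H (fun x => x.2))
  have Einj : Function.Injective E := by
    intro a b hab
    have h1 := e.injective hab
    have h2 := congrArg Subtype.val h1
    exact Subtype.ext (linj h2)
  -- it remains to show that Δ0 is free
  suffices hfree : IsFreeGroup Δ0 by
    have e1 : Δ0 ≃* Δ := Δ0.equivMapOfInjective _ D.subtype_injective
    exact not_free L hc hdiv Δ hΔ (e1.symm.trans (IsFreeGroup.toFreeGroup Δ0))
  by_cases htriv : ∀ x : Δ0, x = 1
  · have : Subsingleton Δ0 := ⟨fun a b => by rw [htriv a, htriv b]⟩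
    have e0 : FreeGroup Empty ≃* Δ0 :=
      { toFun := fun _ => 1, invFun := fun _ => 1, left_inv := fun _ => Subsingleton.elim _ _,
        right_inv := fun _ => Subsingleton.elim _ _, map_mul' := fun _ _ => (one_mul _).symm }
    exact IsFreeGroup.ofMulEquiv e0
  push Not at htriv
  obtain ⟨δ, hδ⟩ := htriv
  have htf0 : ∀ x : Δ0, ∀ n : ℕ, n ≠ 0 → x ^ n = 1 → x = 1 := by
    intro x n hn hx
    apply Einj
    rw [map_one]
    apply pow_left_injective hn
    simp only
    rw [← map_pow, hx, map_one, one_pow]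
  have hmemΔ : ∀ x ∈ Δ, ∃ y : Δ0, (y : unitary (Quaternion (𝓞 L))) = x := by
    rintro x ⟨y, hy, rfl⟩
    exact ⟨⟨y, hy⟩, rfl⟩
  obtain ⟨a, ha, b, hb, hab⟩ := noncomm_gamma Δ hΔ (by
    intro x hx n hn hxn
    obtain ⟨y, rfl⟩ := hmemΔ x hx
    rw [htf0 y n hn (Subtype.ext (Subtype.ext hxn))]; rfl) δ ⟨δ.1, δ.2, rfl⟩ (by
      intro h; exact hδ (Subtype.ext (Subtype.ext h)))
  obtain ⟨a, rfl⟩ := hmemΔ a ha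
  obtain ⟨b, rfl⟩ := hmemΔ b hb
  have hab0 : ¬ Commute a b := by
    intro h
    apply hab
    have h2 := congrArg (fun w : Δ0 => (w : unitary (Quaternion (𝓞 L)))) h.eq
    exact h2
  -- the normal subgroup
  let U1 : Subgroup Sˣ :=
    { carrier := {v | (v : S) - 1 ∈ J ∧ normSq (π v) = 1}
      one_mem' := by simp
      mul_mem' := by
        rintro v w ⟨hv1, hv2⟩ ⟨hw1, hw2⟩
        refine ⟨?_, ?_⟩
        · have : ((v * w : Sˣ) : S) - 1 = v * ((w : S) - 1) + ((v : S) - 1) := by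
            rw [Units.val_mul]; noncomm_ring
          rw [this]; exact J.add_mem (hl _ _ hw1) hv1
        · rw [Units.val_mul, map_mul, map_mul, hv2, hw2, one_mul]
      inv_mem' := by
        rintro v ⟨hv1, hv2⟩
        refine ⟨?_, ?_⟩
        · have : ((v⁻¹ : Sˣ) : S) - 1 = - (((v⁻¹ : Sˣ) : S) * ((v : S) - 1)) := by
            rw [mul_sub, Units.inv_mul]; noncomm_ring
          rw [this]; exact J.neg_mem (hl _ _ hv1)
        · have : normSq (π v) * normSq (π ((v⁻¹ : Sˣ) : S)) = 1 := by
            rw [← map_mul, ← map_mul, Units.mul_inv, map_one, map_one]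
          rwa [hv2, one_mul] at this }
  have hU1n : U1.Normal := by
    constructor
    rintro v ⟨hv1, hv2⟩ g
    refine ⟨?_, ?_⟩
    · have : ((g * v * g⁻¹ : Sˣ) : S) - 1 = g * ((v : S) - 1) * ((g⁻¹ : Sˣ) : S) := by
        rw [Units.val_mul, Units.val_mul, mul_sub, sub_mul, mul_one, Units.mul_inv]
      rw [this]; exact hr _ _ (hl _ _ hv1)
    · have : normSq (π g) * normSq (π ((g⁻¹ : Sˣ) : S)) = 1 := by
        rw [← map_mul, ← map_mul, Units.mul_inv, map_one, map_one]
      rw [Units.val_mul, Units.val_mul, map_mul, map_mul, map_mul, map_mul, hv2, mul_one, this]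
  have hU1inj : ∀ v ∈ U1, ∀ w ∈ U1, π (v : S) = π (w : S) → v = w := by
    rintro v ⟨hv1, -⟩ w ⟨hw1, -⟩ h
    apply Units.ext
    rw [← sub_eq_zero]
    apply hinj
    · have := J.sub_mem hv1 hw1
      rwa [sub_sub_sub_cancel_right] at this
    · rw [map_sub, h, sub_self]
  let P : Subgroup H := U1.subgroupOf H
  have hPn : P.Normal := inferInstance
  let N : Subgroup (∀ j, FreeGroup (X j)) := P.map e.toMonoidHom
  have hNn : N.Normal := hPn.map _ e.surjective
  have hEN : ∀ x : Δ0, E x ∈ N := by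
    intro x
    refine ⟨⟨l x, x.2⟩, ?_, rfl⟩
    refine ⟨(hl12 x).2, ?_⟩
    show normSq (π (l x : S)) = 1
    rw [(hl12 x).1, inc, qmap_normSq, (mem_unitary_iff _).1 x.1.1.2, map_one]
  obtain ⟨j, hj⟩ := prod_embed N (E a) (E b) (hEN a) (hEN b) (by
      intro h
      apply hab0
      apply Einj
      rw [map_mul, map_mul]; exact h) (by
      rintro _ ⟨v, hv, rfl⟩ _ ⟨w, hw, rfl⟩ _ ⟨c, hcP, rfl⟩ hvw hcv hcw
      have hcv' : c * v = v * c := e.injective (by rw [map_mul, map_mul]; exact hcv)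
      have hcw' : c * w = w * c := e.injective (by rw [map_mul, map_mul]; exact hcw)
      have hv' : (v : Sˣ) ∈ U1 := hv
      have hw' : (w : Sˣ) ∈ U1 := hw
      have hc' : (c : Sˣ) ∈ U1 := hcP
      have p1 : ∀ x y : H, x * y = y * x → π (x.1 : S) * π (y.1 : S) = π (y.1 : S) * π (x.1 : S) := by
        intro x y hxy
        rw [← map_mul, ← map_mul]
        have := congrArg (fun w : H => ((w : Sˣ) : S)) hxy
        exact congrArg π this
      have hcen := q_centr (π (v.1 : S)) (π (w.1 : S)) (π (c.1 : S)) (p1 _ _ hcv').symm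
        (p1 _ _ hcw').symm (by
          intro h
          apply hvw
          have h3 : (v.1 * w.1 : Sˣ) = w.1 * v.1 := by
            apply hU1inj _ (U1.mul_mem hv' hw') _ (U1.mul_mem hw' hv')
            rw [Units.val_mul, Units.val_mul, map_mul, map_mul, h]
          have h4 : v * w = w * v := Subtype.ext h3
          show e v * e w = e w * e v
          rw [← map_mul, h4, map_mul])
      have hsq := q_real_sq _ hcen hc'.2
      have h5 : (c.1 * c.1 : Sˣ) = 1 := by
        apply hU1inj _ (U1.mul_mem hc' hc') _ U1.one_mem
        rw [Units.val_mul, map_mul, hsq, Units.val_one, map_one]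
      have h6 : c * c = 1 := Subtype.ext h5
      have h7 : (e c) ^ 2 = 1 ^ 2 := by rw [pow_two, ← map_mul, h6, map_one, one_pow]
      exact pow_left_injective two_ne_zero h7)
  let Fh : Δ0 →* FreeGroup (X j) := (Pi.evalMonoidHom _ j).comp E
  have Finj : Function.Injective Fh := by
    rw [injective_iff_map_eq_one]
    intro x hx
    apply Einj
    rw [map_one]
    exact hj _ (hEN x) hx
  have hsub : IsFreeGroup Fh.range := subgroupIsFreeOfIsFree _
  exact IsFreeGroup.ofMulEquiv (MonoidHom.ofInjective Finj).symm

end GRU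

namespace GRU

open Quaternion NumberField

/-- Coordinates of the standard representation of the quaternion group. -/
def qq : QuaternionGroup 2 → Fin 4 → ℤ
  | .a k => ![![1,0,0,0],![0,1,0,0],![-1,0,0,0],![0,-1,0,0]] k
  | .xa k => ![![0,0,1,0],![0,0,0,-1],![0,0,-1,0],![0,0,0,1]] k

theorem qq_mul (p q : QuaternionGroup 2) : qof (qq (p * q)) = qof (qq p) * qof (qq q) := by
  ext
  · simp only [re_mul, qof_re, qof_imI, qof_imJ, qof_imK]
    revert p q; decide
  · simp only [imI_mul, qof_re, qof_imI, qof_imJ, qof_imK]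
    revert p q; decide
  · simp only [imJ_mul, qof_re, qof_imI, qof_imJ, qof_imK]
    revert p q; decide
  · simp only [imK_mul, qof_re, qof_imI, qof_imJ, qof_imK]
    revert p q; decide

/-- The standard representation of the quaternion group. -/
def kap (L : Type*) [CommRing L] : QuaternionGroup 2 →* Quaternion L where
  toFun p := qmap (Int.castRingHom L) (qof (qq p))
  map_one' := by
    rw [QuaternionGroup.one_def]
    ext <;> simp [qq]
  map_mul' p q := by rw [qq_mul, map_mul]

theorem kap_two (L : Type*) [CommRing L] : kap L (.a 2) = -1 := by
  ext <;> simp [kap, qq]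

theorem kap_I (L : Type*) [CommRing L] : kap L (.a 1) = qI L := by
  ext <;> simp [kap, qq, qI]

theorem kap_J (L : Type*) [CommRing L] : kap L (.xa 0) = qJ L := by
  ext <;> simp [kap, qq, qJ]

/-- The representation of `G`. -/
theorem exists_rep {L : Type*} [Field L] {G : Type*} [Group G] (ψ : QuaternionGroup 2 →* G)
    (C : Subgroup G) (hψ : Function.Injective ψ) (hcomm : ∀ q, ∀ c ∈ C, Commute (ψ q) c)
    (hCab : ∀ c ∈ C, ∀ d ∈ C, Commute c d)
    (hsurj : ∀ g, ∃ q, ∃ c ∈ C, g = ψ q * c)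
    (hinter : ∀ q, ψ q ∈ C → q = 1 ∨ q = .a 2) (hz : ψ (.a 2) ∈ C)
    (χ : C →* Lˣ) (hχ : χ ⟨_, hz⟩ = -1) :
    ∃ ρ : G →* Quaternion L, ∀ q, ∀ c : C, ρ (ψ q * c) = kap L q * ((χ c : L) : Quaternion L) := by
  choose q c hc hg using hsurj
  have wd : ∀ q q' : QuaternionGroup 2, ∀ c c' : C, ψ q * c = ψ q' * c' →
      kap L q * ((χ c : L) : Quaternion L) = kap L q' * ((χ c' : L) : Quaternion L) := by
    intro q q' c c' h
    have h1 : ψ (q'⁻¹ * q) = (c' * c⁻¹ : C) := by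
      have : ψ q = ψ q' * c' * (c : G)⁻¹ := by rw [← h]; group
      rw [map_mul, map_inv, this, Subgroup.coe_mul, Subgroup.coe_inv]; group
    have h2 := hinter (q'⁻¹ * q) (by rw [h1]; exact (c' * c⁻¹ : C).2)
    rcases h2 with h2 | h2
    · have h3 : q = q' := by rw [inv_mul_eq_one] at h2; exact h2.symm
      subst h3
      have h4 : c = c' := Subtype.ext (mul_left_cancel h)
      rw [h4]
    · have h3 : q = q' * .a 2 := by rw [← h2]; group
      have h4 : c' = ⟨_, hz⟩ * c := by
        apply Subtype.ext
        rw [h2] at h1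
        show (c' : G) = ψ (.a 2) * c
        rw [h1, Subgroup.coe_mul, Subgroup.coe_inv]; group
      rw [h4, map_mul, hχ, h3, map_mul, kap_two]
      simp
  have key : ∀ q' : QuaternionGroup 2, ∀ c' : C,
      kap L (q (ψ q' * c')) * ((χ ⟨c (ψ q' * c'), hc _⟩ : L) : Quaternion L) =
        kap L q' * ((χ c' : L) : Quaternion L) := by
    intro q' c'
    exact wd _ _ _ _ (hg _).symm
  refine ⟨{ toFun := fun g => kap L (q g) * ((χ ⟨c g, hc g⟩ : L) : Quaternion L)
            map_one' := ?_, map_mul' := ?_ }, key⟩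
  · have := key 1 1
    rw [map_one, map_one, map_one] at this
    simpa using this
  · intro g h
    have e1 : g * h = ψ (q g * q h) * ((⟨c g, hc g⟩ * ⟨c h, hc h⟩ : C) : G) := by
      conv_lhs => rw [hg g, hg h]
      rw [map_mul, Subgroup.coe_mul]
      have := (hcomm (q h) (c g) (hc g)).eq
      simp only [mul_assoc]
      rw [← mul_assoc (c g), ← this, mul_assoc]
    have := key (q g * q h) (⟨c g, hc g⟩ * ⟨c h, hc h⟩)
    rw [← e1] at this
    rw [this, map_mul, map_mul, Units.val_mul, coe_mul]
    simp only [mul_assoc]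
    have h5 := coe_commutes (χ ⟨c g, hc g⟩ : L) (kap L (q h))
    rw [← mul_assoc (kap L (q h)), ← h5, mul_assoc]

theorem exists_field {K : Type} [Field K] [NumberField K] (σ : K →+* ℂ) {C : Type} [Group C]
    [Finite C] (χ : C →* ℂˣ) (hcx : (∃ x, (σ x).im ≠ 0) ∨ ∃ c, (χ c : ℂ).im ≠ 0) :
    ∃ (L : Type) (_ : Field L) (_ : NumberField L) (s : K →+* L) (ι : L →+* ℂ) (χ' : C →* Lˣ),
      (∀ c, ι (χ' c) = χ c) ∧ (∃ w : InfinitePlace L, w.IsComplex) ∧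
      ∀ T : Subring L, (∀ k, s k ∈ T) → (∀ c, (χ' c : L) ∈ T) → ∀ x, x ∈ T := by
  letI : Algebra K ℂ := σ.toAlgebra
  let s : Set ℂ := Set.range (fun c => (χ c : ℂ))
  have hsfin : Finite s := Set.finite_range _
  have hsint : ∀ x ∈ s, IsIntegral K x := by
    rintro _ ⟨c, rfl⟩
    have h1 : (χ c : ℂ) ^ Nat.card C = 1 := by
      rw [← Units.val_pow_eq_pow_val, ← map_pow, pow_card_eq_one', map_one, Units.val_one]
    apply IsIntegral.of_pow (Nat.card_pos (α := C))
    rw [h1]; exact isIntegral_one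
  let L := IntermediateField.adjoin K s
  have hfd : FiniteDimensional K L := IntermediateField.finiteDimensional_adjoin hsint
  have hnf : NumberField L := NumberField.of_module_finite K L
  let χ0 : C →* L :=
    { toFun := fun c => ⟨χ c, IntermediateField.subset_adjoin K s ⟨c, rfl⟩⟩
      map_one' := by apply Subtype.ext; simp
      map_mul' := fun a b => by apply Subtype.ext; simp }
  refine ⟨L, inferInstance, hnf, algebraMap K L, algebraMap L ℂ, χ0.toHomUnits, ?_, ?_, ?_⟩
  · intro c; rfl
  · refine ⟨InfinitePlace.mk (algebraMap L ℂ), ?_⟩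
    rw [InfinitePlace.isComplex_mk_iff]
    intro h
    rw [ComplexEmbedding.isReal_iff] at h
    have h2 : ∀ x : L, (algebraMap L ℂ x).im = 0 := by
      intro x
      have := RingHom.congr_fun h x
      rw [ComplexEmbedding.conjugate_coe_eq] at this
      exact Complex.conj_eq_iff_im.1 this
    rcases hcx with ⟨x, hx⟩ | ⟨c, hc⟩
    · exact hx (h2 (algebraMap K L x))
    · exact hc (h2 (χ0 c))
  · intro T hK hC x
    let T' : Subalgebra K L := { T with algebraMap_mem' := hK }
    obtain ⟨x, hx⟩ := x
    induction hx using IntermediateField.adjoin_induction with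
    | mem x hx =>
      obtain ⟨c, rfl⟩ := hx
      exact hC c
    | algebraMap k => exact hK k
    | add x y hx hy h1 h2 => exact T.add_mem h1 h2
    | inv x hx h1 =>
      have := T'.inv_mem_of_algebraic (x := ⟨⟨x, hx⟩, h1⟩) (Algebra.IsAlgebraic.isAlgebraic _)
      exact this
    | mul x y hx hy h1 h2 => exact T.mul_mem h1 h2

theorem right_id {A : Type*} [Ring A] [IsSemisimpleRing A] (N : Ideal A) :
    ∃ f ∈ N, ∀ x ∈ N, x * f = x := by
  obtain ⟨N', hN'⟩ := exists_isCompl N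
  have h1 : (1 : A) ∈ N ⊔ N' := by rw [hN'.sup_eq_top]; trivial
  obtain ⟨f, hf, e, he, hfe⟩ := Submodule.mem_sup.1 h1
  refine ⟨f, hf, fun x hx => ?_⟩
  have h2 : x = x * f + x * e := by rw [← mul_add, hfe, mul_one]
  have h3 : x * e ∈ N := by
    have : x * e = x - x * f := by rw [eq_sub_iff_add_eq', ← h2]
    rw [this]; exact N.sub_mem hx (N.mul_mem_left _ hf)
  have h4 : x * e = 0 := by
    have : x * e ∈ N ⊓ N' := ⟨h3, N'.mul_mem_left _ he⟩
    rw [hN'.inf_eq_bot] at this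
    exact this
  rw [h4, add_zero] at h2
  exact h2.symm

theorem ss_split {A B : Type*} [Ring A] [IsSemisimpleRing A] [Ring B] (π : A →+* B)
    (hπ : Function.Surjective π) : ∃ J : AddSubgroup A, (∀ s x, x ∈ J → s * x ∈ J) ∧
      (∀ s x, x ∈ J → x * s ∈ J) ∧ (∀ x ∈ J, π x = 0 → x = 0) ∧ ∀ q, ∃ x ∈ J, π x = q := by
  let J : Ideal A :=
    { carrier := {x | ∀ t, π t = 0 → t * x = 0}
      zero_mem' := fun t _ => mul_zero t
      add_mem' := fun {x y} hx hy t ht => by rw [mul_add, hx t ht, hy t ht, add_zero]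
      smul_mem' := fun s x hx t ht => by
        rw [smul_eq_mul, ← mul_assoc]; exact hx _ (by rw [map_mul, ht, zero_mul]) }
  refine ⟨J.toAddSubgroup, fun s x hx => J.mul_mem_left s hx, ?_, ?_, ?_⟩
  · intro s x hx t ht
    rw [← mul_assoc, hx t ht, zero_mul]
  · obtain ⟨f, hf, hfx⟩ := right_id (J ⊓ RingHom.ker π)
    have hf0 : f = 0 := by
      rw [← hfx f hf]; exact hf.1 f hf.2
    intro x hx hx0
    rw [← hfx x ⟨hx, hx0⟩, hf0, mul_zero]
  · obtain ⟨f, hf, hfx⟩ := right_id (RingHom.ker π)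
    intro q
    obtain ⟨a, rfl⟩ := hπ q
    refine ⟨a * (1 - f), J.mul_mem_left _ ?_, ?_⟩
    · intro t ht
      rw [mul_sub, mul_one, hfx t ht, sub_self]
    · rw [map_mul, map_sub, map_one, (hf : π f = 0), sub_zero, mul_one]

end GRU

namespace GRU

open Quaternion NumberField

theorem den_field {K : Type*} [Field K] [Algebra ℚ K] (R : Subring K)
    (hspan : Submodule.span ℚ (R : Set K) = ⊤) (k : K) : ∃ N : ℕ, N ≠ 0 ∧ N • k ∈ R := by
  have hk : k ∈ Submodule.span ℚ (R : Set K) := by rw [hspan]; trivial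
  induction hk using Submodule.span_induction with
  | mem x hx => exact ⟨1, one_ne_zero, by rwa [one_smul]⟩
  | zero => exact ⟨1, one_ne_zero, by rw [smul_zero]; exact R.zero_mem⟩
  | add x y _ _ h1 h2 =>
    obtain ⟨N, hN, h1⟩ := h1
    obtain ⟨M, hM, h2⟩ := h2
    refine ⟨N * M, mul_ne_zero hN hM, ?_⟩
    rw [smul_add]
    refine R.add_mem ?_ ?_
    · rw [mul_comm, mul_smul]; exact R.nsmul_mem h1 M
    · rw [mul_smul]; exact R.nsmul_mem h2 N
  | smul q x _ h1 =>
    obtain ⟨N, hN, h1⟩ := h1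
    refine ⟨q.den * N, mul_ne_zero q.den_ne_zero hN, ?_⟩
    have : (q.den * N) • (q • x) = q.num • (N • x) := by
      simp only [← Nat.cast_smul_eq_nsmul ℚ, ← Int.cast_smul_eq_zsmul ℚ, smul_smul]
      congr 1
      push_cast
      rw [mul_right_comm, Rat.den_mul_eq_num]
    rw [this]
    exact R.zsmul_mem h1 _

theorem map_inj {K : Type*} [CommRing K] (R : Subring K) (G : Type*) [Group G] :
    Function.Injective (MonoidAlgebra.mapRingHom G R.subtype) := by
  rw [injective_iff_map_eq_zero]
  intro x hx
  ext g
  have := congrArg (fun x => MonoidAlgebra.coeff x g) hx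
  simpa using this

theorem den_alg {K : Type*} [Field K] [Algebra ℚ K] (R : Subring K)
    (hspan : Submodule.span ℚ (R : Set K) = ⊤) {G : Type*} [Group G] (x : MonoidAlgebra K G) :
    ∃ N : ℕ, N ≠ 0 ∧ ∃ y : MonoidAlgebra R G, MonoidAlgebra.mapRingHom G R.subtype y = N • x := by
  induction x using MonoidAlgebra.induction_linear with
  | zero => exact ⟨1, one_ne_zero, 0, by simp⟩
  | add f g h1 h2 =>
    obtain ⟨N, hN, y, h1⟩ := h1
    obtain ⟨M, hM, z, h2⟩ := h2
    refine ⟨N * M, mul_ne_zero hN hM, M • y + N • z, ?_⟩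
    rw [map_add, map_nsmul, map_nsmul, h1, h2, smul_add, smul_smul, smul_smul, mul_comm]
  | single m r =>
    obtain ⟨N, hN, h⟩ := den_field R hspan r
    refine ⟨N, hN, MonoidAlgebra.single m ⟨_, h⟩, ?_⟩
    rw [MonoidAlgebra.mapRingHom_single, MonoidAlgebra.smul_single]
    rfl

theorem forward_core {K : Type} [Field K] [NumberField K] (R : Subring K)
    (hspan : Submodule.span ℚ (R : Set K) = ⊤) {G : Type} [Group G] [Finite G] (ω : R)
    (hω : ∀ a b : ℤ, (a ≠ 0 ∨ b ≠ 0) → (a : R) + b * ω ≠ 0)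
    (H : Subgroup (MonoidAlgebra R G)ˣ) (hH : H.FiniteIndex) {m : ℕ} {X : Fin m → Type}
    (e : H ≃* ∀ j, FreeGroup (X j)) (ψ : QuaternionGroup 2 →* G)
    (C : Subgroup G) (hψ : Function.Injective ψ) (hcomm : ∀ q, ∀ c ∈ C, Commute (ψ q) c)
    (hCab : ∀ c ∈ C, ∀ d ∈ C, Commute c d)
    (hsurj : ∀ g, ∃ q, ∃ c ∈ C, g = ψ q * c)
    (hinter : ∀ q, ψ q ∈ C → q = 1 ∨ q = .a 2) (hz : ψ (.a 2) ∈ C)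
    (χ : C →* ℂˣ) (hχ : χ ⟨_, hz⟩ = -1) (σ : K →+* ℂ)
    (hcx : (∃ x, (σ x).im ≠ 0) ∨ ∃ c, (χ c : ℂ).im ≠ 0) : False := by
  obtain ⟨L, _, _, s, ι, χ', hχ', hc, hT⟩ := exists_field σ χ hcx
  have hχ2 : χ' ⟨_, hz⟩ = -1 := by
    apply Units.ext
    apply ι.injective
    rw [hχ', hχ]; simp
  obtain ⟨ρ, hρ⟩ := exists_rep ψ C hψ hcomm hCab hsurj hinter hz χ' hχ2
  let f : K →+* Quaternion L := (algebraMap L (Quaternion L)).comp s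
  let πK : MonoidAlgebra K G →+* Quaternion L := MonoidAlgebra.liftNCRingHom f ρ
    (fun k g => Algebra.commutes (s k) (ρ g))
  have hπ1 : ∀ k : K, πK (MonoidAlgebra.single 1 k) = ((s k : L) : Quaternion L) := by
    intro k
    show MonoidAlgebra.liftNC _ _ _ = _
    rw [MonoidAlgebra.liftNC_single]
    simp [f]
  have hπ2 : ∀ g : G, πK (MonoidAlgebra.single g 1) = ρ g := by
    intro k
    show MonoidAlgebra.liftNC _ _ _ = _
    rw [MonoidAlgebra.liftNC_single]
    simp
  have hsc : ∀ x : L, (x : Quaternion L) ∈ πK.range := by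
    have := hT (πK.range.comap (algebraMap L (Quaternion L))) ?_ ?_
    · exact this
    · intro k; exact ⟨_, hπ1 k⟩
    · intro c
      refine ⟨_, (hπ2 (ψ 1 * c)).trans ?_⟩
      rw [hρ, map_one, one_mul]; rfl
  have hI : qI L ∈ πK.range := by
    refine ⟨_, (hπ2 (ψ (.a 1) * (1 : C))).trans ?_⟩
    rw [hρ, map_one, kap_I]; simp
  have hJ : qJ L ∈ πK.range := by
    refine ⟨_, (hπ2 (ψ (.xa 0) * (1 : C))).trans ?_⟩
    rw [hρ, map_one, kap_J]; simp
  have hπ : Function.Surjective πK := by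
    intro q
    have : q = (q.re : Quaternion L) + q.imI * qI L + q.imJ * qJ L + q.imK * (qI L * qJ L) := by
      ext <;> simp [qI, qJ]
    have h2 : q ∈ πK.range := by
      rw [this]
      exact add_mem (add_mem (add_mem (hsc _) (mul_mem (hsc _) hI)) (mul_mem (hsc _) hJ))
        (mul_mem (hsc _) (mul_mem hI hJ))
    exact h2
  obtain ⟨J, hl, hr, hinj, hs⟩ := ss_split πK hπ
  let φ := MonoidAlgebra.mapRingHom G R.subtype
  refine abs_contra hc (πK.comp φ) (J.comap (φ : MonoidAlgebra R G →+ MonoidAlgebra K G))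
    ?_ ?_ ?_ ?_ (nil_comm_grp ω hω H hH e) H hH e
  · intro s x hx
    show φ (s * x) ∈ J
    rw [map_mul]; exact hl _ _ hx
  · intro s x hx
    show φ (x * s) ∈ J
    rw [map_mul]; exact hr _ _ hx
  · intro x hx h0
    exact map_inj R G ((hinj _ hx h0).trans (map_zero _).symm)
  · intro q
    obtain ⟨x, hx, hq⟩ := hs q
    obtain ⟨N, hN, y, hy⟩ := den_alg R hspan x
    refine ⟨N, hN, y, ?_, ?_⟩
    · show φ y ∈ J
      rw [hy]; exact J.nsmul_mem hx N
    · show πK (φ y) = _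
      rw [hy, map_nsmul, hq]

theorem unit_im {z : ℂ} {n : ℕ} (hn : n ≠ 0) (h : z ^ n = 1) (h2 : z ^ 2 ≠ 1) : z.im ≠ 0 := by
  intro h0
  have h1 : ‖z‖ = 1 := Complex.norm_eq_one_of_pow_eq_one h hn
  apply h2
  have h3 := Complex.sq_norm z
  rw [Complex.normSq_apply, h0, h1] at h3
  apply Complex.ext
  · simp [sq, h0]; linarith
  · simp [sq, h0]

theorem exists_omega {K : Type} [Field K] [NumberField K] (hK : Module.finrank ℚ K ≠ 1)
    (R : Subring K) (hspan : Submodule.span ℚ (R : Set K) = ⊤) :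
    ∃ ω : R, ∀ a b : ℤ, (a ≠ 0 ∨ b ≠ 0) → (a : R) + b * ω ≠ 0 := by
  by_contra hcon
  push Not at hcon
  have hb : (⊥ : Subalgebra ℚ K) = ⊤ := by
    have h1 : Submodule.span ℚ (R : Set K) ≤ Subalgebra.toSubmodule (⊥ : Subalgebra ℚ K) := by
      rw [Submodule.span_le]
      intro x hx
      obtain ⟨a, b, hab, h⟩ := hcon ⟨x, hx⟩
      have h' : (a : K) + b * x = 0 := by
        have := congrArg (Subtype.val) h
        simpa using this
      have hb : b ≠ 0 := by
        rintro rfl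
        simp at h'
        simp [h'] at hab
      have hb' : (b : K) ≠ 0 := by exact_mod_cast hb
      show x ∈ (⊥ : Subalgebra ℚ K)
      rw [Algebra.mem_bot]
      refine ⟨-a / b, ?_⟩
      simp
      field_simp
      linear_combination -h'
    rw [hspan] at h1
    rw [eq_top_iff]; exact h1
  exact hK (Subalgebra.bot_eq_top_iff_finrank_eq_one.1 hb)

theorem forward {K : Type} [Field K] [NumberField K] (hK : Module.finrank ℚ K ≠ 1) (R : Subring K)
    (hspan : Submodule.span ℚ (R : Set K) = ⊤) {G : Type} [Group G] [Finite G]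
    (H : Subgroup (MonoidAlgebra R G)ˣ) (hH : H.FiniteIndex) {m : ℕ} {X : Fin m → Type}
    (e : H ≃* ∀ j, FreeGroup (X j)) (hna : ¬ ∀ a b : G, a * b = b * a) :
    (∀ σ : K →+* ℂ, ∀ x : K, (σ x).im = 0) ∧
        ∃ (A : Type) (_ : CommGroup A), (∀ a : A, a ^ 2 = 1) ∧
          Nonempty (G ≃* QuaternionGroup 2 × A) := by
  obtain ⟨ω, hω⟩ := exists_omega hK R hspan
  have hna' : ∃ x y : G, ¬ Commute x y := by
    push Not at hna
    exact hna
  obtain ⟨ψ, C, hψ, hcomm, hCab, hsurj, hinter, hz, hC4⟩ :=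
    ded_struct (fun h g => ded_of_grp ω hω H hH e h g) hna'
  let _ : CommGroup C := { (inferInstance : Group C) with
    mul_comm := fun x y => Subtype.ext (hCab _ x.2 _ y.2) }
  let z : C := ⟨_, hz⟩
  have hz1 : z ≠ 1 := by
    intro h
    have h1 : ψ (.a 2) = ψ 1 := by rw [map_one]; exact congrArg Subtype.val h
    exact absurd (hψ h1) (by decide)
  have hz2 : z ^ 2 = 1 := by
    apply Subtype.ext
    show ψ (.a 2) ^ 2 = 1
    rw [← map_pow, show (QuaternionGroup.a 2 : QuaternionGroup 2) ^ 2 = 1 by decide, map_one]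
  have hpm : ∀ χ : C →* ℂˣ, χ z = 1 ∨ χ z = -1 := by
    intro χ
    have : (χ z) ^ 2 = 1 := by rw [← map_pow, hz2, map_one]
    have h2 : (χ z : ℂ) ^ 2 = 1 := by
      rw [← Units.val_pow_eq_pow_val, this, Units.val_one]
    rcases mul_self_eq_one_iff.1 ((sq _).symm.trans h2) with h | h
    · left; exact Units.ext h
    · right; exact Units.ext h
  have hex : ∀ c : C, c ≠ 1 → ∃ χ : C →* ℂˣ, χ c ≠ 1 := fun c hc =>
    CommGroup.exists_apply_ne_one_of_hasEnoughRootsOfUnity C ℂ hc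
  obtain ⟨χ1, hχ1⟩ := hex z hz1
  have hχ1 : χ1 z = -1 := (hpm χ1).resolve_left hχ1
  have core : ∀ χ : C →* ℂˣ, χ z = -1 → ∀ σ : K →+* ℂ,
      ((∃ x, (σ x).im ≠ 0) ∨ ∃ c, (χ c : ℂ).im ≠ 0) → False := fun χ hχ σ hcx =>
    forward_core R hspan ω hω H hH e ψ C hψ hcomm hCab hsurj hinter hz χ hχ σ hcx
  refine ⟨?_, ?_⟩
  · intro σ x
    by_contra hx
    exact core χ1 hχ1 σ (Or.inl ⟨x, hx⟩)
  · refine ded_iso ψ C hψ hcomm hCab hsurj hinter hz ?_ χ1 hχ1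
    intro c hc
    by_contra hc2
    have hσ : Nonempty (K →+* ℂ) := inferInstance
    obtain ⟨σ⟩ := hσ
    have key : ∀ χ : C →* ℂˣ, χ z = -1 → (χ ⟨c, hc⟩) ^ 2 = 1 := by
      intro χ hχ
      by_contra h
      refine core χ hχ σ (Or.inr ⟨⟨c, hc⟩, unit_im (n := Nat.card C) Nat.card_pos.ne' ?_ ?_⟩)
      · rw [← Units.val_pow_eq_pow_val, ← map_pow, pow_card_eq_one', map_one, Units.val_one]
      · intro h'
        apply h
        apply Units.ext
        rw [Units.val_pow_eq_pow_val, h', Units.val_one]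
    have hc4 : (⟨c, hc⟩ : C) ^ 4 ≠ 1 := fun h => hc2 (hC4 c hc (congrArg Subtype.val h))
    obtain ⟨χ2, hχ2⟩ := hex _ hc4
    have h1 := key χ1 hχ1
    have h2 := key (χ1 * χ2 ^ 2) (by
      rw [MonoidHom.mul_apply, MonoidHom.pow_apply, ← map_pow, hz2, map_one, mul_one, hχ1])
    rw [MonoidHom.mul_apply, mul_pow, h1, one_mul, MonoidHom.pow_apply, ← pow_mul, ← map_pow] at h2
    exact hχ2 h2

end GRU

namespace GRU

open NumberField

theorem fg_units0 {ι : Type} [Finite ι] (L : ι → Type) [∀ i, Field (L i)] [∀ i, NumberField (L i)]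
    {Γ : Type} [CommGroup Γ] (f : ∀ i, Γ →* L i) (hi : ∀ i γ, IsIntegral ℤ (f i γ))
    (hf : ∀ a b, (∀ i, f i a = f i b) → a = b) : Group.FG Γ := by
  let F0 : ∀ i, Γ →* 𝓞 (L i) := fun i =>
      { toFun := fun γ => (⟨f i γ, hi i γ⟩ : 𝓞 (L i))
        map_one' := Subtype.ext (map_one (f i))
        map_mul' := fun a b => Subtype.ext (map_mul (f i) a b) }
  let F : ∀ i, Γ →* (𝓞 (L i))ˣ := fun i => MonoidHom.toHomUnits (F0 i)
  let g : Additive Γ →+ ∀ i, Additive (𝓞 (L i))ˣ :=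
    { toFun := fun γ i => Additive.ofMul (F i γ.toMul)
      map_zero' := funext fun i => congrArg Additive.ofMul (map_one (F i))
      map_add' := fun a b => funext fun i =>
        congrArg Additive.ofMul (map_mul (F i) a.toMul b.toMul) }
  have hg : Function.Injective g := by
    intro a b hab
    apply Additive.toMul.injective
    apply hf
    intro i
    exact congrArg (fun u : Additive (𝓞 (L i))ˣ => ((u.toMul : 𝓞 (L i)) : L i)) (congrFun hab i)
  have hN : Module.Finite ℤ (Additive Γ) := Module.Finite.of_injective g.toIntLinearMap hg
  have := Module.Finite.iff_addGroup_fg.1 hN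
  exact GroupFG.iff_add_fg.2 this

theorem nf_of_surj {A L : Type} [CommRing A] [Algebra ℚ A] [FiniteDimensional ℚ A] [Field L]
    (f : A →+* L) (hf : Function.Surjective f) : NumberField L := by
  have hc : CharZero L := charZero_of_injective_ringHom (f.comp (algebraMap ℚ A)).injective
  refine { to_charZero := hc, to_finiteDimensional := ?_ }
  exact Module.Finite.of_surjective f.toAddMonoidHom.toRatLinearMap hf

/-- A group of integral units of a reduced finite-dimensional commutative `ℚ`-algebra is finitely
generated. -/
theorem fg_units {A : Type} [CommRing A] [Algebra ℚ A] [FiniteDimensional ℚ A] [IsReduced A]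
    {Γ : Type} [CommGroup Γ] (f : Γ →* A) (hf : Function.Injective f)
    (hi : ∀ γ, IsIntegral ℤ (f γ)) : Group.FG Γ := by
  have hart : IsArtinianRing A := IsArtinianRing.of_finite ℚ A
  let fld : ∀ P : MaximalSpectrum A, Field (A ⧸ P.asIdeal) := fun P =>
    Ideal.Quotient.field P.asIdeal
  have hnf : ∀ P : MaximalSpectrum A, NumberField (A ⧸ P.asIdeal) := by
    exact fun P => nf_of_surj (Ideal.Quotient.mk P.asIdeal) Ideal.Quotient.mk_surjective
  refine fg_units0 (fun P : MaximalSpectrum A => A ⧸ P.asIdeal)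
    (fun P => ((Ideal.Quotient.mk P.asIdeal) : A →* A ⧸ P.asIdeal).comp f)
    (fun P γ => (hi γ).map (Ideal.Quotient.mk P.asIdeal).toIntAlgHom) ?_
  intro a b hab
  apply hf
  rw [← sub_eq_zero]
  have h4 : IsNilpotent (f a - f b) := by
    rw [nilpotent_iff_mem_prime]
    intro J hJ
    have hm : J.IsMaximal := inferInstance
    exact Ideal.Quotient.eq.1 (hab ⟨J, hm⟩)
  exact h4.eq_zero

theorem virt_of_fg {Γ : Type} [Group Γ] (Z : Subgroup Γ) (hZ : Z.FiniteIndex)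
    (hc : ∀ a b : Z, a * b = b * a) (hfg : Group.FG Z) :
    ∃ H : Subgroup Γ, H.FiniteIndex ∧
      ∃ (m : ℕ) (X : Fin m → Type), Nonempty (↥H ≃* ∀ j, FreeGroup (X j)) := by
  let _ : CommGroup Z := { (inferInstance : Group Z) with mul_comm := hc }
  obtain ⟨ι, j, _, _, p, hp, e, ⟨E⟩⟩ := CommGroup.equiv_free_prod_prod_multiplicative_zmod Z
  have : ∀ i, NeZero (p i ^ e i) := fun i => ⟨pow_ne_zero _ (hp i).ne_zero⟩
  have : ∀ i, Finite (Multiplicative (ZMod (p i ^ e i))) := fun i =>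
    inferInstanceAs (Finite (ZMod (p i ^ e i)))
  let pr : Z →* ((i : ι) → Multiplicative (ZMod (p i ^ e i))) :=
    (MonoidHom.snd _ _).comp E.toMonoidHom
  let H0 : Subgroup Z := pr.ker
  have hH0 : H0.FiniteIndex := inferInstance
  let e1 : H0 ≃* (j → Multiplicative ℤ) :=
    { toFun := fun x => (E x).1
      invFun := fun y => ⟨E.symm (y, 1), by
        show (E (E.symm (y, 1))).2 = 1
        rw [E.apply_symm_apply]⟩
      left_inv := fun x => by
        apply Subtype.ext
        show E.symm ((E x).1, 1) = x
        rw [MulEquiv.symm_apply_eq]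
        have : (E x).2 = 1 := x.2
        rw [← this]
      right_inv := fun y => by
        show (E (E.symm (y, 1))).1 = y
        rw [E.apply_symm_apply]
      map_mul' := fun a b => by simp }
  refine ⟨H0.map Z.subtype, ?_, Fintype.card j, fun _ => Unit, ⟨?_⟩⟩
  · constructor
    rw [Subgroup.index_map_subtype]
    exact mul_ne_zero hH0.index_ne_zero hZ.index_ne_zero
  · let e2 : H0.map Z.subtype ≃* H0 := (H0.equivMapOfInjective _ Z.subtype_injective).symm
    let e3 : (j → Multiplicative ℤ) ≃* (Fin (Fintype.card j) → Multiplicative ℤ) :=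
      MulEquiv.arrowCongr (Fintype.equivFin j) (MulEquiv.refl _)
    let e4 : (Fin (Fintype.card j) → FreeGroup Unit) ≃* (Fin (Fintype.card j) → Multiplicative ℤ) :=
      MulEquiv.piCongrRight fun _ => FreeGroup.mulEquivIntOfUnique
    exact e2.trans (e1.trans (e3.trans e4.symm))

end GRU

namespace GRU

open NumberField MonoidAlgebra

/-- A central element of square zero in a semisimple ring vanishes. -/
theorem central_sq {A : Type*} [Ring A] [IsSemisimpleRing A] (x : A) (hx : ∀ y, x * y = y * x)
    (h : x * x = 0) : x = 0 := by
  obtain ⟨f, hf, hfx⟩ := right_id (Ideal.span {x})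
  obtain ⟨a, rfl⟩ := Ideal.mem_span_singleton'.1 hf
  rw [← hfx x (Ideal.mem_span_singleton_self x), ← mul_assoc, hx a, mul_assoc, h, mul_zero]

theorem central_of_comm {k G : Type*} [CommRing k] [Group G] (x : MonoidAlgebra k G)
    (h : ∀ g : G, x * single g 1 = single g 1 * x) (y : MonoidAlgebra k G) : x * y = y * x := by
  induction y using MonoidAlgebra.induction_linear with
  | zero => simp
  | add f g h1 h2 => rw [mul_add, add_mul, h1, h2]
  | single g r =>
    have : (single g r : MonoidAlgebra k G) = r • single g 1 := by simp
    rw [this, mul_smul_comm, h, smul_mul_assoc]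

/-- The unit of the group ring given by a group element. -/
noncomputable def gu (k : Type*) {G : Type*} [CommRing k] [Group G] (g : G) :
    (MonoidAlgebra k G)ˣ where
  val := single g 1
  inv := single g⁻¹ 1
  val_inv := by rw [single_mul_single, mul_inv_cancel, mul_one]; rfl
  inv_val := by rw [single_mul_single, inv_mul_cancel, mul_one]; rfl

theorem central_of_center {k G : Type*} [CommRing k] [Group G] (u : (MonoidAlgebra k G)ˣ)
    (hu : u ∈ Subgroup.center (MonoidAlgebra k G)ˣ) (y : MonoidAlgebra k G) :
    (u : MonoidAlgebra k G) * y = y * u := by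
  apply central_of_comm
  intro g
  have := Subgroup.mem_center_iff.1 hu (gu k g)
  exact (congrArg Units.val this).symm

theorem fin_RG {K : Type} [Field K] (R : Subring K) (hfg : R.toAddSubgroup.FG) (G : Type)
    [Group G] [Finite G] : Module.Finite ℤ (MonoidAlgebra R G) := by
  have h1 : Module.Finite ℤ R := by
    rw [Module.Finite.iff_addGroup_fg]
    exact (AddGroup.fg_iff_addSubgroup_fg R.toAddSubgroup).2 hfg
  let l : MonoidAlgebra R G →+ (G → R) :=
    { toFun := fun x g => x.coeff g
      map_zero' := by funext g; simp
      map_add' := fun a b => by funext g; simp }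
  refine Module.Finite.of_injective l.toIntLinearMap ?_
  intro x y hxy
  ext g
  exact congrArg Subtype.val (congrFun hxy g)

theorem center_fg {K : Type} [Field K] [NumberField K] (R : Subring K)
    (hfg : R.toAddSubgroup.FG) (G : Type) [Group G] [Finite G] :
    Group.FG (Subgroup.center (MonoidAlgebra R G)ˣ) := by
  let B := Subalgebra.center K (MonoidAlgebra K G)
  let φ := MonoidAlgebra.mapRingHom G R.subtype
  have hφ : Function.Injective φ := map_inj R G
  have hmem : ∀ u : Subgroup.center (MonoidAlgebra R G)ˣ,
      φ ((u : (MonoidAlgebra R G)ˣ) : MonoidAlgebra R G) ∈ B := by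
    intro u
    rw [Subalgebra.mem_center_iff]
    intro y
    symm
    apply central_of_comm
    intro g
    have h1 := central_of_center u.1 u.2 (single g 1)
    have h2 := congrArg φ h1
    rw [map_mul, map_mul] at h2
    have h3 : φ (single g 1) = single g 1 := by
      show MonoidAlgebra.mapRingHom G R.subtype _ = _
      rw [MonoidAlgebra.mapRingHom_single, map_one]
    rwa [h3] at h2
  let f : Subgroup.center (MonoidAlgebra R G)ˣ →* B :=
    { toFun := fun u => ⟨_, hmem u⟩
      map_one' := by apply Subtype.ext; simp
      map_mul' := fun a b => by apply Subtype.ext; simp }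
  have hf : Function.Injective f := by
    intro a b hab
    apply Subtype.ext
    apply Units.ext
    apply hφ
    exact congrArg Subtype.val hab
  have hred : IsReduced B := by
    rw [isReduced_iff_pow_one_lt 2 one_lt_two]
    intro x hx
    apply Subtype.ext
    apply central_sq
    · intro y
      exact (Subalgebra.mem_center_iff.1 x.2 y).symm
    · have := congrArg Subtype.val hx
      simpa [sq] using this
  have hfd0 : FiniteDimensional K (MonoidAlgebra K G) := inferInstance
  have hfd1 : FiniteDimensional K B := inferInstance
  have hfd : FiniteDimensional ℚ B := FiniteDimensional.trans ℚ K B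
  have hfin := fin_RG R hfg G
  let _ : CommGroup (Subgroup.center (MonoidAlgebra R G)ˣ) :=
    { (inferInstance : Group (Subgroup.center (MonoidAlgebra R G)ˣ)) with
      mul_comm := fun a b => Subtype.ext (Subgroup.mem_center_iff.1 b.2 a.1) }
  refine fg_units (A := B) (Γ := Subgroup.center (MonoidAlgebra R G)ˣ) f hf ?_
  intro u
  have h1 : IsIntegral ℤ ((u : (MonoidAlgebra R G)ˣ) : MonoidAlgebra R G) := IsIntegral.of_finite ℤ _
  have h2 := h1.map φ.toIntAlgHom
  have h3 := (isIntegral_algHom_iff (B.val.toRingHom.toIntAlgHom) (x := f u)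
    Subtype.val_injective).1 h2
  exact h3

end GRU

namespace GRU

open NumberField MonoidAlgebra

theorem fg_sub {Z : Type*} [CommGroup Z] [Group.FG Z] (B : Subgroup Z) : Group.FG B := by
  have h1 : Module.Finite ℤ (Additive Z) := Module.Finite.iff_addGroup_fg.2 inferInstance
  have h2 : Module.Finite ℤ (Additive B) :=
    Module.Finite.of_injective (MonoidHom.toAdditive B.subtype).toIntLinearMap
      (fun a b h => B.subtype_injective h)
  exact GroupFG.iff_add_fg.2 (Module.Finite.iff_addGroup_fg.1 h2)

theorem sq_index {B : Type*} [CommGroup B] [Group.FG B] :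
    (powMonoidHom 2 : B →* B).range.FiniteIndex := by
  have h : Finite (B ⧸ (powMonoidHom 2 : B →* B).range) := by
    apply CommGroup.finite_of_fg_isMulTorsion
    intro x
    obtain ⟨b, rfl⟩ := QuotientGroup.mk_surjective x
    rw [isOfFinOrder_iff_pow_eq_one]
    refine ⟨2, two_pos, ?_⟩
    rw [← QuotientGroup.mk_pow, QuotientGroup.eq_one_iff]
    exact ⟨b, rfl⟩
  exact Subgroup.finiteIndex_of_finite_quotient

theorem center_index {U : Type*} [Group U] (N : U →* U) (hN : ∀ u, N u ∈ Subgroup.center U)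
    (hN2 : ∀ u, N (N u) = N u ^ 2) (hker : Finite N.ker) (hfg : Group.FG (Subgroup.center U)) :
    (Subgroup.center U).FiniteIndex := by
  let _ : CommGroup (Subgroup.center U) :=
    { (inferInstance : Group (Subgroup.center U)) with
      mul_comm := fun a b => Subtype.ext (Subgroup.mem_center_iff.1 b.2 a.1) }
  let N' : U →* Subgroup.center U := N.codRestrict _ hN
  have hB : Group.FG N'.range := fg_sub N'.range
  have hS := sq_index (B := N'.range)
  let E : Subgroup U := (powMonoidHom 2 : N'.range →* N'.range).range.comap N'.rangeRestrict
  have hE : E.FiniteIndex := by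
    constructor
    rw [Subgroup.index_comap_of_surjective _ N'.rangeRestrict_surjective]
    exact hS.index_ne_zero
  have hEk : ∀ u ∈ E, ∃ v, ∃ k : N.ker, u = k * N v := by
    rintro u ⟨⟨_, v, rfl⟩, hb⟩
    have h1 : N v ^ 2 = N u := congrArg (fun x : N'.range => ((x : Subgroup.center U) : U)) hb
    refine ⟨v, ⟨u * (N v)⁻¹, ?_⟩, ?_⟩
    · rw [MonoidHom.mem_ker, map_mul, map_inv, hN2, h1, mul_inv_cancel]
    · simp
  have hfq : Finite (U ⧸ E) := inferInstance
  let F : (U ⧸ E) × N.ker → U ⧸ Subgroup.center U := fun p => ((p.1.out * p.2 : U) : U ⧸ _)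
  have hF : Function.Surjective F := by
    intro x
    obtain ⟨u, rfl⟩ := QuotientGroup.mk_surjective x
    have h1 : ((u : U ⧸ E).out)⁻¹ * u ∈ E := by
      rw [← QuotientGroup.eq, QuotientGroup.out_eq']
    obtain ⟨v, k, hk⟩ := hEk _ h1
    refine ⟨((u : U ⧸ E), k), ?_⟩
    show ((_ : U) : U ⧸ Subgroup.center U) = _
    rw [QuotientGroup.eq]
    have h2 : u = (u : U ⧸ E).out * (k * N v) := by rw [← hk]; group
    have : ((u : U ⧸ E).out * k)⁻¹ * u = N v := by
      conv_lhs => rw [mul_inv_rev]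
      rw [mul_assoc, hk]; group
    rw [this]; exact hN v
  have : Finite (U ⧸ Subgroup.center U) := Finite.of_surjective F hF
  exact Subgroup.finiteIndex_of_finite_quotient

section
variable {k G : Type*} [CommRing k] [Group G]

theorem sym_central (hG : ∀ g h : G, h * g * h⁻¹ = g ∨ h * g * h⁻¹ = g⁻¹) (x : MonoidAlgebra k G)
    (hx : st x = x) (y : MonoidAlgebra k G) : x * y = y * x := by
  apply central_of_comm
  intro h
  ext g
  rw [MonoidAlgebra.coeff_mul_single_apply, MonoidAlgebra.coeff_single_mul_apply, one_mul, mul_one]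
  have h1 := hG (g * h⁻¹) h⁻¹
  have h2 : h⁻¹ * (g * h⁻¹) * h⁻¹⁻¹ = h⁻¹ * g := by group
  rw [h2] at h1
  rcases h1 with h1 | h1
  · rw [h1]
  · rw [h1, ← st_coeff, hx]

/-- The involution on units. -/
noncomputable def stU (u : (MonoidAlgebra k G)ˣ) : (MonoidAlgebra k G)ˣ where
  val := st (u : MonoidAlgebra k G)
  inv := st ((u⁻¹ : (MonoidAlgebra k G)ˣ) : MonoidAlgebra k G)
  val_inv := by rw [← st_mul, Units.inv_mul, st_one]
  inv_val := by rw [← st_mul, Units.mul_inv, st_one]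

theorem stU_mul (u v : (MonoidAlgebra k G)ˣ) : stU (u * v) = stU v * stU u :=
  Units.ext (st_mul _ _)

theorem stU_stU (u : (MonoidAlgebra k G)ˣ) : stU (stU u) = u := Units.ext (st_st _)

theorem nrm_center (hG : ∀ g h : G, h * g * h⁻¹ = g ∨ h * g * h⁻¹ = g⁻¹)
    (u : (MonoidAlgebra k G)ˣ) : u * stU u ∈ Subgroup.center (MonoidAlgebra k G)ˣ := by
  rw [Subgroup.mem_center_iff]
  intro v
  apply Units.ext
  refine (sym_central hG ((u * stU u : (MonoidAlgebra k G)ˣ) : MonoidAlgebra k G) ?_ v).symm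
  have : stU (u * stU u) = u * stU u := by rw [stU_mul, stU_stU]
  exact congrArg Units.val this

/-- The norm on units. -/
noncomputable def nrm (hG : ∀ g h : G, h * g * h⁻¹ = g ∨ h * g * h⁻¹ = g⁻¹) :
    (MonoidAlgebra k G)ˣ →* (MonoidAlgebra k G)ˣ where
  toFun u := u * stU u
  map_one' := by rw [one_mul]; exact Units.ext st_one
  map_mul' u v := by
    have h := Subgroup.mem_center_iff.1 (nrm_center hG v) u
    rw [stU_mul]
    calc u * v * (stU v * stU u) = (u * (v * stU v)) * stU u := by group
      _ = (v * stU v) * (u * stU u) := by rw [h]; group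
      _ = _ := (Subgroup.mem_center_iff.1 (nrm_center hG v) _).symm

end

theorem nrm_ker {K : Type} [Field K] [NumberField K] (R : Subring K)
    (hfg : R.toAddSubgroup.FG) {G : Type} [Group G] [Finite G]
    (hG : ∀ g h : G, h * g * h⁻¹ = g ∨ h * g * h⁻¹ = g⁻¹)
    (hreal : ∀ σ : K →+* ℂ, ∀ x : K, (σ x).im = 0) : Finite (nrm (k := R) hG).ker := by
  cases nonempty_fintype G
  have h1 : Module.Finite ℤ R := by
    rw [Module.Finite.iff_addGroup_fg]
    exact (AddGroup.fg_iff_addSubgroup_fg R.toAddSubgroup).2 hfg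
  let S : Set K := {x : K | IsIntegral ℤ x ∧ ∀ φ : K →+* ℂ, ‖φ x‖ ≤ 1}
  have hS : S.Finite := Embeddings.finite_of_norm_le K ℂ 1
  have hSf : Finite S := hS
  have hmem : ∀ u : (nrm (k := R) hG).ker, ∀ g : G,
      ((((u : (MonoidAlgebra R G)ˣ) : MonoidAlgebra R G).coeff g : R) : K) ∈ S := by
    intro u g
    set x := ((u : (MonoidAlgebra R G)ˣ) : MonoidAlgebra R G) with hx
    refine ⟨(IsIntegral.of_finite ℤ (x.coeff g)).map R.subtype.toIntAlgHom, ?_⟩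
    intro φ
    have h2 : x * st x = 1 := congrArg Units.val u.2
    have h3 := mul_st_coeff x
    rw [h2] at h3
    have h4 : (1 : R) = ∑ g, x.coeff g ^ 2 := by
      rw [← h3, MonoidAlgebra.one_def]; simp
    have h5 : (1 : ℂ) = ∑ g, (φ (x.coeff g : R)) ^ 2 := by
      have := congrArg (fun r : R => φ r) h4
      simpa using this
    have h6 : ∀ g, φ (x.coeff g : R) = ((φ (x.coeff g : R)).re : ℂ) := fun g =>
      Complex.ext (by simp) (by simp [hreal])
    have h7 : (1 : ℝ) = ∑ g, (φ (x.coeff g : R)).re ^ 2 := by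
      have h8 : (1 : ℂ) = ∑ g, (((φ (x.coeff g : R)).re : ℝ) : ℂ) ^ 2 := by
        rw [h5]; exact Finset.sum_congr rfl fun g _ => by rw [← h6]
      exact_mod_cast h8
    have h9 : (φ (x.coeff g : R)).re ^ 2 ≤ 1 := by
      rw [h7]
      exact Finset.single_le_sum (f := fun g => (φ (x.coeff g : R)).re ^ 2)
        (fun i _ => sq_nonneg _) (Finset.mem_univ g)
    rw [h6, Complex.norm_real, Real.norm_eq_abs]
    exact (sq_le_one_iff_abs_le_one _).1 h9
  refine Finite.of_injective (fun u : (nrm (k := R) hG).ker => fun g : G => (⟨_, hmem u g⟩ : S)) ?_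
  intro u v huv
  apply Subtype.ext
  apply Units.ext
  ext g
  exact congrArg (fun s : S => (s : K)) (congrFun huv g)

theorem backward_q {K : Type} [Field K] [NumberField K] (R : Subring K)
    (hfg : R.toAddSubgroup.FG) {G : Type} [Group G] [Finite G]
    (hG : ∀ g h : G, h * g * h⁻¹ = g ∨ h * g * h⁻¹ = g⁻¹)
    (hreal : ∀ σ : K →+* ℂ, ∀ x : K, (σ x).im = 0) :
    (Subgroup.center (MonoidAlgebra R G)ˣ).FiniteIndex := by
  refine center_index (nrm (k := R) hG) (nrm_center hG) ?_ (nrm_ker R hfg hG hreal)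
    (center_fg R hfg G)
  intro u
  show (u * stU u) * stU (u * stU u) = (u * stU u) ^ 2
  rw [stU_mul, stU_stU, sq]

theorem q8_conj : ∀ g h : QuaternionGroup 2, h * g * h⁻¹ = g ∨ h * g * h⁻¹ = g⁻¹ := by decide

theorem backward {K : Type} [Field K] [NumberField K] (R : Subring K)
    (hfg : R.toAddSubgroup.FG) {G : Type} [Group G] [Finite G]
    (h : (∀ a b : G, a * b = b * a) ∨
      ((∀ σ : K →+* ℂ, ∀ x : K, (σ x).im = 0) ∧
        ∃ (A : Type) (_ : CommGroup A), (∀ a : A, a ^ 2 = 1) ∧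
          Nonempty (G ≃* QuaternionGroup 2 × A))) :
    ∃ H : Subgroup (MonoidAlgebra R G)ˣ, H.FiniteIndex ∧
      ∃ (m : ℕ) (X : Fin m → Type), Nonempty (↥H ≃* ∀ j, FreeGroup (X j)) := by
  refine virt_of_fg (Subgroup.center (MonoidAlgebra R G)ˣ) ?_
    (fun a b => Subtype.ext (Subgroup.mem_center_iff.1 b.2 a.1)) (center_fg R hfg G)
  rcases h with h | ⟨hreal, A, _, hA, ⟨E⟩⟩
  · have : Subgroup.center (MonoidAlgebra R G)ˣ = ⊤ := by
      rw [eq_top_iff]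
      intro u _
      rw [Subgroup.mem_center_iff]
      intro v
      apply Units.ext
      refine central_of_comm (v : MonoidAlgebra R G) (fun g => ?_) u
      symm
      apply central_of_comm
      intro g'
      rw [single_mul_single, single_mul_single, h]
    rw [this]; infer_instance
  · refine backward_q R hfg ?_ hreal
    intro g h
    have key : E h * E g * (E h)⁻¹ = E g ∨ E h * E g * (E h)⁻¹ = (E g)⁻¹ := by
      have ha : ∀ a : A, a⁻¹ = a := fun a => by
        rw [inv_eq_iff_mul_eq_one, ← sq, hA]
      rcases q8_conj (E g).1 (E h).1 with h1 | h1
      · left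
        exact Prod.ext h1 (by simp [mul_comm])
      · right
        refine Prod.ext h1 ?_
        show (E h).2 * (E g).2 * (E h).2⁻¹ = (E g).2⁻¹
        rw [ha (E g).2, mul_comm, inv_mul_cancel_left]
    rw [← map_mul, ← map_inv, ← map_mul, ← map_inv] at key
    exact key.imp (fun h => E.injective h) (fun h => E.injective h)

end GRU

/-- Let `K ≠ ℚ` be a number field, `R` an order in `K` and `G` a
finite group. Then the unit group of the group ring `RG` is virtually a direct
product of finitely many free groups iff either `G` is abelian, or `K` is totally
real and `G ≅ Q₈ × A` for `A` an elementary abelian 2-group. -/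
theorem group_ring_units_virtually_product_of_free_iff
    (K : Type) [Field K] [NumberField K] (hK : Module.finrank ℚ K ≠ 1)
    (R : Subring K) (hR : IsOrderIn R)
    (G : Type) [Group G] [Finite G] :
    IsVirtuallyDirectProductOfFreeGroups (MonoidAlgebra ↥R G)ˣ ↔
      (∀ a b : G, a * b = b * a) ∨
      ((∀ σ : K →+* ℂ, ∀ x : K, (σ x).im = 0) ∧
        ∃ (A : Type) (_ : CommGroup A), (∀ a : A, a ^ 2 = 1) ∧
          Nonempty (G ≃* QuaternionGroup 2 × A)) := by
  constructor
  · rintro ⟨H, hH, m, X, ⟨e⟩⟩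
    by_cases hna : ∀ a b : G, a * b = b * a
    · exact Or.inl hna
    · exact Or.inr (GRU.forward hK R hR.2 H hH e hna)
  · intro h
    exact GRU.backward R hR.1 h
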